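/- There exist D ∈ ℕ, a sequence of finite connected simple graphs G_n = (V_n, E_n) with maximal degree at most D and |V_n| → ∞, and constants c,C > 0 with c·t_mix(G_n) ≤ t_rel(G_n) ≤ C·t_mix(G_n) for all n (so the sequence of LSRWs does not exhibit pre-cutoff), such that for every ε > 0 there are a constant c_ε > 0 and, for each n, edge weights w^{(n)} : E_n → {1, 1+ε} with t_mix(G_n,(w_e^{(n)})) ≥ c_ε·log|V_n|·t_mix(G_n) for all sufficiently large n; moreover the sequence of lazy random walks on the weighted networks (G_n,(w_e^{(n)})) exhibits total variation cutoff. -/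

import Mathlib

open Filter Finset

noncomputable section

variable {V : Type} [Fintype V] [DecidableEq V]

/-- `P` is a row-stochastic matrix. -/
def IsStoch (P : Matrix V V ℝ) : Prop :=
  (∀ i j, 0 ≤ P i j) ∧ ∀ i, ∑ j, P i j = 1

/-- `π` is a probability vector with full support. -/
def IsProb (π : V → ℝ) : Prop := (∀ i, 0 < π i) ∧ ∑ i, π i = 1

/-- reversibility: `π x * P x y = π y * P y x`. -/
def Rev (P : Matrix V V ℝ) (π : V → ℝ) : Prop := ∀ i j, π i * P i j = π j * P j i

/-- irreducibility -/
def Irred (P : Matrix V V ℝ) : Prop := ∀ i j, ∃ t : ℕ, 0 < (P ^ t) i j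

/-- the lazy version `(I + P)/2` of a chain -/
def lazyM (P : Matrix V V ℝ) : Matrix V V ℝ := (2 : ℝ)⁻¹ • (1 + P)

/-- total variation distance -/
def tvDist (μ ν : V → ℝ) : ℝ := (∑ x, |μ x - ν x|) / 2

/-- worst-case total variation distance from stationarity at time `t` -/
def dTV (P : Matrix V V ℝ) (π : V → ℝ) (t : ℕ) : ℝ := ⨆ x, tvDist ((P ^ t) x) π

/-- the `ε` total-variation mixing time -/
def mixTime (P : Matrix V V ℝ) (π : V → ℝ) (ε : ℝ) : ℕ := sInf {t : ℕ | dTV P π t ≤ ε}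

/-- worst-case separation distance at time `t` -/
def dSep (P : Matrix V V ℝ) (π : V → ℝ) (t : ℕ) : ℝ := 1 - ⨅ x, ⨅ y, ((P ^ t) x y) / π y

/-- the `ε` separation time -/
def sepTime (P : Matrix V V ℝ) (π : V → ℝ) (ε : ℝ) : ℕ := sInf {t : ℕ | dSep P π t ≤ ε}

/-- the heat kernel `H_t = exp (t (P - I))` of the associated continuous-time chain -/
def heatKer (P : Matrix V V ℝ) (t : ℝ) : Matrix V V ℝ :=
  ∑' k : ℕ, (t ^ k / (Nat.factorial k : ℝ)) • ((P - 1) ^ k)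

/-- separation distance of the continuous-time chain -/
def dSepC (P : Matrix V V ℝ) (π : V → ℝ) (t : ℝ) : ℝ := 1 - ⨅ x, ⨅ y, (heatKer P t) x y / π y

/-- the `ε` separation time of the continuous-time chain -/
def sepTimeC (P : Matrix V V ℝ) (π : V → ℝ) (ε : ℝ) : ℝ := sInf {t : ℝ | 0 ≤ t ∧ dSepC P π t ≤ ε}

/-- degree of a vertex -/
def deg (G : SimpleGraph V) (v : V) : ℕ := Nat.card {u // G.Adj v u}

open Classical in
/-- transition matrix of the lazy simple random walk on `G` -/
def walkMat (G : SimpleGraph V) : Matrix V V ℝ :=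
  Matrix.of fun v u => if v = u then 1/2 else if G.Adj v u then 1 / (2 * (deg G v : ℝ)) else 0

/-- stationary distribution of the (lazy) simple random walk on `G` -/
def degSta (G : SimpleGraph V) (v : V) : ℝ := (deg G v : ℝ) / ∑ u, (deg G u : ℝ)

/-- the `ε` total-variation mixing time of the lazy simple random walk on `G` -/
def tmixG (G : SimpleGraph V) (ε : ℝ) : ℕ := mixTime (walkMat G) (degSta G) ε

/-- the second largest eigenvalue of a reversible transition matrix -/
def lam2 (P : Matrix V V ℝ) : ℝ :=
  sSup {μ : ℝ | μ ≠ 1 ∧ ∃ f : V → ℝ, f ≠ 0 ∧ P.mulVec f = μ • f}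

/-- the relaxation time `1/(1-λ₂)` -/
def trel (P : Matrix V V ℝ) : ℝ := 1 / (1 - lam2 P)

/-- the relaxation time of the lazy simple random walk on `G` -/
def trelG (G : SimpleGraph V) : ℝ := trel (walkMat G)

/-- transition matrix of the lazy random walk on the network with edge weights `w` -/
def wMat (w : V → V → ℝ) : Matrix V V ℝ :=
  Matrix.of fun v u => if v = u then 1/2 else w v u / (2 * ∑ x, w v x)

/-- stationary distribution of the lazy random walk on the network with edge weights `w` -/
def wSta (w : V → V → ℝ) (v : V) : ℝ := (∑ x, w v x) / ∑ u, ∑ x, w u x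

/-- `w` is a valid system of edge weights on the graph `G`: symmetric, positive on edges
and vanishing off the edges. -/
def GoodWeights (G : SimpleGraph V) (w : V → V → ℝ) : Prop :=
  (∀ u v, w u v = w v u) ∧ (∀ u v, G.Adj u v → 0 < w u v) ∧ ∀ u v, ¬ G.Adj u v → w u v = 0

/-- the `ε` total-variation mixing time of the lazy random walk on the weighted network -/
def tmixW (w : V → V → ℝ) (ε : ℝ) : ℕ := mixTime (wMat w) (wSta w) ε

/-- the probability of a discrete trajectory -/
def pathProb (P : Matrix V V ℝ) {k : ℕ} (w : Fin (k+1) → V) : ℝ :=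
  ∏ i : Fin k, P (w i.castSucc) (w i.succ)

/-- `P_x[T_y = k]`: probability that the chain started at `x` first hits `y` at time `k` -/
def firstHit (P : Matrix V V ℝ) (x y : V) (k : ℕ) : ℝ :=
  ∑ w : Fin (k+1) → V,
    if w 0 = x ∧ w (Fin.last k) = y ∧ ∀ i : Fin k, w i.castSucc ≠ y then pathProb P w else 0

/-- the restriction of `P - I` to the complement of `y` -/
def restrQ (P : Matrix V V ℝ) (y : V) : Matrix {w : V // w ≠ y} {w : V // w ≠ y} ℝ :=
  Matrix.of fun a b => P a.1 b.1 - if a = b then 1 else 0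

/-- `exp (t A)` where `A` is the restriction of `P - I` to the complement of `y` -/
def heatRestr (P : Matrix V V ℝ) (y : V) (t : ℝ) :
    Matrix {w : V // w ≠ y} {w : V // w ≠ y} ℝ :=
  ∑' k : ℕ, (t ^ k / (Nat.factorial k : ℝ)) • (restrQ P y ^ k)

/-- `P_x[T_B < r]` for the chain `P`: the probability that the set `B` is hit before time `r` -/
def hitByTime (P : Matrix V V ℝ) (B : Finset V) (x : V) (r : ℕ) : ℝ :=
  ∑ k ∈ Finset.range r, ∑ w : Fin (k+1) → V,
    if w 0 = x ∧ w (Fin.last k) ∈ B ∧ ∀ i : Fin k, w i.castSucc ∉ B then pathProb P w else 0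

set_option linter.unusedSectionVars false

/-- A lazy reversible chain with full support stationary distribution. -/
structure IsLazyChain (P : Matrix V V ℝ) (π : V → ℝ) : Prop where
  stoch : IsStoch P
  prob : IsProb π
  rev : Rev P π
  lazy : ∀ x, 1 / 2 ≤ P x x

/-- The bilinear form `∑ π f g`. -/
def ip (π f g : V → ℝ) : ℝ := ∑ x, π x * f x * g x

/-- The survival probability `P_x(T_A > t)`. -/
def surv (P : Matrix V V ℝ) (A : V → Prop) [DecidablePred A] : ℕ → V → ℝ
  | 0 => fun x => if A x then 0 else 1
  | t + 1 => fun x => if A x then 0 else P.mulVec (surv P A t) x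

section general

variable {P : Matrix V V ℝ} {π : V → ℝ}

omit [DecidableEq V] in
theorem mulVec_apply (P : Matrix V V ℝ) (f : V → ℝ) (x : V) :
    P.mulVec f x = ∑ y, P x y * f y := rfl

omit [DecidableEq V] in
theorem IsStoch.mulVec_mono (h : IsStoch P) {f g : V → ℝ} (hfg : ∀ x, f x ≤ g x) (x : V) :
    P.mulVec f x ≤ P.mulVec g x :=
  sum_le_sum fun y _ => mul_le_mul_of_nonneg_left (hfg y) (h.1 x y)

omit [DecidableEq V] in
theorem IsStoch.mulVec_const (h : IsStoch P) (c : ℝ) (x : V) :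
    P.mulVec (fun _ => c) x = c := by
  rw [mulVec_apply, ← sum_mul, h.2, one_mul]

omit [DecidableEq V] in
theorem IsStoch.mulVec_nonneg (h : IsStoch P) {f : V → ℝ} (hf : ∀ x, 0 ≤ f x) (x : V) :
    0 ≤ P.mulVec f x :=
  sum_nonneg fun y _ => mul_nonneg (h.1 x y) (hf y)

theorem IsStoch.pow (h : IsStoch P) (t : ℕ) : IsStoch (P ^ t) := by
  induction t with
  | zero =>
    refine ⟨fun i j => ?_, fun i => ?_⟩
    · rw [pow_zero, Matrix.one_apply]; split_ifs <;> norm_num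
    · simp [Matrix.one_apply]
  | succ t ih =>
    refine ⟨fun i j => ?_, fun i => ?_⟩
    · rw [pow_succ, Matrix.mul_apply]
      exact sum_nonneg fun k _ => mul_nonneg (ih.1 i k) (h.1 k j)
    · simp only [pow_succ, Matrix.mul_apply]
      rw [sum_comm]
      simp only [← mul_sum, h.2, mul_one, ih.2]

namespace IsLazyChain

variable (hc : IsLazyChain P π)
include hc

theorem sum_mulVec (f : V → ℝ) : ∑ x, π x * P.mulVec f x = ∑ x, π x * f x := by
  simp only [mulVec_apply, mul_sum]
  rw [sum_comm]
  refine sum_congr rfl fun y _ => ?_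
  rw [← mul_one (π y * f y), ← hc.stoch.2 y, mul_sum]
  refine sum_congr rfl fun x _ => ?_
  rw [← mul_assoc, hc.rev x y]; ring

theorem ip_mulVec (f g : V → ℝ) : ip π f (P.mulVec g) = ip π (P.mulVec f) g := by
  simp only [ip, mulVec_apply, mul_sum, sum_mul]
  rw [sum_comm]
  refine sum_congr rfl fun y _ => sum_congr rfl fun x _ => ?_
  have := hc.rev x y
  linear_combination f x * g y * this

theorem sq_mulVec_le (f : V → ℝ) (x : V) :
    (P.mulVec f x) ^ 2 ≤ P.mulVec (fun y => f y ^ 2) x := by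
  set m := P.mulVec f x with hm
  have h0 : 0 ≤ P.mulVec (fun y => (f y - m) ^ 2) x :=
    hc.stoch.mulVec_nonneg (fun y => sq_nonneg _) x
  have h1 : P.mulVec (fun y => (f y - m) ^ 2) x =
      P.mulVec (fun y => f y ^ 2) x - 2 * m * P.mulVec f x + m ^ 2 * ∑ y, P x y := by
    simp only [mulVec_apply, mul_sum, ← sum_sub_distrib, ← sum_add_distrib]
    exact sum_congr rfl fun y _ => by ring
  rw [hc.stoch.2, ← hm] at h1
  nlinarith

theorem ip_mulVec_mulVec_le (f : V → ℝ) : ip π (P.mulVec f) (P.mulVec f) ≤ ip π f f := by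
  calc ip π (P.mulVec f) (P.mulVec f) = ∑ x, π x * (P.mulVec f x) ^ 2 :=
        sum_congr rfl fun x _ => by ring
    _ ≤ ∑ x, π x * P.mulVec (fun y => f y ^ 2) x :=
        sum_le_sum fun x _ => mul_le_mul_of_nonneg_left (hc.sq_mulVec_le f x) (hc.prob.1 x).le
    _ = ∑ x, π x * f x ^ 2 := hc.sum_mulVec _
    _ = ip π f f := sum_congr rfl fun x _ => by ring

theorem ip_self_mulVec_nonneg (f : V → ℝ) : 0 ≤ ip π f (P.mulVec f) := by
  set Q : V → V → ℝ := fun x y => P x y - if x = y then 1 / 2 else 0 with hQ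
  have hQ0 : ∀ x y, 0 ≤ Q x y := by
    intro x y
    by_cases h : x = y
    · subst h; simp only [hQ, if_true]; linarith [hc.lazy x]
    · simp only [hQ, h, if_false, sub_zero]; exact hc.stoch.1 x y
  have h0 : 0 ≤ ∑ x, ∑ y, π x * Q x y * (f x + f y) ^ 2 :=
    sum_nonneg fun x _ => sum_nonneg fun y _ =>
      mul_nonneg (mul_nonneg (hc.prob.1 x).le (hQ0 x y)) (sq_nonneg _)
  have e1 : ∀ x y, π x * Q x y * (f x + f y) ^ 2 =
      f x ^ 2 * (π x * P x y) + (π x * P x y) * f y ^ 2 + 2 * (π x * f x * (P x y * f y))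
        - if x = y then 2 * (π x * f x ^ 2) else 0 := by
    intro x y
    by_cases h : x = y
    · subst h; simp only [hQ, if_true]; ring
    · simp only [hQ, h, if_false]; ring
  have e2 : ∑ x, ∑ y, π x * Q x y * (f x + f y) ^ 2 = 2 * ip π f (P.mulVec f) := by
    simp only [e1, sum_sub_distrib, sum_add_distrib, sum_ite_eq, mem_univ, if_true]
    have a1 : ∑ x, ∑ y, f x ^ 2 * (π x * P x y) = ∑ x, π x * f x ^ 2 := by
      refine sum_congr rfl fun x _ => ?_
      rw [← mul_sum, ← mul_sum, hc.stoch.2]; ring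
    have a2 : ∑ x, ∑ y, π x * P x y * f y ^ 2 = ∑ x, π x * f x ^ 2 := by
      rw [← hc.sum_mulVec]
      simp only [mulVec_apply, mul_sum, mul_assoc]
    have a3 : ∑ x, ∑ y, 2 * (π x * f x * (P x y * f y)) = 2 * ip π f (P.mulVec f) := by
      simp only [ip, mulVec_apply, mul_sum]
    rw [a1, a2, a3, ← mul_sum]; ring
  linarith

end IsLazyChain

/-! ### Total variation distance -/

omit [DecidableEq V] in
theorem tvDist_le_one {μ ν : V → ℝ} (h0 : ∀ x, 0 ≤ μ x) (h1 : ∑ x, μ x = 1)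
    (h2 : IsProb ν) : tvDist μ ν ≤ 1 := by
  have : ∑ x, |μ x - ν x| ≤ ∑ x, (μ x + ν x) := sum_le_sum fun x _ => by
    rw [abs_le]; constructor <;> linarith [h0 x, h2.1 x]
  rw [sum_add_distrib, h1, h2.2] at this
  unfold tvDist; linarith

omit [DecidableEq V] in
/-- Lower bound on total variation by the mass defect on a set. -/
theorem sum_sub_sum_le_tvDist {μ ν : V → ℝ} (h1 : ∑ x, μ x = 1) (h2 : ∑ x, ν x = 1)
    (S : V → Prop) [DecidablePred S] :
    (∑ x, if S x then μ x else 0) - (∑ x, if S x then ν x else 0) ≤ tvDist μ ν := by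
  have e1 : ∑ x, (if S x then μ x - ν x else 0) =
      (∑ x, if S x then μ x else 0) - (∑ x, if S x then ν x else 0) := by
    rw [← sum_sub_distrib]; exact sum_congr rfl fun x _ => by split_ifs <;> simp
  have e2 : ∑ x, (μ x - ν x) = 0 := by rw [sum_sub_distrib, h1, h2, sub_self]
  have : ∑ x, (2 * (if S x then μ x - ν x else 0) - (μ x - ν x)) ≤ ∑ x, |μ x - ν x| :=
    sum_le_sum fun x _ => by
      split_ifs
      · linarith [le_abs_self (μ x - ν x)]
      · linarith [neg_abs_le (μ x - ν x)]
  rw [sum_sub_distrib, ← mul_sum, e1, e2] at this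
  unfold tvDist; linarith

namespace IsLazyChain
variable (hc : IsLazyChain P π)
include hc

theorem tvDist_pow_le_one (t : ℕ) (x : V) : tvDist ((P ^ t) x) π ≤ 1 :=
  tvDist_le_one (fun y => (hc.stoch.pow t).1 x y) ((hc.stoch.pow t).2 x) hc.prob

theorem tvDist_succ_le_mulVec (t : ℕ) (x : V) :
    tvDist ((P ^ (t + 1)) x) π ≤ P.mulVec (fun z => tvDist ((P ^ t) z) π) x := by
  have h : ∀ y, |(P ^ (t + 1)) x y - π y| ≤ ∑ z, P x z * |(P ^ t) z y - π y| := by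
    intro y
    have : (P ^ (t + 1)) x y - π y = ∑ z, P x z * ((P ^ t) z y - π y) := by
      simp only [mul_sub, sum_sub_distrib, ← sum_mul, hc.stoch.2, one_mul]
      rw [pow_succ', Matrix.mul_apply]
    rw [this]
    refine (abs_sum_le_sum_abs _ _).trans_eq (sum_congr rfl fun z _ => ?_)
    rw [abs_mul, abs_of_nonneg (hc.stoch.1 x z)]
  have h2 := sum_le_sum fun y (_ : y ∈ univ) => h y
  rw [sum_comm] at h2
  simp only [← mul_sum] at h2
  simp only [tvDist, mulVec_apply]
  simp only [mul_div_assoc', ← sum_div]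
  linarith

theorem stationary (y : V) : ∑ x, π x * P x y = π y := by
  simp only [hc.rev _ y, ← mul_sum, hc.stoch.2, mul_one]

theorem tvDist_succ_le (t : ℕ) (x : V) :
    tvDist ((P ^ (t + 1)) x) π ≤ tvDist ((P ^ t) x) π := by
  have h : ∀ y, |(P ^ (t + 1)) x y - π y| ≤ ∑ z, |(P ^ t) x z - π z| * P z y := by
    intro y
    have : (P ^ (t + 1)) x y - π y = ∑ z, ((P ^ t) x z - π z) * P z y := by
      simp only [sub_mul, sum_sub_distrib, hc.stationary]
      rw [pow_succ, Matrix.mul_apply]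
    rw [this]
    refine (abs_sum_le_sum_abs _ _).trans_eq (sum_congr rfl fun z _ => ?_)
    rw [abs_mul, abs_of_nonneg (hc.stoch.1 z y)]
  have h2 := sum_le_sum fun y (_ : y ∈ univ) => h y
  rw [sum_comm] at h2
  simp only [← mul_sum, hc.stoch.2, mul_one] at h2
  simp only [tvDist]
  linarith

theorem tvDist_antitone (x : V) : Antitone fun t => tvDist ((P ^ t) x) π :=
  antitone_nat_of_succ_le fun t => hc.tvDist_succ_le t x

theorem tvDist_le_dTV (t : ℕ) (x : V) : tvDist ((P ^ t) x) π ≤ dTV P π t :=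
  le_ciSup (f := fun x => tvDist ((P ^ t) x) π) (Set.finite_range _).bddAbove x

theorem nonempty : Nonempty V := by
  by_contra h
  rw [not_nonempty_iff] at h
  have := hc.prob.2
  simp at this

theorem dTV_le {t : ℕ} {ε : ℝ} (h : ∀ x, tvDist ((P ^ t) x) π ≤ ε) : dTV P π t ≤ ε :=
  have := hc.nonempty
  ciSup_le h

theorem le_mixTime {t s : ℕ} {ε : ℝ} {x : V} (h : ε < tvDist ((P ^ t) x) π)
    (hs : dTV P π s ≤ ε) : t ≤ mixTime P π ε := by
  have hmem : mixTime P π ε ∈ {t : ℕ | dTV P π t ≤ ε} := Nat.sInf_mem ⟨s, hs⟩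
  by_contra hlt
  push Not at hlt
  have h1 := hc.tvDist_antitone x hlt.le
  have h2 := hc.tvDist_le_dTV (mixTime P π ε) x
  have h3 : dTV P π (mixTime P π ε) ≤ ε := hmem
  simp only at h1
  linarith

/-! ### Survival probabilities -/

variable (A : V → Prop) [DecidablePred A]

omit hc in
theorem surv_of_mem {A : V → Prop} [DecidablePred A] {x : V} (h : A x) (t : ℕ) :
    surv P A t x = 0 := by
  cases t <;> simp [surv, h]

omit hc in
theorem surv_succ {A : V → Prop} [DecidablePred A] {x : V} (h : ¬ A x) (t : ℕ) :
    surv P A (t + 1) x = P.mulVec (surv P A t) x := by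
  simp [surv, h]

omit hc in
theorem surv_zero {A : V → Prop} [DecidablePred A] {x : V} (h : ¬ A x) :
    surv P A 0 x = 1 := by
  simp [surv, h]

theorem surv_nonneg (t : ℕ) (x : V) : 0 ≤ surv P A t x := by
  induction t generalizing x with
  | zero => simp only [surv]; split_ifs <;> norm_num
  | succ t ih =>
    by_cases h : A x
    · rw [surv_of_mem h]
    · rw [surv_succ h]; exact hc.stoch.mulVec_nonneg ih x

theorem surv_le_one (t : ℕ) (x : V) : surv P A t x ≤ 1 := by
  induction t generalizing x with
  | zero => simp only [surv]; split_ifs <;> norm_num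
  | succ t ih =>
    by_cases h : A x
    · rw [surv_of_mem h]; exact zero_le_one
    · rw [surv_succ h, ← hc.stoch.mulVec_const 1 x]; exact hc.stoch.mulVec_mono ih x

theorem surv_succ_le (t : ℕ) (x : V) : surv P A (t + 1) x ≤ surv P A t x := by
  induction t generalizing x with
  | zero =>
    by_cases h : A x
    · rw [surv_of_mem h, surv_of_mem h]
    · rw [surv_zero h]; exact hc.surv_le_one A _ x
  | succ t ih =>
    by_cases h : A x
    · rw [surv_of_mem h, surv_of_mem h]
    · rw [surv_succ h, surv_succ h]; exact hc.stoch.mulVec_mono ih x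

theorem surv_antitone (x : V) : Antitone fun t => surv P A t x :=
  antitone_nat_of_succ_le fun t => hc.surv_succ_le A t x

theorem sum_surv_le {h : V → ℝ} (h0 : ∀ x, 0 ≤ h x)
    (hs : ∀ x, ¬ A x → P.mulVec h x ≤ h x - 1) (m : ℕ) (x : V) :
    ∑ j ∈ range m, surv P A j x ≤ h x := by
  induction m generalizing x with
  | zero => simpa using h0 x
  | succ m ih =>
    by_cases hx : A x
    · simp only [surv_of_mem hx, sum_const_zero]; exact h0 x
    · rw [sum_range_succ', surv_zero hx]
      have e : ∑ k ∈ range m, surv P A (k + 1) x =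
          P.mulVec (fun y => ∑ k ∈ range m, surv P A k y) x := by
        simp only [surv_succ hx, mulVec_apply, mul_sum]
        rw [sum_comm]
      rw [e]
      have := hc.stoch.mulVec_mono ih x
      linarith [hs x hx]

theorem mul_surv_le {h : V → ℝ} (h0 : ∀ x, 0 ≤ h x)
    (hs : ∀ x, ¬ A x → P.mulVec h x ≤ h x - 1) (m : ℕ) (x : V) :
    m * surv P A m x ≤ h x := by
  refine le_trans ?_ (hc.sum_surv_le A h0 hs m x)
  rw [← nsmul_eq_mul, ← card_range m, ← sum_const, card_range]
  exact sum_le_sum fun j hj => hc.surv_antitone A x (mem_range.1 hj).le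

theorem tvDist_add_le {θ : ℝ} {t : ℕ} (hθ : 0 ≤ θ)
    (h : ∀ z, A z → tvDist ((P ^ t) z) π ≤ θ) (s : ℕ) (y : V) :
    tvDist ((P ^ (t + s)) y) π ≤ θ + surv P A s y := by
  induction s generalizing y with
  | zero =>
    by_cases hy : A y
    · rw [surv_of_mem hy]; simpa using h y hy
    · rw [surv_zero hy]
      linarith [hc.tvDist_pow_le_one (t + 0) y]
  | succ s ih =>
    by_cases hy : A y
    · rw [surv_of_mem hy, add_zero]
      exact (hc.tvDist_antitone y (Nat.le_add_right t (s + 1))).trans (h y hy)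
    · rw [surv_succ hy]
      refine (hc.tvDist_succ_le_mulVec (t + s) y).trans ?_
      refine (hc.stoch.mulVec_mono ih y).trans_eq ?_
      simp only [mulVec_apply, mul_add, sum_add_distrib, ← sum_mul, hc.stoch.2, one_mul]

theorem surv_le_sum_pow (t : ℕ) (x : V) :
    surv P A t x ≤ ∑ y, if A y then 0 else (P ^ t) x y := by
  induction t generalizing x with
  | zero =>
    by_cases hx : A x
    · rw [surv_of_mem hx]
      exact sum_nonneg fun y _ => by
        split_ifs
        · exact le_rfl
        · exact (hc.stoch.pow 0).1 x y
    · rw [surv_zero hx]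
      refine le_trans ?_ (single_le_sum (f := fun y => if A y then 0 else (P ^ 0) x y)
        (fun y _ => ?_) (mem_univ x))
      · simp [hx]
      · by_cases hy : A y
        · simp [hy]
        · simpa only [hy, if_false] using (hc.stoch.pow 0).1 x y
  | succ t ih =>
    by_cases hx : A x
    · rw [surv_of_mem hx]
      exact sum_nonneg fun y _ => by
        split_ifs
        · exact le_rfl
        · exact (hc.stoch.pow (t + 1)).1 x y
    · rw [surv_succ hx]
      refine (hc.stoch.mulVec_mono ih x).trans_eq ?_
      simp only [mulVec_apply, mul_sum]
      rw [sum_comm]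
      refine sum_congr rfl fun y _ => ?_
      split_ifs
      · simp only [mul_zero, sum_const_zero]
      · rw [pow_succ', Matrix.mul_apply]

theorem surv_sub_le_tvDist (t : ℕ) (x : V) :
    surv P A t x - (∑ y, if A y then 0 else π y) ≤ tvDist ((P ^ t) x) π :=
  (sub_le_sub_right (hc.surv_le_sum_pow A t x) _).trans
    (by simpa only [ite_not] using
      sum_sub_sum_le_tvDist ((hc.stoch.pow t).2 x) hc.prob.2 fun y => ¬ A y)

/-- Upper tail of the hitting time of `A` via a variance supersolution. -/
theorem surv_mul_sq_le {v H : V → ℝ} (hv : ∀ x, ¬ A x → P.mulVec v x = v x - 1)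
    (v0 : ∀ x, 0 ≤ v x) (H0 : ∀ x, 0 ≤ H x)
    (hH : ∀ x, ¬ A x → P.mulVec H x ≤ H x - ∑ y, P x y * (v y - v x) ^ 2)
    {t : ℕ} {x : V} (hx : v x ≤ t) : surv P A t x * (t - v x) ^ 2 ≤ H x := by
  have key : ∀ (s : ℕ) (a : ℝ) (x : V), 0 ≤ s - a →
      surv P A s x * (s - a) ^ 2 ≤ (v x - a) ^ 2 + H x := by
    intro s
    induction s with
    | zero =>
      intro a x ha
      by_cases hA : A x
      · rw [surv_of_mem hA]; nlinarith [sq_nonneg (v x - a), H0 x]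
      · rw [surv_zero hA]
        push_cast at ha ⊢
        nlinarith [v0 x, H0 x]
    | succ s ih =>
      intro a x ha
      by_cases hA : A x
      · rw [surv_of_mem hA]; nlinarith [sq_nonneg (v x - a), H0 x]
      · rw [surv_succ hA]
        push_cast at ha ⊢
        have h1 : ∀ y, surv P A s y * (s - (a - 1)) ^ 2 ≤ (v y - (a - 1)) ^ 2 + H y :=
          fun y => ih (a - 1) y (by linarith)
        have h2 := hc.stoch.mulVec_mono h1 x
        have e1 : P.mulVec (fun y => surv P A s y * (s - (a - 1)) ^ 2) x =
            P.mulVec (surv P A s) x * (s + 1 - a) ^ 2 := by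
          simp only [mulVec_apply, sum_mul]
          exact sum_congr rfl fun y _ => by ring
        have e2 : P.mulVec (fun y => (v y - (a - 1)) ^ 2 + H y) x =
            ∑ y, P x y * (v y - v x) ^ 2 + 2 * (v x - (a - 1)) * (P.mulVec v x - v x * ∑ y, P x y)
              + (v x - (a - 1)) ^ 2 * (∑ y, P x y) + P.mulVec H x := by
          simp only [mulVec_apply, mul_sum, ← sum_sub_distrib, ← sum_add_distrib]
          exact sum_congr rfl fun y _ => by ring
        rw [e1, e2, hc.stoch.2, hv x hA] at h2
        have := hH x hA
        nlinarith
  have := key t (v x) x (by linarith)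
  simpa using this

/-- Lower tail of the hitting time of `A` via a variance supersolution. -/
theorem one_sub_surv_le {v H J : V → ℝ} {m l : ℝ} (hl : 0 < l)
    (hv : ∀ x, ¬ A x → P.mulVec v x = v x - 1)
    (H0 : ∀ x, 0 ≤ H x) (J0 : ∀ x, 0 ≤ J x)
    (hH : ∀ x, ¬ A x → P.mulVec H x ≤ H x - ∑ y, P x y * (v y - v x) ^ 2)
    (hJ : ∀ x, ¬ A x → P.mulVec J x ≤ J x)
    (hA : ∀ x, A x → 1 ≤ J x ∨ l ≤ m - v x)
    (t : ℕ) (x : V) (ht : v x = t + m) : 1 - surv P A t x ≤ H x / l ^ 2 + J x := by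
  have key : ∀ (s : ℕ) (m' : ℝ) (x : V), m ≤ m' →
      1 - surv P A s x ≤ ((v x - s - m') ^ 2 + H x) / l ^ 2 + J x := by
    intro s
    induction s with
    | zero =>
      intro m' x hm'
      by_cases hx : A x
      · rw [surv_of_mem hx]
        rcases hA x hx with h | h
        · have : 0 ≤ ((v x - (0:ℕ) - m') ^ 2 + H x) / l ^ 2 :=
            div_nonneg (add_nonneg (sq_nonneg _) (H0 x)) (sq_nonneg _)
          linarith
        · have : 1 ≤ ((v x - (0:ℕ) - m') ^ 2 + H x) / l ^ 2 := by
            rw [le_div_iff₀ (by positivity)]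
            push_cast
            nlinarith [H0 x]
          linarith [J0 x]
      · rw [surv_zero hx]
        have : 0 ≤ ((v x - (0:ℕ) - m') ^ 2 + H x) / l ^ 2 :=
          div_nonneg (add_nonneg (sq_nonneg _) (H0 x)) (sq_nonneg _)
        linarith [J0 x]
    | succ s ih =>
      intro m' x hm'
      by_cases hx : A x
      · rw [surv_of_mem hx]
        rcases hA x hx with h | h
        · have : 0 ≤ ((v x - (s + 1 : ℕ) - m') ^ 2 + H x) / l ^ 2 :=
            div_nonneg (add_nonneg (sq_nonneg _) (H0 x)) (sq_nonneg _)
          linarith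
        · have : 1 ≤ ((v x - (s + 1 : ℕ) - m') ^ 2 + H x) / l ^ 2 := by
            rw [le_div_iff₀ (by positivity)]
            push_cast
            have : (0:ℝ) ≤ s := s.cast_nonneg
            nlinarith [H0 x]
          linarith [J0 x]
      · rw [surv_succ hx]
        push_cast
        have h2 := hc.stoch.mulVec_mono (fun y => ih m' y hm') x
        have e1 : P.mulVec (fun y => 1 - surv P A s y) x =
            ∑ y, P x y - P.mulVec (surv P A s) x := by
          simp only [mulVec_apply, ← sum_sub_distrib]
          exact sum_congr rfl fun y _ => by ring
        have e2 : P.mulVec (fun y => ((v y - s - m') ^ 2 + H y) / l ^ 2 + J y) x =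
            ((∑ y, P x y * (v y - v x) ^ 2
              + 2 * (v x - s - m') * (P.mulVec v x - v x * ∑ y, P x y)
              + (v x - s - m') ^ 2 * (∑ y, P x y) + P.mulVec H x)) / l ^ 2 + P.mulVec J x := by
          simp only [mulVec_apply, mul_sum, sum_div, ← sum_sub_distrib, ← sum_add_distrib]
          exact sum_congr rfl fun y _ => by ring
        rw [e1, e2, hc.stoch.2, hv x hx] at h2
        have h3 : (∑ y, P x y * (v y - v x) ^ 2
              + 2 * (v x - s - m') * (v x - 1 - v x * 1)
              + (v x - s - m') ^ 2 * 1 + P.mulVec H x) / l ^ 2 ≤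
              ((v x - (s + 1) - m') ^ 2 + H x) / l ^ 2 := by
          refine div_le_div_of_nonneg_right ?_ (sq_nonneg l)
          linarith [hH x hx]
        linarith [hJ x hx]
  have := key t m x le_rfl
  rw [ht] at this
  simpa using this

end IsLazyChain
end general

section general

variable {P : Matrix V V ℝ} {π : V → ℝ}

theorem Rev.pow (h : Rev P π) (t : ℕ) : Rev (P ^ t) π := by
  induction t with
  | zero =>
    intro i j
    rw [pow_zero, Matrix.one_apply, Matrix.one_apply]
    by_cases hij : i = j
    · subst hij; rfl
    · simp [hij, Ne.symm hij]
  | succ t ih =>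
    intro i j
    rw [pow_succ, Matrix.mul_apply, ← pow_succ, pow_succ', Matrix.mul_apply, mul_sum, mul_sum]
    refine sum_congr rfl fun k _ => ?_
    have h1 := ih i k
    have h2 := h k j
    linear_combination P k j * h1 + (P ^ t) k i * h2

namespace IsLazyChain
variable (hc : IsLazyChain P π)
include hc

theorem ip_mulVec_self_le (H : V → ℝ) : ip π (P.mulVec H) H ≤ ip π H H := by
  have h1 := hc.ip_mulVec_mulVec_le H
  have h2 : 0 ≤ ip π (P.mulVec H - H) (P.mulVec H - H) :=
    sum_nonneg fun x _ => by
      rw [mul_assoc]; exact mul_nonneg (hc.prob.1 x).le (mul_self_nonneg _)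
  have h3 : ip π (P.mulVec H - H) (P.mulVec H - H) =
      ip π (P.mulVec H) (P.mulVec H) - 2 * ip π (P.mulVec H) H + ip π H H := by
    simp only [ip, mul_sum, ← sum_sub_distrib, ← sum_add_distrib]
    exact sum_congr rfl fun x _ => by simp only [Pi.sub_apply]; ring
  linarith

theorem ip_pow_mulVec (t : ℕ) (f g : V → ℝ) :
    ip π f ((P ^ t).mulVec g) = ip π ((P ^ t).mulVec f) g := by
  induction t generalizing f with
  | zero => simp
  | succ t ih =>
    rw [pow_succ', ← Matrix.mulVec_mulVec, hc.ip_mulVec, ih, Matrix.mulVec_mulVec, ← pow_succ,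
      pow_succ']

theorem summable_surv (A : V → Prop) [DecidablePred A] {h : V → ℝ} (h0 : ∀ x, 0 ≤ h x)
    (hs : ∀ x, ¬ A x → P.mulVec h x ≤ h x - 1) (x : V) :
    Summable fun j => surv P A j x :=
  summable_of_sum_range_le (fun j => hc.surv_nonneg A j x) fun m => hc.sum_surv_le A h0 hs m x

/-- Starting from `o`, the chain is mixed by a constant multiple of the average hitting time
of `o`. -/
theorem mul_tvDist_sq_le (o : V) {h : V → ℝ} (h0 : ∀ x, 0 ≤ h x)
    (hs : ∀ x, x ≠ o → P.mulVec h x ≤ h x - 1) (l : ℕ) :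
    l * (2 * tvDist ((P ^ l) o) π) ^ 2 ≤ ∑ x, π x * h x := by
  have hsum := hc.summable_surv (fun x => x = o) h0 hs
  set g : V → ℝ := fun x => ∑' j, surv P (fun x => x = o) j x with hg
  have g0 : ∀ x, 0 ≤ g x := fun x => tsum_nonneg fun j => hc.surv_nonneg _ j x
  have gle : ∀ x, g x ≤ h x := fun x =>
    (hsum x).tsum_le_of_sum_range_le fun m => hc.sum_surv_le (fun x => x = o) h0 hs m x
  have go : g o = 0 := by
    simp only [hg, IsLazyChain.surv_of_mem (A := fun x => x = o) rfl, tsum_zero]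
  have gx : ∀ x, x ≠ o → P.mulVec g x = g x - 1 := by
    intro x hx
    have e1 : P.mulVec g x = ∑' j, P.mulVec (surv P (fun x => x = o) j) x := by
      simp only [mulVec_apply, hg, ← tsum_mul_left]
      rw [Summable.tsum_finsetSum fun y _ => (hsum y).mul_left _]
    have e2 : g x = surv P (fun x => x = o) 0 x + ∑' j, surv P (fun x => x = o) (j + 1) x :=
      (hsum x).tsum_eq_zero_add
    rw [IsLazyChain.surv_zero (A := fun x => x = o) hx] at e2
    simp only [IsLazyChain.surv_succ (A := fun x => x = o) hx] at e2
    rw [e1, e2]; ring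
  have po := hc.prob.1 o
  set f : V → ℝ := P.mulVec g - g with hf
  have fx : ∀ x, f x = (if x = o then 1 / π o else 0) - 1 := by
    have h1 : ∀ x, x ≠ o → f x = -1 := fun x hx => by simp [hf, gx x hx]
    have h2 : ∑ x, π x * f x = 0 := by
      simp only [hf, Pi.sub_apply, mul_sub, sum_sub_distrib, hc.sum_mulVec, sub_self]
    have h3 : ∑ x, π x * (f x + 1) = 1 := by
      simp only [mul_add, sum_add_distrib, h2, mul_one, hc.prob.2, zero_add]
    rw [sum_eq_single o (fun x _ hx => by rw [h1 x hx]; ring) (by simp)] at h3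
    intro x
    by_cases hx : x = o
    · subst hx
      simp only [if_true]
      field_simp
      linarith
    · simp [h1 x hx, hx]
  have ipf : ∀ u : V → ℝ, ip π f u = u o - ∑ x, π x * u x := by
    intro u
    have : ∀ x, π x * f x * u x = (if x = o then u x else 0) - π x * u x := by
      intro x
      rw [fx]
      split_ifs with hx
      · subst hx; field_simp
      · ring
    simp only [ip, this, sum_sub_distrib, sum_ite_eq', mem_univ, if_true]
  have Ff : ∀ j y, π y * (P ^ j).mulVec f y = (P ^ j) o y - π y := by
    intro j y
    have : (P ^ j).mulVec f y = (P ^ j) y o * (1 / π o) - 1 := by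
      simp only [mulVec_apply, fx, mul_sub, sum_sub_distrib, mul_one, (hc.stoch.pow j).2,
        mul_ite, mul_zero, sum_ite_eq', mem_univ, if_true]
    rw [this]
    have := hc.rev.pow j y o
    field_simp
    linarith
  set a : ℕ → ℝ := fun j => ip π f ((P ^ j).mulVec f) with ha
  have a_even : ∀ j, a (2 * j) = ip π ((P ^ j).mulVec f) ((P ^ j).mulVec f) := by
    intro j
    rw [ha]; simp only
    rw [two_mul, pow_add, ← Matrix.mulVec_mulVec, hc.ip_pow_mulVec]
  have a_odd : ∀ j, 0 ≤ a (2 * j + 1) := by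
    intro j
    have : a (2 * j + 1) = ip π ((P ^ j).mulVec f) (P.mulVec ((P ^ j).mulVec f)) := by
      rw [ha]; simp only
      rw [show 2 * j + 1 = j + (1 + j) by ring, pow_add, pow_add, pow_one,
        ← Matrix.mulVec_mulVec, hc.ip_pow_mulVec, ← Matrix.mulVec_mulVec]
    rw [this]; exact hc.ip_self_mulVec_nonneg _
  have b_anti : Antitone fun j => a (2 * j) := antitone_nat_of_succ_le fun j => by
    rw [a_even, a_even, pow_succ', ← Matrix.mulVec_mulVec]
    exact hc.ip_mulVec_mulVec_le _
  have tele : ∀ m, ∑ j ∈ range m, a j = ip π f ((P ^ m).mulVec g) - ip π f g := by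
    intro m
    induction m with
    | zero => simp
    | succ m ih =>
      rw [sum_range_succ, ih]
      have : (P ^ m).mulVec f = (P ^ (m + 1)).mulVec g - (P ^ m).mulVec g := by
        rw [hf, Matrix.mulVec_sub, Matrix.mulVec_mulVec, ← pow_succ]
      have h2 : a m = ip π f ((P ^ (m + 1)).mulVec g) - ip π f ((P ^ m).mulVec g) := by
        simp only [ha, this, ip, Pi.sub_apply, mul_sub, sum_sub_distrib]
      rw [h2]; ring
  have low : ∀ k, k ≤ l → k * a (2 * l) ≤ ∑ j ∈ range (2 * k), a j := by
    intro k
    induction k with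
    | zero => simp
    | succ k ih =>
      intro hk
      have h1 := ih (by lia)
      have h2 : a (2 * l) ≤ a (2 * k) := b_anti (show k ≤ l by lia)
      rw [show 2 * (k + 1) = 2 * k + 1 + 1 by ring, sum_range_succ, sum_range_succ]
      push_cast
      linarith [a_odd k]
  have h1 := low l le_rfl
  rw [tele, ipf g, go] at h1
  have h2 : ip π f ((P ^ (2 * l)).mulVec g) ≤ 0 := by
    rw [two_mul, pow_add, ← Matrix.mulVec_mulVec, hc.ip_pow_mulVec]
    have e : (P ^ l).mulVec f = P.mulVec ((P ^ l).mulVec g) - (P ^ l).mulVec g := by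
      rw [hf, Matrix.mulVec_sub, Matrix.mulVec_mulVec, Matrix.mulVec_mulVec, ← pow_succ, pow_succ']
    rw [e]
    have := hc.ip_mulVec_self_le ((P ^ l).mulVec g)
    simp only [ip, Pi.sub_apply, mul_sub, sub_mul, sum_sub_distrib] at this ⊢
    linarith
  have h3 : (2 * tvDist ((P ^ l) o) π) ^ 2 ≤ a (2 * l) := by
    rw [a_even]
    have e : 2 * tvDist ((P ^ l) o) π = ∑ y, π y * |(P ^ l).mulVec f y| := by
      unfold tvDist
      rw [mul_div_cancel₀ _ two_ne_zero]
      refine sum_congr rfl fun y _ => ?_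
      rw [← Ff, abs_mul, abs_of_pos (hc.prob.1 y)]
    rw [e]
    set F := (P ^ l).mulVec f
    set m := ∑ y, π y * |F y|
    have : 0 ≤ ∑ y, π y * (|F y| - m) ^ 2 :=
      sum_nonneg fun y _ => mul_nonneg (hc.prob.1 y).le (sq_nonneg _)
    have e2 : ∑ y, π y * (|F y| - m) ^ 2 =
        ip π F F - 2 * m * (∑ y, π y * |F y|) + m ^ 2 * ∑ y, π y := by
      clear_value m
      simp only [ip, mul_sum, ← sum_sub_distrib, ← sum_add_distrib]
      refine sum_congr rfl fun y _ => ?_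
      rw [sub_sq, sq_abs]; ring
    rw [hc.prob.2, show ∑ y, π y * |F y| = m from rfl] at e2
    linarith
  have h4 : ∑ x, π x * g x ≤ ∑ x, π x * h x :=
    sum_le_sum fun x _ => mul_le_mul_of_nonneg_left (gle x) (hc.prob.1 x).le
  have h5 := mul_le_mul_of_nonneg_left h3 (l.cast_nonneg (α := ℝ))
  linarith

/-! ### Relaxation time -/

theorem abs_pow_eigenvalue_le {μ : ℝ} {f : V → ℝ} (hμ : μ ≠ 1) (hf : f ≠ 0)
    (hP : P.mulVec f = μ • f) (t : ℕ) : |μ| ^ t ≤ 2 * dTV P π t := by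
  have h0 : ∑ x, π x * f x = 0 := by
    have := hc.sum_mulVec f
    simp only [hP, Pi.smul_apply, smul_eq_mul, mul_left_comm, ← mul_sum] at this
    have h2 : (μ - 1) * ∑ x, π x * f x = 0 := by linarith
    exact (mul_eq_zero.1 h2).resolve_left (sub_ne_zero.2 hμ)
  have hpow : (P ^ t).mulVec f = μ ^ t • f := by
    induction t with
    | zero => simp
    | succ t ih =>
      rw [pow_succ, ← Matrix.mulVec_mulVec, hP, Matrix.mulVec_smul, ih, smul_smul, pow_succ']
  have := hc.nonempty
  obtain ⟨x, -, hx⟩ := exists_max_image univ (fun x => |f x|) univ_nonempty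
  have hfx : 0 < |f x| := by
    obtain ⟨z, hz⟩ := Function.ne_iff.1 hf
    exact (abs_pos.2 hz).trans_le (hx z (mem_univ z))
  have e : μ ^ t * f x = ∑ y, ((P ^ t) x y - π y) * f y := by
    simp only [sub_mul, sum_sub_distrib, h0, sub_zero]
    rw [← mulVec_apply, hpow]; rfl
  have h1 : |μ| ^ t * |f x| ≤ 2 * tvDist ((P ^ t) x) π * |f x| := by
    rw [← abs_pow, ← abs_mul, e]
    refine (abs_sum_le_sum_abs _ _).trans ?_
    unfold tvDist
    rw [mul_div_cancel₀ _ two_ne_zero, sum_mul]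
    refine sum_le_sum fun y _ => ?_
    rw [abs_mul]
    exact mul_le_mul_of_nonneg_left (hx y (mem_univ y)) (abs_nonneg _)
  have h2 := le_of_mul_le_mul_right h1 hfx
  linarith [hc.tvDist_le_dTV t x]

theorem eigenvalue_le {t : ℕ} (ht : dTV P π t ≤ 1 / 4) {μ : ℝ} (hμ : μ ≠ 1)
    {f : V → ℝ} (hf : f ≠ 0) (hP : P.mulVec f = μ • f) :
    0 < t ∧ μ ≤ 1 - 1 / (2 * t) := by
  have h := hc.abs_pow_eigenvalue_le hμ hf hP t
  have ht0 : 0 < t := by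
    rcases Nat.eq_zero_or_pos t with h0 | h0
    · subst h0; rw [pow_zero] at h; linarith
    · exact h0
  refine ⟨ht0, ?_⟩
  by_contra hlt
  push Not at hlt
  have htr : (1 : ℝ) ≤ t := by exact_mod_cast ht0
  have hb0 : (0 : ℝ) ≤ 1 - 1 / (2 * t) := by
    rw [sub_nonneg, div_le_one (by positivity)]; linarith
  have h1 := one_add_mul_le_pow (a := -(1 / (2 * (t : ℝ)))) (by linarith) t
  have h2 : (1 - 1 / (2 * (t : ℝ))) ^ t < |μ| ^ t :=
    pow_lt_pow_left₀ (hlt.trans_le (le_abs_self μ)) hb0 ht0.ne'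
  have h3 : (t : ℝ) * -(1 / (2 * t)) = -(1 / 2) := by field_simp
  rw [h3, ← sub_eq_add_neg] at h1
  rw [← sub_eq_add_neg] at h1
  linarith

theorem trel_bounds {s : ℕ} (hs : dTV P π s ≤ 1 / 4) {μ : ℝ} (hμ : μ < 1)
    {f : V → ℝ} (hf : f ≠ 0) (hP : P.mulVec f = μ • f) :
    1 / (1 - μ) ≤ trel P ∧ trel P ≤ 2 * mixTime P π (1 / 4) := by
  have hmem : mixTime P π (1 / 4) ∈ {t : ℕ | dTV P π t ≤ 1 / 4} := Nat.sInf_mem ⟨s, hs⟩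
  set t := mixTime P π (1 / 4)
  have hub : ∀ ν ∈ {μ : ℝ | μ ≠ 1 ∧ ∃ f : V → ℝ, f ≠ 0 ∧ P.mulVec f = μ • f},
      ν ≤ 1 - 1 / (2 * (t : ℝ)) := by
    rintro ν ⟨hν, f', hf', hP'⟩
    exact (hc.eigenvalue_le hmem hν hf' hP').2
  have hmemμ : μ ∈ {μ : ℝ | μ ≠ 1 ∧ ∃ f : V → ℝ, f ≠ 0 ∧ P.mulVec f = μ • f} :=
    ⟨hμ.ne, f, hf, hP⟩
  have ht : (0 : ℝ) < t := by exact_mod_cast (hc.eigenvalue_le hmem hμ.ne hf hP).1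
  have h1 : lam2 P ≤ 1 - 1 / (2 * (t : ℝ)) := csSup_le ⟨μ, hmemμ⟩ hub
  have h2 : μ ≤ lam2 P := le_csSup ⟨_, hub⟩ hmemμ
  have h3 : 0 < 1 / (2 * (t : ℝ)) := by positivity
  unfold trel
  constructor
  · exact one_div_le_one_div_of_le (by linarith) (by linarith)
  · rw [div_le_iff₀ (by linarith)]
    have : 2 * (t : ℝ) * (1 / (2 * t)) = 1 := by field_simp
    nlinarith

end IsLazyChain

/-! ### Weighted networks -/

theorem isLazyChain_wMat [Nonempty V] {w : V → V → ℝ} (h0 : ∀ u v, 0 ≤ w u v)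
    (hsymm : ∀ u v, w u v = w v u)
    (hdiag : ∀ v, w v v = 0) (hpos : ∀ v, 0 < ∑ x, w v x) : IsLazyChain (wMat w) (wSta w) := by
  have htot : 0 < ∑ u, ∑ x, w u x := sum_pos (fun u _ => hpos u) univ_nonempty
  refine ⟨⟨fun i j => ?_, fun i => ?_⟩, ⟨fun i => div_pos (hpos i) htot, ?_⟩, fun i j => ?_,
    fun x => ?_⟩
  · simp only [wMat, Matrix.of_apply]
    split_ifs
    · norm_num
    · exact div_nonneg (h0 _ _) (by linarith [hpos i])
  · have : ∀ j, wMat w i j = (if i = j then 1 / 2 else 0) + w i j / (2 * ∑ x, w i x) := by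
      intro j
      simp only [wMat, Matrix.of_apply]
      split_ifs with h
      · subst h; simp [hdiag]
      · ring
    simp only [this, sum_add_distrib, sum_ite_eq, mem_univ, if_true, ← sum_div]
    have := hpos i
    field_simp
    norm_num
  · simp only [wSta, ← sum_div]; exact div_self htot.ne'
  · by_cases h : i = j
    · subst h; rfl
    · simp only [wMat, Matrix.of_apply, h, Ne.symm h, if_false, wSta]
      have := hpos i
      have := hpos j
      rw [hsymm j i]
      field_simp
  · simp [wMat]

/-- The generator of the lazy walk in terms of the network Laplacian. -/
theorem wMat_mulVec_sub {w : V → V → ℝ} (hdiag : ∀ v, w v v = 0) (hpos : ∀ v, 0 < ∑ x, w v x)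
    (h : V → ℝ) (v : V) :
    (wMat w).mulVec h v = h v + (∑ u, w v u * (h u - h v)) / (2 * ∑ x, w v x) := by
  have : ∀ j, wMat w v j * h j = (if v = j then h j / 2 else 0)
      + w v j * h j / (2 * ∑ x, w v x) := by
    intro j
    simp only [wMat, Matrix.of_apply]
    split_ifs with hv
    · subst hv; simp [hdiag]; ring
    · ring
  simp only [mulVec_apply, this, sum_add_distrib, sum_ite_eq, mem_univ, if_true, mul_sub,
    sum_sub_distrib, ← sum_div, ← sum_mul]
  have := hpos v
  field_simp
  ring

/-! ### Relabelling -/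

variable {W : Type} [Fintype W] [DecidableEq W] (e : W ≃ V)

theorem wMat_relabel (w : V → V → ℝ) :
    wMat (fun a b => w (e a) (e b)) = (wMat w).submatrix e e := by
  ext a b
  simp only [wMat, Matrix.of_apply, Matrix.submatrix_apply, e.injective.eq_iff]
  rw [e.sum_comp fun x => w (e a) x]

theorem wSta_relabel (w : V → V → ℝ) (a : W) :
    wSta (fun a b => w (e a) (e b)) a = wSta w (e a) := by
  simp only [wSta]
  rw [e.sum_comp fun x => w (e a) x, ← e.sum_comp fun u => ∑ x, w u x]
  congr 1
  exact sum_congr rfl fun u _ => e.sum_comp fun x => w (e u) x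

theorem submatrix_pow (P : Matrix V V ℝ) (t : ℕ) :
    (P.submatrix e e) ^ t = (P ^ t).submatrix e e := by
  induction t with
  | zero => simp
  | succ t ih => rw [pow_succ, ih, Matrix.submatrix_mul_equiv, ← pow_succ]

theorem tmixW_relabel (w : V → V → ℝ) (ε : ℝ) :
    tmixW (fun a b => w (e a) (e b)) ε = tmixW w ε := by
  have : ∀ t, dTV (wMat fun a b => w (e a) (e b)) (wSta fun a b => w (e a) (e b)) t =
      dTV (wMat w) (wSta w) t := by
    intro t
    simp only [dTV, wMat_relabel, submatrix_pow]
    rw [← e.iSup_comp (g := fun x => tvDist ((wMat w ^ t) x) (wSta w))]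
    congr 1
    funext x
    simp only [tvDist, wSta_relabel, Matrix.submatrix_apply]
    rw [e.sum_comp fun y => |(wMat w ^ t) (e x) y - wSta w y|]
  simp only [tmixW, mixTime, this]

theorem trel_relabel (w : V → V → ℝ) :
    trel (wMat fun a b => w (e a) (e b)) = trel (wMat w) := by
  have key : ∀ (f : V → ℝ), ((wMat w).submatrix e e).mulVec (f ∘ e) = (wMat w).mulVec f ∘ e := by
    intro f
    funext a
    simp only [mulVec_apply, Function.comp_apply, Matrix.submatrix_apply]
    rw [e.sum_comp fun y => wMat w (e a) y * f y]
  have : lam2 (wMat fun a b => w (e a) (e b)) = lam2 (wMat w) := by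
    rw [wMat_relabel]
    unfold lam2
    congr 1
    ext μ
    refine and_congr_right fun _ => ⟨?_, ?_⟩
    · rintro ⟨f, hf, hP⟩
      refine ⟨f ∘ e.symm, fun h0 => hf ?_, ?_⟩
      · funext a
        have := congrFun h0 (e a)
        simpa using this
      · have h1 := key (f ∘ e.symm)
        have h2 : (f ∘ e.symm) ∘ e = f := by funext a; simp
        rw [h2, hP] at h1
        funext b
        have := congrFun h1 (e.symm b)
        simpa using this.symm
    · rintro ⟨f, hf, hP⟩
      refine ⟨f ∘ e, fun h0 => hf ?_, ?_⟩
      · funext b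
        have := congrFun h0 (e.symm b)
        simpa using this
      · rw [key, hP]; rfl
  simp only [trel, this]

/-! ### Simple random walk as a network walk -/

open Classical in
/-- The adjacency indicator of a graph as edge weights. -/
def adjW (G : SimpleGraph V) (u v : V) : ℝ := if G.Adj u v then 1 else 0

theorem sum_adjW (G : SimpleGraph V) (v : V) : ∑ x, adjW G v x = deg G v := by
  classical
  simp only [adjW, deg, sum_boole, Nat.card_eq_fintype_card, Fintype.card_subtype]

theorem walkMat_eq (G : SimpleGraph V) : walkMat G = wMat (adjW G) := by
  ext u v
  simp only [walkMat, wMat, Matrix.of_apply, sum_adjW]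
  split_ifs with h h2
  · rfl
  · simp [adjW, h2]
  · simp [adjW, h2]

theorem degSta_eq (G : SimpleGraph V) : degSta G = wSta (adjW G) := by
  funext v
  simp only [degSta, wSta, sum_adjW]

theorem tmixG_eq (G : SimpleGraph V) (ε : ℝ) : tmixG G ε = tmixW (adjW G) ε := by
  simp only [tmixG, tmixW, walkMat_eq, degSta_eq]

theorem trelG_eq (G : SimpleGraph V) : trelG G = trel (wMat (adjW G)) := by
  simp only [trelG, walkMat_eq]

/-- Connectivity from a function that strictly decreases towards `o` along some edge. -/
theorem connected_of_descent (G : SimpleGraph V) (o : V) (h : V → ℝ)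
    (hd : ∀ v, v ≠ o → ∃ u, G.Adj v u ∧ h u < h v) : G.Connected := by
  have hr : ∀ v, G.Reachable v o := by
    by_contra hcon
    push Not at hcon
    obtain ⟨v, hv⟩ := hcon
    classical
    obtain ⟨m, hm, hmin⟩ := exists_min_image (univ.filter fun v => ¬ G.Reachable v o) h
      ⟨v, by simpa using hv⟩
    simp only [mem_filter, mem_univ, true_and] at hm hmin
    have hmo : m ≠ o := by rintro rfl; exact hm (SimpleGraph.Reachable.refl _)
    obtain ⟨u, hu, hlt⟩ := hd m hmo
    by_cases hur : G.Reachable u o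
    · exact hm (hu.reachable.trans hur)
    · exact absurd (hmin u hur) (not_le.2 hlt)
  have : Nonempty V := ⟨o⟩
  exact SimpleGraph.Connected.mk fun u v => (hr u).trans (hr v).symm

end general

/-- A finite multigraph without loops whose edges carry positive integer lengths, edges of
length one being simple. -/
structure BaseNet (Z ℰ : Type) where
  src : ℰ → Z
  dst : ℰ → Z
  len : ℰ → ℕ
  len_pos : ∀ e, 0 < len e
  src_ne_dst : ∀ e, src e ≠ dst e
  simple : ∀ e e', len e = 1 → len e' = 1 →
    (src e = src e' ∧ dst e = dst e') ∨ (src e = dst e' ∧ dst e = src e') → e = e'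

namespace BaseNet

variable {Z ℰ : Type} [Fintype Z] [Fintype ℰ] [DecidableEq Z] [DecidableEq ℰ] (N : BaseNet Z ℰ)

/-- Vertices of the graph in which each edge is replaced by a path of the given length. -/
abbrev Vx : Type := Z ⊕ (Σ e : ℰ, Fin (N.len e - 1))

/-- The `j`-th point on the path replacing the edge `e`. -/
def pt (e : ℰ) (j : ℕ) : N.Vx :=
  if j = 0 then Sum.inl (N.src e)
  else if h : j - 1 < N.len e - 1 then Sum.inr ⟨e, ⟨j - 1, h⟩⟩ else Sum.inl (N.dst e)

theorem pt_zero (e : ℰ) : N.pt e 0 = Sum.inl (N.src e) := by simp [pt]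

theorem pt_len (e : ℰ) : N.pt e (N.len e) = Sum.inl (N.dst e) := by
  have := N.len_pos e
  simp only [pt]
  rw [if_neg (by lia), dif_neg (by lia)]

theorem inr_eq_pt_iff {e : ℰ} {i : Fin (N.len e - 1)} {e' : ℰ} {j : ℕ} :
    (Sum.inr ⟨e, i⟩ : N.Vx) = N.pt e' j ↔ e' = e ∧ j = i + 1 := by
  constructor
  · intro h
    unfold pt at h
    split_ifs at h with h0 h1
    simp only [Sum.inr.injEq] at h
    obtain ⟨rfl, h2⟩ := Sigma.mk.inj_iff.1 h
    have h3 := eq_of_heq h2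
    subst h3
    refine ⟨rfl, ?_⟩
    simp only
    lia
  · rintro ⟨rfl, rfl⟩
    have := i.2
    simp [pt]

theorem inl_eq_pt_iff {z : Z} {e : ℰ} {j : ℕ} (hj : j ≤ N.len e) :
    (Sum.inl z : N.Vx) = N.pt e j ↔ (j = 0 ∧ z = N.src e) ∨ (j = N.len e ∧ z = N.dst e) := by
  have := N.len_pos e
  unfold pt
  split_ifs with h0 h1
  · subst h0
    simp only [Sum.inl.injEq, true_and]
    constructor
    · exact Or.inl
    · rintro (h | ⟨h, -⟩)
      · exact h
      · lia
  · simp only [false_iff, not_or, not_and]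
    exact ⟨fun h => absurd h h0, fun h => by lia⟩
  · have : j = N.len e := by lia
    rw [Sum.inl.injEq]
    constructor
    · exact fun h => Or.inr ⟨this, h⟩
    · rintro (⟨h, -⟩ | ⟨-, h⟩)
      · exact absurd h h0
      · exact h

/-- Edge weights of the stretched network when the path replacing `e` has weight `c e`. -/
def sw (c : ℰ → ℝ) (u v : N.Vx) : ℝ :=
  ∑ e, ∑ j ∈ range (N.len e), c e *
    ((if u = N.pt e j ∧ v = N.pt e (j + 1) then 1 else 0)
      + (if v = N.pt e j ∧ u = N.pt e (j + 1) then 1 else 0))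

theorem sw_symm (c : ℰ → ℝ) (u v : N.Vx) : N.sw c u v = N.sw c v u := by
  simp only [sw]
  refine sum_congr rfl fun e _ => sum_congr rfl fun j _ => ?_
  rw [add_comm]

theorem sw_nonneg {c : ℰ → ℝ} (hc : ∀ e, 0 ≤ c e) (u v : N.Vx) : 0 ≤ N.sw c u v :=
  sum_nonneg fun e _ => sum_nonneg fun j _ => mul_nonneg (hc e) (by positivity)

theorem sum_sw (c : ℰ → ℝ) (φ : N.Vx → ℝ) (u : N.Vx) :
    ∑ v, N.sw c u v * φ v = ∑ e, ∑ j ∈ range (N.len e), c e *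
      ((if u = N.pt e j then φ (N.pt e (j + 1)) else 0)
        + (if u = N.pt e (j + 1) then φ (N.pt e j) else 0)) := by
  simp only [sw, sum_mul]
  rw [sum_comm]
  refine sum_congr rfl fun e _ => ?_
  rw [sum_comm]
  refine sum_congr rfl fun j _ => ?_
  simp only [mul_assoc, ← mul_sum, add_mul, sum_add_distrib]
  congr 2
  · by_cases h : u = N.pt e j
    · simp [h]
    · simp [h]
  · by_cases h : u = N.pt e (j + 1)
    · simp [h]
    · simp [h]

theorem sum_sw_inr (c : ℰ → ℝ) (φ : N.Vx → ℝ) (e : ℰ) (i : Fin (N.len e - 1)) :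
    ∑ v, N.sw c (Sum.inr ⟨e, i⟩) v * φ v = c e * (φ (N.pt e (i + 2)) + φ (N.pt e i)) := by
  have hi := i.2
  simp only [sum_sw, N.inr_eq_pt_iff]
  rw [sum_eq_single e]
  · simp only [true_and, mul_add, sum_add_distrib]
    rw [sum_eq_single (i.1 + 1), sum_eq_single i.1]
    · simp
    · intro j _ hj; rw [if_neg (by lia), mul_zero]
    · intro h; exact absurd (mem_range.2 (by lia)) h
    · intro j _ hj; rw [if_neg hj, mul_zero]
    · intro h; exact absurd (mem_range.2 (by lia)) h
  · intro e' _ he; simp [he]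
  · simp

theorem sum_sw_inl (c : ℰ → ℝ) (φ : N.Vx → ℝ) (z : Z) :
    ∑ v, N.sw c (Sum.inl z) v * φ v = ∑ e, c e *
      ((if z = N.src e then φ (N.pt e 1) else 0)
        + (if z = N.dst e then φ (N.pt e (N.len e - 1)) else 0)) := by
  rw [sum_sw]
  refine sum_congr rfl fun e _ => ?_
  have := N.len_pos e
  rw [← mul_sum, sum_add_distrib]
  congr 2
  · rw [sum_eq_single 0]
    · rw [N.pt_zero]; simp
    · intro j hj hj0
      have := mem_range.1 hj
      rw [if_neg]
      rw [N.inl_eq_pt_iff this.le]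
      lia
    · intro h; exact absurd (mem_range.2 this) h
  · rw [sum_eq_single (N.len e - 1)]
    · rw [Nat.sub_add_cancel this, N.pt_len]; simp
    · intro j hj hj0
      have := mem_range.1 hj
      rw [if_neg]
      rw [N.inl_eq_pt_iff this]
      lia
    · intro h; exact absurd (mem_range.2 (by lia)) h

theorem rowsum_inr (c : ℰ → ℝ) (e : ℰ) (i : Fin (N.len e - 1)) :
    ∑ v, N.sw c (Sum.inr ⟨e, i⟩) v = 2 * c e := by
  have := N.sum_sw_inr c (fun _ => 1) e i
  simp only [mul_one] at this
  rw [this]; ring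

/-- The total weight of the edges at a base vertex. -/
def bdeg (c : ℰ → ℝ) (z : Z) : ℝ :=
  ∑ e, c e * ((if z = N.src e then 1 else 0) + (if z = N.dst e then 1 else 0))

theorem rowsum_inl (c : ℰ → ℝ) (z : Z) :
    ∑ v, N.sw c (Sum.inl z) v = N.bdeg c z := by
  have := N.sum_sw_inl c (fun _ => 1) z
  simp only [mul_one] at this
  exact this

theorem rowsum_pos {c : ℰ → ℝ} (hc : ∀ e, 0 < c e) (hz : ∀ z, ∃ e, z = N.src e ∨ z = N.dst e)
    (u : N.Vx) : 0 < ∑ v, N.sw c u v := by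
  rcases u with z | ⟨e, i⟩
  · rw [rowsum_inl]
    obtain ⟨e, he⟩ := hz z
    refine sum_pos' (fun e _ => mul_nonneg (hc e).le (by positivity)) ⟨e, mem_univ _, ?_⟩
    refine mul_pos (hc e) ?_
    rcases he with he | he
    · rw [if_pos he]; positivity
    · rw [if_pos he]; positivity
  · rw [rowsum_inr]; linarith [hc e]

theorem pt_ne (e : ℰ) {j k : ℕ} (hjk : j < k) (hk : k ≤ N.len e) : N.pt e j ≠ N.pt e k := by
  intro h
  by_cases hj : j = 0
  · subst hj
    rw [N.pt_zero, N.inl_eq_pt_iff hk] at h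
    rcases h with ⟨h, -⟩ | ⟨-, h⟩
    · lia
    · exact N.src_ne_dst e h
  · have e1 : N.pt e j = Sum.inr ⟨e, ⟨j - 1, by lia⟩⟩ := by
      symm; rw [N.inr_eq_pt_iff]; simp only [true_and]; lia
    rw [e1, N.inr_eq_pt_iff] at h
    have := h.2
    simp only at this
    lia

theorem sw_eq_zero_or (u v : N.Vx) :
    (∀ c, N.sw c u v = 0) ∨ ∃ e, ∀ c, N.sw c u v = c e := by
  classical
  have row : ∀ c u v, N.sw c u v = ∑ x, N.sw c u x * (if x = v then 1 else 0) := by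
    intro c u v; simp
  have inr_case : ∀ (e : ℰ) (i : Fin (N.len e - 1)) (v : N.Vx),
      (∀ c, N.sw c (Sum.inr ⟨e, i⟩) v = 0) ∨ ∃ e', ∀ c, N.sw c (Sum.inr ⟨e, i⟩) v = c e' := by
    intro e i v
    have hne : N.pt e i ≠ N.pt e (i + 2) := N.pt_ne e (by lia) (by have := i.2; lia)
    by_cases h1 : N.pt e (i + 2) = v
    · right; refine ⟨e, fun c => ?_⟩
      rw [row, N.sum_sw_inr, if_pos h1, if_neg (by rw [← h1]; exact hne)]; ring
    · by_cases h2 : N.pt e i = v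
      · right; refine ⟨e, fun c => ?_⟩
        rw [row, N.sum_sw_inr, if_neg h1, if_pos h2]; ring
      · left; intro c
        rw [row, N.sum_sw_inr, if_neg h1, if_neg h2]; ring
  rcases u with z | ⟨e, i⟩
  · rcases v with z' | ⟨e, i⟩
    · have key : ∀ c, N.sw c (Sum.inl z) (Sum.inl z') = ∑ e, c e *
          ((if z = N.src e ∧ z' = N.dst e ∧ N.len e = 1 then 1 else 0)
            + (if z = N.dst e ∧ z' = N.src e ∧ N.len e = 1 then 1 else 0)) := by
        intro c
        rw [row, N.sum_sw_inl]
        refine sum_congr rfl fun e _ => ?_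
        have := N.len_pos e
        congr 2
        · rw [← ite_and]
          refine if_congr (and_congr_right fun hz => ?_) rfl rfl
          rw [eq_comm, N.inl_eq_pt_iff this]
          have := N.src_ne_dst e
          constructor
          · rintro (⟨h, -⟩ | ⟨h, h2⟩)
            · lia
            · exact ⟨h2, h.symm⟩
          · rintro ⟨h1, h2⟩; exact Or.inr ⟨h2.symm, h1⟩
        · rw [← ite_and]
          refine if_congr (and_congr_right fun hz => ?_) rfl rfl
          rw [eq_comm, N.inl_eq_pt_iff (Nat.sub_le _ _)]
          constructor
          · rintro (⟨h, h2⟩ | ⟨h, -⟩)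
            · exact ⟨h2, by lia⟩
            · lia
          · rintro ⟨h1, h2⟩; exact Or.inl ⟨by lia, h1⟩
      by_cases hex : ∃ e, ((z = N.src e ∧ z' = N.dst e) ∨ (z = N.dst e ∧ z' = N.src e)) ∧ N.len e = 1
      · obtain ⟨e, he, hl⟩ := hex
        right; refine ⟨e, fun c => ?_⟩
        rw [key, sum_eq_single e]
        · have hne := N.src_ne_dst e
          rcases he with ⟨rfl, rfl⟩ | ⟨rfl, rfl⟩
          · simp [hl, hne]
          · simp [hl, hne.symm]
        · intro e' _ hee
          rw [if_neg, if_neg]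
          · simp
          · rintro ⟨h1, h2, h3⟩
            refine hee (N.simple e' e h3 hl ?_)
            rw [← h1, ← h2]
            rcases he with ⟨h4, h5⟩ | ⟨h4, h5⟩
            · right; exact ⟨h5, h4⟩
            · left; exact ⟨h5, h4⟩
          · rintro ⟨h1, h2, h3⟩
            refine hee (N.simple e' e h3 hl ?_)
            rw [← h1, ← h2]
            rcases he with ⟨h4, h5⟩ | ⟨h4, h5⟩
            · left; exact ⟨h4, h5⟩
            · right; exact ⟨h4, h5⟩
        · simp
      · left; intro c
        rw [key]
        refine sum_eq_zero fun e _ => ?_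
        rw [if_neg, if_neg]
        · simp
        · rintro ⟨h1, h2, h3⟩; exact hex ⟨e, Or.inr ⟨h1, h2⟩, h3⟩
        · rintro ⟨h1, h2, h3⟩; exact hex ⟨e, Or.inl ⟨h1, h2⟩, h3⟩
    · rcases inr_case e i (Sum.inl z) with h | ⟨e', h⟩
      · left; intro c; rw [N.sw_symm, h]
      · right; exact ⟨e', fun c => by rw [N.sw_symm, h]⟩
  · exact inr_case e i v

theorem sw_self (c : ℰ → ℝ) (u : N.Vx) : N.sw c u u = 0 := by
  refine sum_eq_zero fun e _ => sum_eq_zero fun j hj => ?_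
  have h := N.pt_ne e (Nat.lt_succ_self j) (mem_range.1 hj)
  rw [if_neg]
  · ring
  · rintro ⟨h1, h2⟩; exact h (h1.symm.trans h2)

/-! ### Quadratic extension of functions from the base -/

/-- The quadratic profile along the path replacing `e` with second difference `-4 q e`. -/
def prof (f : Z → ℝ) (q : ℰ → ℝ) (e : ℰ) (j : ℝ) : ℝ :=
  f (N.src e) + j / N.len e * (f (N.dst e) - f (N.src e)) + 2 * q e * (j * (N.len e - j))

/-- Extension of `f` from the base to the stretched network. -/
def lift (f : Z → ℝ) (q : ℰ → ℝ) : N.Vx → ℝ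
  | Sum.inl z => f z
  | Sum.inr ⟨e, i⟩ => N.prof f q e (i + 1)

theorem lift_inl (f : Z → ℝ) (q : ℰ → ℝ) (z : Z) : N.lift f q (Sum.inl z) = f z := rfl

theorem lift_inr (f : Z → ℝ) (q : ℰ → ℝ) (e : ℰ) (i : Fin (N.len e - 1)) :
    N.lift f q (Sum.inr ⟨e, i⟩) = N.prof f q e (i + 1) := rfl

theorem lift_pt (f : Z → ℝ) (q : ℰ → ℝ) (e : ℰ) {j : ℕ} (hj : j ≤ N.len e) :
    N.lift f q (N.pt e j) = N.prof f q e j := by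
  have := N.len_pos e
  rcases Nat.eq_zero_or_pos j with h0 | h0
  · subst h0; rw [pt_zero, lift_inl]; simp [prof]
  · rcases hj.eq_or_lt with h1 | h1
    · subst h1; rw [pt_len, lift_inl]
      have : (N.len e : ℝ) ≠ 0 := by exact_mod_cast this.ne'
      simp [prof, div_self this]
    · have : (Sum.inr ⟨e, ⟨j - 1, by lia⟩⟩ : N.Vx) = N.pt e j := by
        rw [N.inr_eq_pt_iff]; simp only [true_and]; lia
      rw [← this, lift_inr]
      congr 1
      have : ((j - 1 : ℕ) : ℝ) = j - 1 := by push_cast [Nat.cast_sub h0]; ring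
      simp only [this]; ring

/-- The net flow of `f` out of a base vertex, with the quadratic corrections. -/
def blap (c : ℰ → ℝ) (f : Z → ℝ) (q : ℰ → ℝ) (z : Z) : ℝ :=
  ∑ e, c e *
    ((if z = N.src e then (f (N.dst e) - f (N.src e)) / N.len e + 2 * q e * N.len e else 0)
    + (if z = N.dst e then (f (N.src e) - f (N.dst e)) / N.len e + 2 * q e * N.len e else 0))

section walk

variable {c : ℰ → ℝ} (hc : ∀ e, 0 < c e) (hz : ∀ z, ∃ e, z = N.src e ∨ z = N.dst e)
include hc hz

theorem bdeg_pos (z : Z) : 0 < N.bdeg c z := by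
  rw [← rowsum_inl]; exact N.rowsum_pos hc hz _

theorem mulVec_inr (φ : N.Vx → ℝ) (e : ℰ) (i : Fin (N.len e - 1)) :
    (wMat (N.sw c)).mulVec φ (Sum.inr ⟨e, i⟩) = φ (Sum.inr ⟨e, i⟩) +
      (φ (N.pt e (i + 2)) + φ (N.pt e i) - 2 * φ (Sum.inr ⟨e, i⟩)) / 4 := by
  rw [wMat_mulVec_sub (N.sw_self c) (N.rowsum_pos hc hz), rowsum_inr]
  simp only [mul_sub, sum_sub_distrib, sum_sw_inr, ← sum_mul, rowsum_inr]
  have := (hc e).ne'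
  field_simp
  ring

theorem mulVec_inl (φ : N.Vx → ℝ) (z : Z) :
    (wMat (N.sw c)).mulVec φ (Sum.inl z) = φ (Sum.inl z) +
      (∑ e, c e * ((if z = N.src e then φ (N.pt e 1) - φ (Sum.inl (N.src e)) else 0)
        + (if z = N.dst e then φ (N.pt e (N.len e - 1)) - φ (Sum.inl (N.dst e)) else 0)))
        / (2 * N.bdeg c z) := by
  rw [wMat_mulVec_sub (N.sw_self c) (N.rowsum_pos hc hz), rowsum_inl]
  congr 2
  simp only [mul_sub, sum_sub_distrib, sum_sw_inl, ← sum_mul, rowsum_inl, bdeg]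
  rw [sum_mul, ← sum_sub_distrib]
  refine sum_congr rfl fun e _ => ?_
  rw [mul_assoc, ← mul_sub]
  congr 1
  have hne := N.src_ne_dst e
  by_cases h1 : z = N.src e
  · subst h1; simp [hne]
  · by_cases h2 : z = N.dst e
    · subst h2; simp [hne.symm]
    · simp [h1, h2]

theorem mulVec_lift_inr (f : Z → ℝ) (q : ℰ → ℝ) (e : ℰ) (i : Fin (N.len e - 1)) :
    (wMat (N.sw c)).mulVec (N.lift f q) (Sum.inr ⟨e, i⟩) =
      N.lift f q (Sum.inr ⟨e, i⟩) - q e := by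
  have hi := i.2
  rw [N.mulVec_inr hc hz, N.lift_pt f q e (by lia), N.lift_pt f q e (by lia), lift_inr]
  simp only [prof]
  push_cast
  ring

theorem mulVec_lift_inl (f : Z → ℝ) (q : ℰ → ℝ) (z : Z) :
    (wMat (N.sw c)).mulVec (N.lift f q) (Sum.inl z) = f z +
      (N.blap c f q z - 2 * ∑ e, c e * (q e * ((if z = N.src e then 1 else 0)
        + (if z = N.dst e then 1 else 0)))) / (2 * N.bdeg c z) := by
  rw [N.mulVec_inl hc hz, lift_inl]
  congr 2
  rw [blap, mul_sum, ← sum_sub_distrib]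
  refine sum_congr rfl fun e _ => ?_
  have := N.len_pos e
  have hl : (N.len e : ℝ) ≠ 0 := by exact_mod_cast this.ne'
  rw [N.lift_pt f q e this, N.lift_pt f q e (Nat.sub_le _ _), lift_inl, lift_inl]
  simp only [prof]
  rw [Nat.cast_sub (show 1 ≤ N.len e from this)]
  split_ifs <;> field_simp <;> push_cast <;> ring

/-- Supersolution property of a lifted function with unit curvature. -/
theorem mulVec_lift_le_sub_one (f : Z → ℝ) (u : N.Vx)
    (h : ∀ z, u = Sum.inl z → N.blap c f (fun _ => 1) z ≤ 0) :
    (wMat (N.sw c)).mulVec (N.lift f fun _ => 1) u ≤ N.lift f (fun _ => 1) u - 1 := by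
  rcases u with z | ⟨e, i⟩
  · rw [N.mulVec_lift_inl hc hz, lift_inl]
    have hb := N.bdeg_pos hc hz z
    simp only [one_mul]
    change _ + (_ - 2 * N.bdeg c z) / _ ≤ _
    have : N.blap c f (fun _ => 1) z / (2 * N.bdeg c z) ≤ 0 :=
      div_nonpos_of_nonpos_of_nonneg (h z rfl) (by linarith)
    rw [sub_div, div_self (by linarith)]
    linarith
  · rw [N.mulVec_lift_inr hc hz]

/-- Exact Poisson equation for a lifted function with unit curvature near `z`. -/
theorem mulVec_lift_eq_sub_one (f : Z → ℝ) (q : ℰ → ℝ) (z : Z)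
    (hq : ∀ e, z = N.src e ∨ z = N.dst e → q e = 1) (h : N.blap c f q z = 0) :
    (wMat (N.sw c)).mulVec (N.lift f q) (Sum.inl z) = f z - 1 := by
  rw [N.mulVec_lift_inl hc hz, h]
  have hb := N.bdeg_pos hc hz z
  have : ∑ e, c e * (q e * ((if z = N.src e then 1 else 0) + (if z = N.dst e then 1 else 0)))
      = N.bdeg c z := by
    refine sum_congr rfl fun e _ => ?_
    by_cases he : z = N.src e ∨ z = N.dst e
    · rw [hq e he, one_mul]
    · push Not at he
      simp [he.1, he.2]
  rw [this]
  field_simp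
  ring

theorem mulVec_lift_le (f : Z → ℝ) {q : ℰ → ℝ} (hq : ∀ e, 0 ≤ q e) (u : N.Vx)
    (h : ∀ z, u = Sum.inl z → N.blap c f q z ≤ 0) :
    (wMat (N.sw c)).mulVec (N.lift f q) u ≤ N.lift f q u := by
  rcases u with z | ⟨e, i⟩
  · rw [N.mulVec_lift_inl hc hz, lift_inl]
    have hb := N.bdeg_pos hc hz z
    have h2 : 0 ≤ ∑ e, c e * (q e * ((if z = N.src e then 1 else 0)
        + (if z = N.dst e then 1 else 0))) :=
      sum_nonneg fun e _ => mul_nonneg (hc e).le (mul_nonneg (hq e) (by positivity))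
    have : (N.blap c f q z - 2 * ∑ e, c e * (q e * ((if z = N.src e then 1 else 0)
        + (if z = N.dst e then 1 else 0)))) / (2 * N.bdeg c z) ≤ 0 :=
      div_nonpos_of_nonpos_of_nonneg (by linarith [h z rfl]) (by linarith)
    linarith
  · rw [N.mulVec_lift_inr hc hz]; linarith [hq e]

theorem prof_step_abs (f : Z → ℝ) {q : ℰ → ℝ} {e : ℰ} (h0 : 0 ≤ q e) (h1 : q e ≤ 1)
    {j : ℕ} (hj : j + 1 ≤ N.len e) :
    |N.prof f q e (j + 1 : ℕ) - N.prof f q e j| ≤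
      |f (N.dst e) - f (N.src e)| / N.len e + 2 * N.len e := by
  have hl : (0 : ℝ) < N.len e := by exact_mod_cast N.len_pos e
  have hjr : (j : ℝ) + 1 ≤ N.len e := by exact_mod_cast hj
  have hj0 : (0 : ℝ) ≤ j := j.cast_nonneg
  have e1 : N.prof f q e (j + 1 : ℕ) - N.prof f q e j =
      (f (N.dst e) - f (N.src e)) / N.len e + 2 * q e * (N.len e - 2 * j - 1) := by
    simp only [prof]; push_cast; field_simp; ring
  rw [e1]
  refine (abs_add_le _ _).trans (add_le_add (by rw [abs_div, abs_of_pos hl]) ?_)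
  rw [abs_mul, abs_of_nonneg (by linarith)]
  have : |(N.len e : ℝ) - 2 * j - 1| ≤ N.len e := by rw [abs_le]; constructor <;> linarith
  have h3 := abs_nonneg ((N.len e : ℝ) - 2 * j - 1)
  nlinarith

/-- A lifted supersolution that dominates the local variance of a lifted function. -/
theorem mulVec_lift_le_sub_variance (f g : Z → ℝ) {q p : ℰ → ℝ} (hq0 : ∀ e, 0 ≤ q e)
    (hq1 : ∀ e, q e ≤ 1)
    (hp : ∀ e, (|f (N.dst e) - f (N.src e)| / N.len e + 2 * N.len e) ^ 2 ≤ p e) (u : N.Vx)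
    (h : ∀ z, u = Sum.inl z → N.blap c g p z ≤ 0) :
    (wMat (N.sw c)).mulVec (N.lift g p) u ≤ N.lift g p u
      - ∑ y, wMat (N.sw c) u y * (N.lift f q y - N.lift f q u) ^ 2 := by
  have hsq : ∀ (e : ℰ) (j : ℕ), j + 1 ≤ N.len e →
      (N.prof f q e (j + 1 : ℕ) - N.prof f q e j) ^ 2 ≤ p e := by
    intro e j hj
    refine le_trans ?_ (hp e)
    rw [← sq_abs]
    exact pow_le_pow_left₀ (abs_nonneg _) (N.prof_step_abs hc hz f (hq0 e) (hq1 e) hj) 2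
  change _ ≤ _ - (wMat (N.sw c)).mulVec (fun y => (N.lift f q y - N.lift f q u) ^ 2) u
  rcases u with z | ⟨e, i⟩
  · rw [N.mulVec_lift_inl hc hz, N.mulVec_inl hc hz, lift_inl]
    have hb := N.bdeg_pos hc hz z
    have e0 : (N.lift f q (Sum.inl z) - N.lift f q (Sum.inl z)) ^ 2 = 0 := by ring
    simp only [e0, zero_add]
    have key : (∑ e, c e * ((if z = N.src e then
          (N.lift f q (N.pt e 1) - N.lift f q (Sum.inl z)) ^ 2
            - (N.lift f q (Sum.inl (N.src e)) - N.lift f q (Sum.inl z)) ^ 2 else 0)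
        + (if z = N.dst e then (N.lift f q (N.pt e (N.len e - 1)) - N.lift f q (Sum.inl z)) ^ 2
            - (N.lift f q (Sum.inl (N.dst e)) - N.lift f q (Sum.inl z)) ^ 2 else 0))) ≤
        ∑ e, c e * (p e * ((if z = N.src e then 1 else 0) + (if z = N.dst e then 1 else 0))) := by
      refine sum_le_sum fun e _ => mul_le_mul_of_nonneg_left ?_ (hc e).le
      have hl := N.len_pos e
      rw [mul_add]
      refine add_le_add ?_ ?_
      · split_ifs with h1
        · subst h1
          rw [N.lift_pt f q e hl, ← N.pt_zero, N.lift_pt f q e (Nat.zero_le _)]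
          have := hsq e 0 (by lia)
          rw [zero_add] at this
          linarith
        · simp
      · split_ifs with h1
        · subst h1
          rw [N.lift_pt f q e (Nat.sub_le _ _), ← N.pt_len, N.lift_pt f q e le_rfl]
          have := hsq e (N.len e - 1) (by lia)
          rw [Nat.sub_add_cancel (show 1 ≤ N.len e from hl)] at this
          nlinarith
        · simp
    have h2 := h z rfl
    rw [le_sub_iff_add_le, add_assoc, ← add_div, add_le_iff_nonpos_right]
    have h4 : 0 ≤ ∑ e, c e * (p e * ((if z = N.src e then 1 else 0)
        + (if z = N.dst e then 1 else 0))) :=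
      sum_nonneg fun e _ => mul_nonneg (hc e).le
        (mul_nonneg ((sq_nonneg _).trans (hp e)) (by positivity))
    exact div_nonpos_of_nonpos_of_nonneg (by linarith) (by linarith)
  · have hi := i.2
    rw [N.mulVec_lift_inr hc hz, N.mulVec_inr hc hz]
    have e1 : N.lift f q (Sum.inr ⟨e, i⟩) = N.prof f q e (i + 1 : ℕ) := by
      rw [lift_inr]; push_cast; rfl
    rw [N.lift_pt f q e (by lia), N.lift_pt f q e (by lia), e1]
    have h1 := hsq e i (by lia)
    have h2 := hsq e (i + 1) (by lia)
    have h3 : 0 ≤ p e := (sq_nonneg _).trans (hp e)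
    rw [show i.1 + 1 + 1 = i.1 + 2 from rfl] at h2
    nlinarith

end walk

/-- Bound on a lifted function from bounds at the base. -/
theorem lift_le {f : Z → ℝ} {q : ℰ → ℝ} {e : ℰ} {B : ℝ} (hq : 0 ≤ q e) (hs : f (N.src e) ≤ B)
    (hd : f (N.dst e) ≤ B) (i : Fin (N.len e - 1)) :
    N.lift f q (Sum.inr ⟨e, i⟩) ≤ B + q e * N.len e ^ 2 := by
  rw [lift_inr, prof]
  have hl : (0 : ℝ) < N.len e := by exact_mod_cast N.len_pos e
  have hi : (i : ℝ) + 1 ≤ N.len e := by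
    have := i.2
    have h2 : i.1 + 1 ≤ N.len e := by lia
    exact_mod_cast h2
  have hi0 : (0 : ℝ) ≤ i := i.1.cast_nonneg
  set s : ℝ := (i + 1) / N.len e with hs'
  have hs0 : 0 ≤ s := by positivity
  have hs1 : s ≤ 1 := by rw [hs', div_le_one hl]; exact hi
  have h3 : 2 * q e * ((i + 1) * (N.len e - (i + 1))) ≤ q e * N.len e ^ 2 := by
    have : 2 * (((i : ℝ) + 1) * (N.len e - (i + 1))) ≤ N.len e ^ 2 := by
      nlinarith [sq_nonneg ((N.len e : ℝ) - 2 * (i + 1))]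
    nlinarith
  nlinarith

theorem le_lift {f : Z → ℝ} {q : ℰ → ℝ} {e : ℰ} {B : ℝ} (hq : 0 ≤ q e) (hs : B ≤ f (N.src e))
    (hd : B ≤ f (N.dst e)) (i : Fin (N.len e - 1)) :
    B ≤ N.lift f q (Sum.inr ⟨e, i⟩) := by
  rw [lift_inr, prof]
  have hl : (0 : ℝ) < N.len e := by exact_mod_cast N.len_pos e
  have hi : (i : ℝ) + 1 ≤ N.len e := by
    have := i.2
    have h2 : i.1 + 1 ≤ N.len e := by lia
    exact_mod_cast h2
  have hi0 : (0 : ℝ) ≤ i := i.1.cast_nonneg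
  set s : ℝ := (i + 1) / N.len e with hs'
  have hs0 : 0 ≤ s := by positivity
  have hs1 : s ≤ 1 := by rw [hs', div_le_one hl]; exact hi
  have h3 : 0 ≤ 2 * q e * ((i + 1) * (N.len e - (i + 1))) :=
    mul_nonneg (by linarith) (mul_nonneg (by linarith) (by linarith))
  nlinarith

theorem lift_nonneg {f : Z → ℝ} {q : ℰ → ℝ} (hq : ∀ e, 0 ≤ q e) (hf : ∀ z, 0 ≤ f z)
    (u : N.Vx) : 0 ≤ N.lift f q u := by
  rcases u with z | ⟨e, i⟩
  · exact hf z
  · exact N.le_lift (hq e) (hf _) (hf _) i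

/-- The graph underlying the stretched network. -/
def graph : SimpleGraph N.Vx where
  Adj u v := N.sw (fun _ => 1) u v ≠ 0
  symm := ⟨fun u v h => by rwa [N.sw_symm]⟩
  loopless := ⟨fun u h => h (N.sw_self _ u)⟩

theorem adjW_graph : adjW N.graph = N.sw fun _ => 1 := by
  funext u v
  simp only [adjW, graph]
  rcases N.sw_eq_zero_or u v with h | ⟨e, h⟩
  · simp [h]
  · simp [h]

theorem sw_cases (c : ℰ → ℝ) {u v : N.Vx} (h : N.graph.Adj u v) : ∃ e, N.sw c u v = c e := by
  rcases N.sw_eq_zero_or u v with h' | ⟨e, h'⟩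
  · exact absurd (h' _) h
  · exact ⟨e, h' c⟩

theorem goodWeights_sw {c : ℰ → ℝ} (hc : ∀ e, 0 < c e) : GoodWeights N.graph (N.sw c) := by
  refine ⟨N.sw_symm c, fun u v h => ?_, fun u v h => ?_⟩
  · obtain ⟨e, he⟩ := N.sw_cases c h
    rw [he]; exact hc e
  · rcases N.sw_eq_zero_or u v with h' | ⟨e, h'⟩
    · exact h' c
    · exact absurd (show N.sw (fun _ => 1) u v ≠ 0 by rw [h']; exact one_ne_zero) h

theorem deg_inr (e : ℰ) (i : Fin (N.len e - 1)) : deg N.graph (Sum.inr ⟨e, i⟩) = 2 := by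
  have h := sum_adjW N.graph (Sum.inr ⟨e, i⟩)
  rw [adjW_graph, rowsum_inr] at h
  have : (deg N.graph (Sum.inr ⟨e, i⟩) : ℝ) = 2 := by rw [← h]; norm_num
  exact_mod_cast this

theorem deg_inl (z : Z) : (deg N.graph (Sum.inl z) : ℝ) = N.bdeg (fun _ => 1) z := by
  rw [← sum_adjW N.graph, adjW_graph, rowsum_inl]

end BaseNet

/-! ### The concrete network -/

namespace TreeNet

/-- Number of nodes of the binary tree (in heap numbering, with a spare node `0`). -/
def half (n : ℕ) : ℕ := 2 ^ n ^ 2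

/-- Upper bound for the number of base vertices of the tree part. -/
def size (n : ℕ) : ℕ := 2 * half n * (n + 1)

/-- The length scale. -/
def scale (n : ℕ) : ℕ := (n + 1).factorial * size n ^ 3

/-- A node of the tree together with a height. -/
abbrev Site (n : ℕ) : Type := Fin (2 * half n) × Fin (n + 1)

/-- Sites which are glued into the blob. -/
def IsBd {n : ℕ} (p : Site n) : Prop := p.1.1 = 0 ∨ half n ≤ p.1.1 ∨ p.2.1 = n

instance {n : ℕ} : DecidablePred (IsBd (n := n)) := fun _ => by unfold IsBd; infer_instance

/-- The boundary sites. -/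
abbrev Bd (n : ℕ) : Type := {p : Site n // IsBd p}

/-- Number of boundary sites. -/
def bdCard (n : ℕ) : ℕ := Fintype.card (Bd n)

/-- Enumeration of the boundary sites. -/
def idx (n : ℕ) : Bd n ≃ Fin (bdCard n) := Fintype.equivFin _

/-- Base vertices: sites and ends of dangling paths. -/
abbrev Base (n : ℕ) : Type := Site n ⊕ (Bd n × Bool)

/-- Base edges: tree edges, edges of the path through the boundary, dangling edges. -/
abbrev Edge (n : ℕ) : Type :=
  (Fin (2 * half n) × Fin n × Bool) ⊕ (Fin (bdCard n - 1) ⊕ (Bd n × Bool))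

instance (n : ℕ) : DecidableEq (Base n) := inferInstance

instance (n : ℕ) : DecidableEq (Edge n) := inferInstance

variable {n : ℕ}

theorem half_pos (n : ℕ) : 0 < half n := by unfold half; positivity

theorem size_pos (n : ℕ) : 0 < size n := by
  have := half_pos n
  unfold size; positivity

theorem scale_pos (n : ℕ) : 0 < scale n := by
  have := size_pos n
  unfold scale; positivity

/-- The parent of a node. -/
def parent (t : Fin (2 * half n)) : Fin (2 * half n) := ⟨t.1 / 2, by have := t.2; lia⟩

/-- First endpoint of an edge. -/
def src : Edge n → Base n
  | Sum.inl (t, y, true) => Sum.inl (parent t, y.castSucc)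
  | Sum.inl (t, y, false) => Sum.inl (parent t, y.succ)
  | Sum.inr (Sum.inl j) => Sum.inl ((idx n).symm ⟨j.1, by have := j.2; lia⟩).1
  | Sum.inr (Sum.inr (p, _)) => Sum.inl p.1

/-- Second endpoint of an edge. -/
def dst : Edge n → Base n
  | Sum.inl (t, y, true) => Sum.inl (t, y.succ)
  | Sum.inl (t, y, false) => Sum.inl (t, y.castSucc)
  | Sum.inr (Sum.inl j) => Sum.inl ((idx n).symm ⟨j.1 + 1, by have := j.2; lia⟩).1
  | Sum.inr (Sum.inr (p, b)) => Sum.inr (p, b)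

/-- Length of an edge. -/
def len : Edge n → ℕ
  | Sum.inl (_, y, _) => scale n / ((y.1 + 1) * (y.1 + 2))
  | Sum.inr (Sum.inl _) => 1
  | Sum.inr (Sum.inr _) => scale n

/-- The conductances, with `E` on the tree edges descending in height. -/
def wt (E : ℝ) : Edge n → ℝ
  | Sum.inl (_, _, true) => 1
  | Sum.inl (_, _, false) => E
  | Sum.inr _ => 1

theorem size_ge_two (n : ℕ) : 2 ≤ size n := by
  have := half_pos n
  unfold size; nlinarith

theorem dvd_scale {y : ℕ} (hy : y < n) : ∃ m, scale n = (y + 1) * (y + 2) * m ∧ 8 ≤ m := by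
  have h1 : (y + 1) * (y + 2) ∣ (n + 1).factorial := by
    refine Dvd.dvd.trans ⟨y.factorial, ?_⟩ (Nat.factorial_dvd_factorial (show y + 2 ≤ n + 1 by lia))
    rw [Nat.factorial_succ, Nat.factorial_succ]; ring
  obtain ⟨a, ha⟩ := h1
  refine ⟨a * size n ^ 3, by rw [scale, ha]; ring, ?_⟩
  have ha0 : 0 < a := by
    rcases Nat.eq_zero_or_pos a with h | h
    · subst h; have := Nat.factorial_pos (n + 1); lia
    · exact h
  have h3 : 2 ^ 3 ≤ size n ^ 3 := Nat.pow_le_pow_left (size_ge_two n) 3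
  nlinarith

theorem len_tree_ge (t : Fin (2 * half n)) (y : Fin n) (b : Bool) :
    8 ≤ len (Sum.inl (t, y, b) : Edge n) := by
  obtain ⟨m, hm, hm8⟩ := dvd_scale y.2
  simp only [len]
  rw [hm, Nat.mul_div_cancel_left _ (by positivity)]
  exact hm8

theorem scale_ge (n : ℕ) : size n ^ 3 ≤ scale n := by
  unfold scale
  exact Nat.le_mul_of_pos_left _ (Nat.factorial_pos _)

theorem scale_ge_eight (n : ℕ) : 8 ≤ scale n :=
  (Nat.pow_le_pow_left (size_ge_two n) 3).trans (scale_ge n)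

/-- The base network. -/
def net (n : ℕ) : BaseNet (Base n) (Edge n) where
  src := src
  dst := dst
  len := len
  len_pos := by
    rintro (⟨t, y, b⟩ | j | p)
    · have := len_tree_ge t y b; lia
    · exact one_pos
    · exact scale_pos n
  src_ne_dst := by
    rintro (⟨t, y, b⟩ | j | ⟨p, b⟩)
    · cases b <;> simp [src, dst, Fin.ext_iff]
    · simp only [src, dst, ne_eq, Sum.inl.injEq, Subtype.val_inj, EmbeddingLike.apply_eq_iff_eq,
        Fin.ext_iff]
      lia
    · simp [src, dst]
  simple := by
    have h1 : ∀ e : Edge n, len e = 1 → ∃ j, e = Sum.inr (Sum.inl j) := by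
      rintro (⟨t, y, b⟩ | j | ⟨p, b⟩) h
      · have := len_tree_ge t y b; lia
      · exact ⟨j, rfl⟩
      · have := scale_ge_eight n
        simp only [len] at h; lia
    intro e e' he he' h
    obtain ⟨j, rfl⟩ := h1 e he
    obtain ⟨j', rfl⟩ := h1 e' he'
    simp only [src, dst, Sum.inl.injEq, Subtype.val_inj, EmbeddingLike.apply_eq_iff_eq,
      Fin.ext_iff, Sum.inr.injEq] at h ⊢
    lia

theorem wt_pos {E : ℝ} (hE : 0 < E) (e : Edge n) : 0 < wt E e := by
  rcases e with ⟨t, y, b⟩ | j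
  · cases b
    · exact hE
    · exact one_pos
  · exact one_pos

theorem exists_edge (z : Base n) : ∃ e, z = (net n).src e ∨ z = (net n).dst e := by
  rcases z with ⟨t, x⟩ | p
  · by_cases hx : x.1 < n
    · exact ⟨Sum.inl (t, ⟨x.1, hx⟩, false), Or.inr rfl⟩
    · have : IsBd (t, x) := Or.inr (Or.inr (by have := x.2; simp only; lia))
      exact ⟨Sum.inr (Sum.inr (⟨(t, x), this⟩, true)), Or.inl rfl⟩
  · exact ⟨Sum.inr (Sum.inr p), Or.inr rfl⟩

theorem sum_range_two_mul (M : ℕ) (F : ℕ → ℝ) :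
    ∑ s ∈ range (2 * M), F s = ∑ m ∈ range M, (F (2 * m) + F (2 * m + 1)) := by
  induction M with
  | zero => simp
  | succ M ih =>
    rw [show 2 * (M + 1) = 2 * M + 1 + 1 by ring, sum_range_succ, sum_range_succ, ih,
      sum_range_succ]; ring

theorem sum_children (M t : ℕ) (A : ℕ → ℝ) :
    ∑ s : Fin (2 * M), (if t = s.1 / 2 then A s.1 else 0) =
      if t < M then A (2 * t) + A (2 * t + 1) else 0 := by
  rw [Fin.sum_univ_eq_sum_range fun s => if t = s / 2 then A s else 0, sum_range_two_mul]
  have : ∀ m, ((if t = 2 * m / 2 then A (2 * m) else 0)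
      + if t = (2 * m + 1) / 2 then A (2 * m + 1) else 0) =
      if t = m then A (2 * m) + A (2 * m + 1) else 0 := by
    intro m
    rw [show 2 * m / 2 = m by lia, show (2 * m + 1) / 2 = m by lia]
    split_ifs <;> simp
  simp only [this, sum_ite_eq, mem_range]

theorem sum_heights (x : ℕ) (A : ℕ → ℝ) :
    ∑ y : Fin n, (if x = y.1 then A y.1 else 0) = if x < n then A x else 0 := by
  rw [Fin.sum_univ_eq_sum_range fun y => if x = y then A y else 0]
  simp only [sum_ite_eq, mem_range]

theorem sum_heights_succ {x : ℕ} (hx : x ≤ n) (A : ℕ → ℝ) :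
    ∑ y : Fin n, (if x = y.1 + 1 then A y.1 else 0) = if 0 < x then A (x - 1) else 0 := by
  rw [Fin.sum_univ_eq_sum_range fun y => if x = y + 1 then A y else 0]
  rcases x with _ | x
  · simp
  · simp only [add_left_inj, sum_ite_eq, mem_range, Nat.add_sub_cancel]
    rw [if_pos (by lia), if_pos (by lia)]

/-- Sum over the tree edges at a site. -/
theorem sum_tree_edges (E : ℝ) (a b : ℕ → ℕ → Bool → ℝ) (t : Fin (2 * half n)) (x : Fin (n + 1)) :
    ∑ e : Fin (2 * half n) × Fin n × Bool, wt E (Sum.inl e : Edge n) *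
      ((if (Sum.inl (t, x) : Base n) = src (Sum.inl e) then a e.1.1 e.2.1.1 e.2.2 else 0)
      + (if (Sum.inl (t, x) : Base n) = dst (Sum.inl e) then b e.1.1 e.2.1.1 e.2.2 else 0)) =
    (if t.1 < half n then if x.1 < n then a (2 * t) x true + a (2 * t + 1) x true else 0 else 0)
    + (if 0 < x.1 then b t (x - 1) true else 0)
    + E * ((if t.1 < half n then if 0 < x.1 then
        a (2 * t) (x - 1) false + a (2 * t + 1) (x - 1) false else 0 else 0)
      + (if x.1 < n then b t x false else 0)) := by
  have hxn : x.1 ≤ n := by have := x.2; lia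
  rw [Fintype.sum_prod_type]
  simp only [Fintype.sum_prod_type, Fintype.sum_bool, wt, src, dst, Sum.inl.injEq, Prod.mk.injEq,
    Fin.ext_iff, parent, Fin.val_castSucc, Fin.val_succ, one_mul, sum_add_distrib, ← mul_sum,
    ite_and]
  congr 1
  · congr 1
    · refine Eq.trans (sum_congr rfl fun s _ => ?_) ((sum_children (half n) t
        fun s => if x.1 < n then a s x true else 0).trans (by split_ifs <;> simp))
      rcases eq_or_ne t.1 (s.1 / 2) with h | h
      · simp only [h, if_true]
        exact sum_heights x fun y => a s y true
      · simp [h]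
    · rw [sum_eq_single t]
      · simp only [if_true]
        rw [sum_heights_succ hxn fun y => b t y true]
      · intro s _ hs
        refine sum_eq_zero fun y _ => if_neg fun h => hs (Fin.ext h.symm)
      · simp
  · congr 2
    · refine Eq.trans (sum_congr rfl fun s _ => ?_) ((sum_children (half n) t
        fun s => if 0 < x.1 then a s (x - 1) false else 0).trans (by split_ifs <;> simp))
      rcases eq_or_ne t.1 (s.1 / 2) with h | h
      · simp only [h, if_true]
        exact sum_heights_succ hxn fun y => a s y false
      · simp [h]
    · rw [sum_eq_single t]
      · simp only [if_true]
        rw [sum_heights x fun y => b t y false]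
      · intro s _ hs
        refine sum_eq_zero fun y _ => if_neg fun h => hs (Fin.ext h.symm)
      · simp

end TreeNet

/-! ### The Laplacian of the concrete network -/

theorem BaseNet.blap_mono {Z ℰ : Type} [Fintype Z] [Fintype ℰ] [DecidableEq Z] [DecidableEq ℰ]
    (N : BaseNet Z ℰ) {c : ℰ → ℝ} (hc : ∀ e, 0 < c e) {f g : Z → ℝ} (q : ℰ → ℝ) {z : Z}
    (hz : f z = g z) (h : ∀ z, f z ≤ g z) : N.blap c f q z ≤ N.blap c g q z := by
  refine sum_le_sum fun e _ => mul_le_mul_of_nonneg_left (add_le_add ?_ ?_) (hc e).le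
  · split_ifs with h1
    · rw [← h1, hz]
      have := h (N.dst e)
      gcongr
    · exact le_rfl
  · split_ifs with h1
    · rw [← h1, hz]
      have := h (N.src e)
      gcongr
    · exact le_rfl

namespace TreeNet
variable {n : ℕ}

theorem scale_cast_pos (n : ℕ) : (0 : ℝ) < scale n := by exact_mod_cast scale_pos n

theorem len_tree_cast (t : Fin (2 * half n)) (y : Fin n) (b : Bool) :
    ((net n).len (Sum.inl (t, y, b)) : ℝ) = scale n / (((y.1 : ℝ) + 1) * (y.1 + 2)) := by
  obtain ⟨m, hm, -⟩ := dvd_scale y.2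
  have : (net n).len (Sum.inl (t, y, b)) = m := by
    change scale n / ((y.1 + 1) * (y.1 + 2)) = m
    rw [hm, Nat.mul_div_cancel_left _ (by positivity)]
  rw [this, hm]
  push_cast
  field_simp

theorem src_true (t : Fin (2 * half n)) (y : Fin n) :
    (net n).src (Sum.inl (t, y, true)) = Sum.inl (parent t, y.castSucc) := rfl

theorem src_false (t : Fin (2 * half n)) (y : Fin n) :
    (net n).src (Sum.inl (t, y, false)) = Sum.inl (parent t, y.succ) := rfl

theorem dst_true (t : Fin (2 * half n)) (y : Fin n) :
    (net n).dst (Sum.inl (t, y, true)) = Sum.inl (t, y.succ) := rfl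

theorem dst_false (t : Fin (2 * half n)) (y : Fin n) :
    (net n).dst (Sum.inl (t, y, false)) = Sum.inl (t, y.castSucc) := rfl

/-- The contribution of the tree edges to the Laplacian. -/
def treeLap (E : ℝ) (f : Base n → ℝ) (q : Edge n → ℝ) (z : Base n) : ℝ :=
  ∑ e : Fin (2 * half n) × Fin n × Bool, wt E (Sum.inl e : Edge n) *
    ((if z = (net n).src (Sum.inl e) then (f ((net n).dst (Sum.inl e))
        - f ((net n).src (Sum.inl e))) / (net n).len (Sum.inl e)
        + 2 * q (Sum.inl e) * (net n).len (Sum.inl e) else 0)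
    + (if z = (net n).dst (Sum.inl e) then (f ((net n).src (Sum.inl e))
        - f ((net n).dst (Sum.inl e))) / (net n).len (Sum.inl e)
        + 2 * q (Sum.inl e) * (net n).len (Sum.inl e) else 0))

/-- The contribution of the remaining edges to the Laplacian. -/
def bdLap (f : Base n → ℝ) (q : Edge n → ℝ) (z : Base n) : ℝ :=
  ∑ e : Fin (bdCard n - 1) ⊕ (Bd n × Bool),
    ((if z = (net n).src (Sum.inr e) then (f ((net n).dst (Sum.inr e))
        - f ((net n).src (Sum.inr e))) / (net n).len (Sum.inr e)
        + 2 * q (Sum.inr e) * (net n).len (Sum.inr e) else 0)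
    + (if z = (net n).dst (Sum.inr e) then (f ((net n).src (Sum.inr e))
        - f ((net n).dst (Sum.inr e))) / (net n).len (Sum.inr e)
        + 2 * q (Sum.inr e) * (net n).len (Sum.inr e) else 0))

theorem blap_eq (E : ℝ) (f : Base n → ℝ) (q : Edge n → ℝ) (z : Base n) :
    (net n).blap (wt E) f q z = treeLap E f q z + bdLap f q z := by
  rw [BaseNet.blap, Fintype.sum_sum_type]
  congr 1
  refine sum_congr rfl fun e _ => ?_
  simp only [wt, one_mul]

theorem bdLap_interior (f : Base n → ℝ) (q : Edge n → ℝ) {p : Site n} (hp : ¬ IsBd p) :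
    bdLap f q (Sum.inl p) = 0 := by
  refine sum_eq_zero fun e _ => ?_
  rcases e with j | ⟨p', b⟩
  · rw [if_neg, if_neg, add_zero]
    · intro h
      simp only [net, dst, Sum.inl.injEq] at h
      exact hp (h ▸ Subtype.prop _)
    · intro h
      simp only [net, src, Sum.inl.injEq] at h
      exact hp (h ▸ Subtype.prop _)
  · rw [if_neg, if_neg, add_zero]
    · simp [net, dst]
    · intro h
      simp only [net, src, Sum.inl.injEq] at h
      exact hp (h ▸ Subtype.prop _)

theorem treeLap_le {E : ℝ} (hE : 0 < E) (f : Base n → ℝ) (q : Edge n → ℝ) (p : Site n) {K : ℝ}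
    (hK : 0 ≤ K)
    (hs : ∀ e : Fin (2 * half n) × Fin n × Bool,
      (f ((net n).dst (Sum.inl e)) - f (Sum.inl p)) / (net n).len (Sum.inl e)
        + 2 * q (Sum.inl e) * (net n).len (Sum.inl e) ≤ K)
    (hd : ∀ e : Fin (2 * half n) × Fin n × Bool,
      (f ((net n).src (Sum.inl e)) - f (Sum.inl p)) / (net n).len (Sum.inl e)
        + 2 * q (Sum.inl e) * (net n).len (Sum.inl e) ≤ K) :
    treeLap E f q (Sum.inl p) ≤ 3 * (1 + E) * K := by
  have key := sum_tree_edges E (fun _ _ _ => K) (fun _ _ _ => K) p.1 p.2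
  refine (sum_le_sum fun e _ => mul_le_mul_of_nonneg_left (add_le_add ?_ ?_)
    (wt_pos hE (Sum.inl e : Edge n)).le).trans (key.le.trans ?_)
  · change _ ≤ ite (Sum.inl p = (net n).src (Sum.inl e)) K 0
    split_ifs with h1
    · rw [← h1]; exact hs e
    · exact le_rfl
  · change _ ≤ ite (Sum.inl p = (net n).dst (Sum.inl e)) K 0
    split_ifs with h1
    · rw [← h1]; exact hd e
    · exact le_rfl
  have hEK : 0 ≤ E * K := mul_nonneg hE.le hK
  split_ifs <;> nlinarith

/-- The generator on functions of level and height (up to scaling). -/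
def levelOp (E : ℝ) (G : ℕ → ℕ → ℝ) (i x : ℕ) : ℝ :=
  ((x : ℝ) + 1) * (x + 2) * (2 * (G (i + 1) (x + 1) - G i x) + E * (G (i - 1) (x + 1) - G i x))
  + x * (x + 1) * (2 * E * (G (i + 1) (x - 1) - G i x) + (G (i - 1) (x - 1) - G i x))

theorem size_two_mul {t : ℕ} (ht : 1 ≤ t) : Nat.size (2 * t) = Nat.size t + 1 := by
  have := Nat.size_bit (b := false) (n := t) (by simp; lia)
  simpa [Nat.bit_val] using this

theorem size_two_mul_add_one (t : ℕ) : Nat.size (2 * t + 1) = Nat.size t + 1 := by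
  have := Nat.size_bit (b := true) (n := t) (by simp)
  simpa [Nat.bit_val] using this

theorem size_div_two (t : ℕ) : Nat.size (t / 2) = Nat.size t - 1 := by
  rcases Nat.even_or_odd' t with ⟨m, rfl | rfl⟩
  · rcases Nat.eq_zero_or_pos m with rfl | hm
    · simp
    · rw [size_two_mul hm, show 2 * m / 2 = m by lia]; rfl
  · rw [size_two_mul_add_one, show (2 * m + 1) / 2 = m by lia]; rfl

theorem blap_interior (E : ℝ) {f : Base n → ℝ} {q : Edge n → ℝ} {G : ℕ → ℕ → ℝ} {Q : ℕ → ℝ}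
    (hf : ∀ p : Site n, f (Sum.inl p) = G (Nat.size p.1) p.2)
    (hq : ∀ t y b, q (Sum.inl (t, y, b)) = Q y.1) {p : Site n} (hp : ¬ IsBd p) :
    (net n).blap (wt E) f q (Sum.inl p) = levelOp E G (Nat.size p.1) p.2 / scale n
      + 2 * scale n * ((2 + E) * Q p.2 / (((p.2.1 : ℝ) + 1) * (p.2.1 + 2))
        + (2 * E + 1) * Q (p.2 - 1) / ((p.2.1 : ℝ) * (p.2.1 + 1))) := by
  rw [blap_eq, bdLap_interior f q hp, add_zero]
  obtain ⟨t, x⟩ := p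
  have hp' : 1 ≤ t.1 ∧ t.1 < half n ∧ x.1 < n := by
    simp only [IsBd, not_or] at hp
    have := x.2
    lia
  obtain ⟨ht1, ht2, hx⟩ := hp'
  have hL := scale_cast_pos n
  have key := sum_tree_edges E
    (fun t' y b => cond b ((G (Nat.size t') (y + 1) - G (Nat.size (t' / 2)) y)
      / (scale n / (((y : ℝ) + 1) * (y + 2))) + 2 * Q y * (scale n / (((y : ℝ) + 1) * (y + 2))))
      ((G (Nat.size t') y - G (Nat.size (t' / 2)) (y + 1))
      / (scale n / (((y : ℝ) + 1) * (y + 2))) + 2 * Q y * (scale n / (((y : ℝ) + 1) * (y + 2)))))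
    (fun t' y b => cond b ((G (Nat.size (t' / 2)) y - G (Nat.size t') (y + 1))
      / (scale n / (((y : ℝ) + 1) * (y + 2))) + 2 * Q y * (scale n / (((y : ℝ) + 1) * (y + 2))))
      ((G (Nat.size (t' / 2)) (y + 1) - G (Nat.size t') y)
      / (scale n / (((y : ℝ) + 1) * (y + 2))) + 2 * Q y * (scale n / (((y : ℝ) + 1) * (y + 2)))))
    t x
  refine Eq.trans (sum_congr rfl ?_) (key.trans ?_)
  · rintro ⟨t', y, b⟩ -
    cases b
    · simp only [src_false, dst_false, hf, len_tree_cast, hq, parent, cond_false, Fin.val_succ,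
        Fin.val_castSucc]
      rfl
    · simp only [src_true, dst_true, hf, len_tree_cast, hq, parent, cond_true, Fin.val_succ,
        Fin.val_castSucc]
      rfl
  · simp only [ht2, hx, if_true, cond_true, cond_false, show 2 * t.1 / 2 = t.1 by lia,
      show (2 * t.1 + 1) / 2 = t.1 by lia, size_two_mul ht1, size_two_mul_add_one, size_div_two,
      levelOp]
    rcases Nat.eq_zero_or_pos x.1 with h0 | h0
    · simp only [h0, lt_irrefl, if_false, Nat.cast_zero]
      field_simp
      ring
    · obtain ⟨y, hy⟩ : ∃ y, x.1 = y + 1 := ⟨x.1 - 1, by lia⟩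
      simp only [hy, Nat.succ_pos, if_true, Nat.add_sub_cancel]
      push_cast
      have h1 : (y : ℝ) + 1 ≠ 0 := by positivity
      have h2 : (y : ℝ) + 2 ≠ 0 := by positivity
      have h3 : (y : ℝ) + 3 ≠ 0 := by positivity
      rw [show (y : ℝ) + 1 + 1 = y + 2 by ring, show (y : ℝ) + 1 + 2 = y + 3 by ring]
      field_simp
      ring

theorem bdCard_le (n : ℕ) : bdCard n ≤ size n := by
  refine (Fintype.card_subtype_le _).trans ?_
  simp [size]

theorem bdCard_pos (n : ℕ) : 0 < bdCard n :=
  Fintype.card_pos_iff.2 ⟨⟨⟨⟨0, by have := half_pos n; lia⟩, 0⟩, Or.inl rfl⟩⟩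

end TreeNet

/-! ### Hitting times of a reference vertex -/

namespace TreeNet
variable {n : ℕ}

/-- A concave function along the path through the boundary. -/
def bdVal (n k : ℕ) : ℝ := size n * scale n * (k * (2 * size n - k))

theorem size_cast_ge_two (n : ℕ) : (2 : ℝ) ≤ size n := by exact_mod_cast size_ge_two n

theorem scale_cast_ge (n : ℕ) : (size n : ℝ) ^ 3 ≤ scale n := by exact_mod_cast scale_ge n

theorem bdVal_nonneg {k : ℕ} (hk : k ≤ size n) : 0 ≤ bdVal n k := by
  have : (k : ℝ) ≤ size n := by exact_mod_cast hk
  have h0 : (0 : ℝ) ≤ k := k.cast_nonneg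
  have := scale_cast_pos n
  unfold bdVal
  exact mul_nonneg (by positivity) (mul_nonneg h0 (by linarith))

theorem bdVal_le (k : ℕ) : bdVal n k ≤ (scale n : ℝ) ^ 2 := by
  have h1 : (k : ℝ) * (2 * size n - k) ≤ size n ^ 2 := by nlinarith [sq_nonneg ((k : ℝ) - size n)]
  have hL := scale_cast_pos n
  have hB := size_cast_ge_two n
  have h2 := scale_cast_ge n
  unfold bdVal
  calc (size n : ℝ) * scale n * (k * (2 * size n - k)) ≤ size n * scale n * size n ^ 2 := by gcongr
    _ = scale n * size n ^ 3 := by ring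
    _ ≤ scale n * scale n := by gcongr
    _ = _ := by ring

theorem site_size_le (p : Site n) : Nat.size p.1 ≤ n ^ 2 + 1 := by
  rw [Nat.size_le]
  have := p.1.2
  unfold half at this
  exact this.trans_eq (pow_succ' 2 _).symm

theorem interior_bounds {p : Site n} (hp : ¬ IsBd p) :
    1 ≤ Nat.size p.1 ∧ Nat.size p.1 ≤ n ^ 2 ∧ p.2.1 < n := by
  simp only [IsBd, not_or, half, not_le] at hp
  refine ⟨?_, ?_, ?_⟩
  · rw [Nat.succ_le_iff, Nat.size_pos]
    exact Nat.pos_of_ne_zero hp.1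
  · rw [Nat.size_le]
    exact hp.2.1
  · exact lt_of_le_of_ne (Nat.lt_succ_iff.1 p.2.2) hp.2.2

/-- The position of a boundary site on the path. -/
def bdPos (p : Bd n) : ℕ := (idx n p).1

theorem bdPos_lt (p : Bd n) : bdPos p < bdCard n := (idx n p).2

/-- The base vertex at which the path through the boundary starts. -/
def origin (n : ℕ) : Bd n := (idx n).symm ⟨0, bdCard_pos n⟩

theorem bdPos_pos {p : Bd n} (hp : p ≠ origin n) : 0 < bdPos p := by
  rcases Nat.eq_zero_or_pos (bdPos p) with h | h
  · refine absurd ?_ hp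
    rw [origin, Equiv.eq_symm_apply]
    exact Fin.ext h
  · exact h

theorem bdPos_symm (k : Fin (bdCard n)) : bdPos ((idx n).symm k) = k := by
  simp [bdPos]

theorem site_eq_symm_iff (p : Bd n) (k : Fin (bdCard n)) :
    (Sum.inl p.1 : Base n) = Sum.inl ((idx n).symm k).1 ↔ bdPos p = k := by
  rw [Sum.inl.injEq, Subtype.val_inj, Equiv.eq_symm_apply, Fin.ext_iff]
  rfl

/-- The Laplacian at the boundary of a function which is a given function `b` of the position. -/
theorem bdLap_boundary (f : Base n → ℝ) (q : Edge n → ℝ) (b : ℕ → ℝ)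
    (hf : ∀ p : Bd n, f (Sum.inl p.1) = b (bdPos p)) (hq : ∀ e, q (Sum.inr e) = 1) (p : Bd n) :
    bdLap f q (Sum.inl p.1) =
      ((if bdPos p < bdCard n - 1 then b (bdPos p + 1) - b (bdPos p) + 2 else 0)
      + (if 0 < bdPos p then b (bdPos p - 1) - b (bdPos p) + 2 else 0))
      + ((f (Sum.inr (p, true)) - b (bdPos p)) / scale n + 2 * scale n
        + ((f (Sum.inr (p, false)) - b (bdPos p)) / scale n + 2 * scale n)) := by
  rw [bdLap, Fintype.sum_sum_type]
  congr 1
  · have h1 : ∀ j : Fin (bdCard n - 1), (net n).src (Sum.inr (Sum.inl j)) =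
        Sum.inl ((idx n).symm ⟨j.1, by have := j.2; lia⟩).1 := fun j => rfl
    have h2 : ∀ j : Fin (bdCard n - 1), (net n).dst (Sum.inr (Sum.inl j)) =
        Sum.inl ((idx n).symm ⟨j.1 + 1, by have := j.2; lia⟩).1 := fun j => rfl
    have h3 : ∀ j : Fin (bdCard n - 1), (net n).len (Sum.inr (Sum.inl j)) = 1 := fun j => rfl
    simp only [h1, h2, h3, site_eq_symm_iff, hf, bdPos_symm, hq, Nat.cast_one, div_one, mul_one,
      sum_add_distrib]
    congr 1
    · rw [← sum_heights (bdPos p) fun k => b (k + 1) - b k + 2]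
    · rw [← sum_heights_succ (n := bdCard n - 1) (by have := bdPos_lt p; lia)
        fun k => b k - b (bdPos p) + 2]
      refine sum_congr rfl fun y _ => ?_
      split_ifs with h
      · rw [h]
      · rfl
  · rw [Fintype.sum_prod_type, sum_eq_single p]
    · have h1 : ∀ c, (net n).src (Sum.inr (Sum.inr (p, c))) = Sum.inl p.1 := fun c => rfl
      have h2 : ∀ c, (net n).dst (Sum.inr (Sum.inr (p, c))) = Sum.inr (p, c) := fun c => rfl
      have h3 : ∀ c, (net n).len (Sum.inr (Sum.inr (p, c))) = scale n := fun c => rfl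
      simp [h1, h2, h3, hf, hq]
    · intro p' _ hp'
      refine sum_eq_zero fun c _ => ?_
      rw [if_neg, if_neg, add_zero]
      · simp [net, dst]
      · simp only [net, src, Sum.inl.injEq]
        exact fun h => hp' (Subtype.ext h.symm)
    · simp

theorem treeLap_leaf (E : ℝ) (f : Base n → ℝ) (q : Edge n → ℝ) (z : Bd n × Bool) :
    treeLap E f q (Sum.inr z) = 0 := by
  refine sum_eq_zero ?_
  rintro ⟨t, y, b⟩ -
  rw [if_neg, if_neg] <;> cases b <;> simp [net, src, dst]

theorem bdLap_leaf (f : Base n → ℝ) (q : Edge n → ℝ) (z : Bd n × Bool) :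
    bdLap f q (Sum.inr z) = (f (Sum.inl z.1.1) - f (Sum.inr z)) / scale n
      + 2 * q (Sum.inr (Sum.inr z)) * scale n := by
  rw [bdLap, sum_eq_single (Sum.inr z)]
  · rw [if_neg, if_pos, zero_add]
    · rfl
    · rfl
    · simp [net, src]
  · rintro (j | z') - h
    · rw [if_neg, if_neg] <;> simp [net, src, dst]
    · rw [if_neg, if_neg]
      · simp
      · simp only [net, dst, Sum.inr.injEq]
        rintro rfl; exact h rfl
      · simp [net, src]
  · simp

/-- The base values of a function dominating the expected hitting time of the origin. -/
def hitBase (U : ℕ → ℕ → ℝ) : Base n → ℝ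
  | Sum.inl p => if hp : IsBd p then bdVal n (bdPos ⟨p, hp⟩)
      else U (Nat.size p.1) p.2 + (scale n : ℝ) ^ 2
  | Sum.inr (p, _) => bdVal n (bdPos p) + 2 * (scale n : ℝ) ^ 2

theorem hitBase_bd (U : ℕ → ℕ → ℝ) (p : Bd n) :
    hitBase U (Sum.inl p.1) = bdVal n (bdPos p) := by
  rw [hitBase, dif_pos p.2]

theorem bdPos_le_size (p : Bd n) : bdPos p + 1 ≤ size n := (bdPos_lt p).trans_le (bdCard_le n)

section hit

variable {E u : ℝ} {U : ℕ → ℕ → ℝ}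
  (hU0 : ∀ i x, i ≤ n ^ 2 + 1 → x ≤ n → 0 ≤ U i x)
  (hU1 : ∀ i x, i ≤ n ^ 2 + 1 → x ≤ n → U i x ≤ u * (scale n : ℝ) ^ 2)
include hU0

theorem hitBase_nonneg (z : Base n) : 0 ≤ hitBase U z := by
  rcases z with p | ⟨p, b⟩
  · simp only [hitBase]
    split_ifs with hp
    · exact bdVal_nonneg (by have := bdPos_le_size ⟨p, hp⟩; lia)
    · have := hU0 (Nat.size p.1) p.2 (site_size_le p) (by have := p.2.2; lia)
      positivity
  · simp only [hitBase]
    have := bdVal_nonneg (n := n) (k := bdPos p) (by have := bdPos_le_size p; lia)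
    positivity

theorem hitBase_le_interior (p : Site n) :
    hitBase U (Sum.inl p) ≤ U (Nat.size p.1) p.2 + (scale n : ℝ) ^ 2 := by
  have := hU0 (Nat.size p.1) p.2 (site_size_le p) (by have := p.2.2; lia)
  simp only [hitBase]
  split_ifs with hp
  · have := bdVal_le (n := n) (bdPos ⟨p, hp⟩)
    linarith
  · exact le_rfl

include hU1

theorem hit_supersolution (hE : 1 ≤ E)
    (hU : ∀ i x, 1 ≤ i → i ≤ n ^ 2 → x < n → levelOp E U i x + 2 * (scale n : ℝ) ^ 2 *
      ((2 + E) / (((x : ℝ) + 1) * (x + 2)) + (2 * E + 1) / ((x : ℝ) * (x + 1))) ≤ 0)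
    (hB : 3 * (1 + E) * (((n : ℝ) + 1) ^ 2 * (u + 1) + 2) + 9 ≤ 2 * size n)
    (v : (net n).Vx) (hv : v ≠ Sum.inl (Sum.inl (origin n).1)) :
    (wMat ((net n).sw (wt E))).mulVec ((net n).lift (hitBase U) fun _ => 1) v ≤
      (net n).lift (hitBase U) (fun _ => 1) v - 1 := by
  have hL := scale_cast_pos n
  have hE0 : 0 < E := by linarith
  refine (net n).mulVec_lift_le_sub_one (wt_pos hE0) exists_edge _ _ ?_
  rintro (p | z) rfl
  · by_cases hp : IsBd p
    · have ho : (⟨p, hp⟩ : Bd n) ≠ origin n := fun h => hv (by rw [← h])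
      have hk := bdPos_pos ho
      have hkB := bdPos_le_size ⟨p, hp⟩
      rw [blap_eq]
      have h1 : treeLap E (hitBase U) (fun _ => 1) (Sum.inl p) ≤
          3 * (1 + E) * (scale n * (((n : ℝ) + 1) ^ 2 * (u + 1) + 2)) := by
        have hu : 0 ≤ u := by
          have := (hU0 0 0 (Nat.zero_le _) (Nat.zero_le _)).trans
            (hU1 0 0 (Nat.zero_le _) (Nat.zero_le _))
          by_contra hcon
          push Not at hcon
          nlinarith [pow_pos hL 2]
        have hp0 := hitBase_nonneg hU0 (Sum.inl p)
        have key : ∀ (p' : Site n) (e : Fin (2 * half n) × Fin n × Bool),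
            (hitBase U (Sum.inl p') - hitBase U (Sum.inl p)) / (net n).len (Sum.inl e)
              + 2 * 1 * (net n).len (Sum.inl e) ≤
              scale n * (((n : ℝ) + 1) ^ 2 * (u + 1) + 2) := by
          rintro p' ⟨t, y, b⟩
          have h2 := hitBase_le_interior hU0 p'
          have h3 := hU1 (Nat.size p'.1) p'.2 (site_size_le p') (by have := p'.2.2; lia)
          have h4 : hitBase U (Sum.inl p') - hitBase U (Sum.inl p) ≤ (u + 1) * (scale n : ℝ) ^ 2 := by
            linarith
          have hy : (y.1 : ℝ) + 1 ≤ n := by exact_mod_cast y.2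
          have hy0 : (0 : ℝ) ≤ y.1 := Nat.cast_nonneg _
          rw [len_tree_cast]
          have h5 : (hitBase U (Sum.inl p') - hitBase U (Sum.inl p)) /
              (scale n / (((y.1 : ℝ) + 1) * (y.1 + 2))) ≤ (u + 1) * (scale n : ℝ) ^ 2 /
              (scale n / (((y.1 : ℝ) + 1) * (y.1 + 2))) := by gcongr
          have h6 : (u + 1) * (scale n : ℝ) ^ 2 / (scale n / (((y.1 : ℝ) + 1) * (y.1 + 2))) =
              (u + 1) * scale n * (((y.1 : ℝ) + 1) * (y.1 + 2)) := by
            field_simp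
          have h7 : ((y.1 : ℝ) + 1) * (y.1 + 2) ≤ ((n : ℝ) + 1) ^ 2 := by nlinarith
          have h8 : (u + 1) * scale n * (((y.1 : ℝ) + 1) * (y.1 + 2)) ≤
              (u + 1) * scale n * ((n : ℝ) + 1) ^ 2 := by gcongr
          have h9 : (scale n : ℝ) / (((y.1 : ℝ) + 1) * (y.1 + 2)) ≤ scale n :=
            div_le_self hL.le (by nlinarith)
          linarith
        refine treeLap_le hE0 _ _ p (by positivity) ?_ ?_
        · rintro ⟨t, y, b⟩
          cases b
          · exact key _ _
          · exact key _ _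
        · rintro ⟨t, y, b⟩
          cases b
          · exact key _ _
          · exact key _ _
      have h2 := bdLap_boundary (hitBase U) (fun _ => 1) (bdVal n) (hitBase_bd U) (fun _ => rfl)
        ⟨p, hp⟩
      set k := bdPos ⟨p, hp⟩ with hkdef
      simp only at h2
      rw [if_pos hk] at h2
      obtain ⟨m, hm⟩ : ∃ m, k = m + 1 := ⟨k - 1, by lia⟩
      have hS : (0 : ℝ) ≤ size n * scale n := by positivity
      have hkr : (k : ℝ) + 1 ≤ size n := by exact_mod_cast hkB
      have h3 : (if k < bdCard n - 1 then bdVal n (k + 1) - bdVal n k + 2 else 0) ≤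
          size n * scale n * (2 * size n - 2 * k - 1) + 2 := by
        split_ifs
        · simp only [bdVal]; push_cast; apply le_of_eq; ring
        · have : 0 ≤ (size n : ℝ) * scale n * (2 * size n - 2 * k - 1) :=
            mul_nonneg hS (by linarith)
          linarith
      have h4 : bdVal n (k - 1) - bdVal n k + 2 =
          - (size n * scale n * (2 * size n - 2 * k + 1)) + 2 := by
        rw [hm, Nat.add_sub_cancel]; simp only [bdVal]; push_cast; ring
      have h5 : ∀ b, (hitBase U (Sum.inr (⟨p, hp⟩, b)) - bdVal n k) / scale n = 2 * scale n := by
        intro b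
        simp only [hitBase, ← hkdef]
        field_simp
        ring
      rw [h5, h5, h4] at h2
      have h8 : (8 : ℝ) ≤ scale n := by exact_mod_cast scale_ge_eight n
      have h9 := mul_le_mul_of_nonneg_right hB hL.le
      rw [h2]
      nlinarith
    · refine ((net n).blap_mono (wt_pos hE0) _ (g := fun z => Sum.elim
        (fun p => U (Nat.size p.1) p.2 + (scale n : ℝ) ^ 2) (fun z => hitBase U (Sum.inr z)) z)
        ?_ ?_).trans ?_
      · simp only [hitBase, dif_neg hp, Sum.elim_inl]
      · rintro (p' | z)
        · exact hitBase_le_interior hU0 p'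
        · exact le_rfl
      · rw [blap_interior E (G := fun i x => U i x + (scale n : ℝ) ^ 2) (Q := fun _ => 1)
          (fun _ => rfl) (fun _ _ _ => rfl) hp]
        obtain ⟨h1, h2, h3⟩ := interior_bounds hp
        have h4 := hU _ _ h1 h2 h3
        have h5 : levelOp E (fun i x => U i x + (scale n : ℝ) ^ 2) (Nat.size p.1) p.2 =
            levelOp E U (Nat.size p.1) p.2 := by
          simp only [levelOp]; ring
        rw [h5, show (2 + E) * 1 = 2 + E by ring, show (2 * E + 1) * 1 = 2 * E + 1 by ring]
        set X := (2 + E) / (((p.2.1 : ℝ) + 1) * (p.2.1 + 2)) + (2 * E + 1) / ((p.2.1 : ℝ)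
          * (p.2.1 + 1))
        have : levelOp E U (Nat.size p.1) p.2 / scale n + 2 * scale n * X =
          (levelOp E U (Nat.size p.1) p.2 + 2 * (scale n : ℝ) ^ 2 * X) / scale n := by
          field_simp
        rw [this]
        exact div_nonpos_of_nonpos_of_nonneg h4 hL.le
  · obtain ⟨p, b⟩ := z
    rw [blap_eq, treeLap_leaf, bdLap_leaf, hitBase_bd]
    simp only [hitBase]
    have : (bdVal n (bdPos p) - (bdVal n (bdPos p) + 2 * (scale n : ℝ) ^ 2)) / scale n =
        - (2 * scale n) := by
      field_simp; ring
    rw [this]; linarith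

theorem hitBase_le (z : Base n) : hitBase U z ≤ (u + 3) * (scale n : ℝ) ^ 2 := by
  have hL := scale_cast_pos n
  have hu : 0 ≤ u * (scale n : ℝ) ^ 2 := (hU0 0 0 (Nat.zero_le _) (Nat.zero_le _)).trans
      (hU1 0 0 (Nat.zero_le _) (Nat.zero_le _))
  rcases z with p | ⟨p, b⟩
  · have h2 := hitBase_le_interior hU0 p
    have h3 := hU1 (Nat.size p.1) p.2 (site_size_le p) (by have := p.2.2; lia)
    nlinarith
  · have := bdVal_le (n := n) (bdPos p)
    simp only [hitBase]
    nlinarith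

theorem hit_le (v : (net n).Vx) :
    (net n).lift (hitBase U) (fun _ => 1) v ≤ (u + 4) * (scale n : ℝ) ^ 2 := by
  have hL := scale_cast_pos n
  rcases v with z | ⟨e, i⟩
  · have := hitBase_le hU0 hU1 z
    rw [BaseNet.lift_inl]
    nlinarith
  · refine ((net n).lift_le zero_le_one (hitBase_le hU0 hU1 _) (hitBase_le hU0 hU1 _) i).trans ?_
    have hle : ((net n).len e : ℝ) ≤ scale n := by
      rcases e with ⟨t, y, b⟩ | j | z
      · rw [len_tree_cast]
        exact div_le_self hL.le (by nlinarith [(Nat.cast_nonneg y.1 : (0 : ℝ) ≤ y.1)])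
      · have := scale_ge_eight n
        have h1 : (net n).len (Sum.inr (Sum.inl j)) = 1 := rfl
        rw [h1]
        exact_mod_cast (by lia : 1 ≤ scale n)
      · exact le_rfl
    have : ((net n).len e : ℝ) ^ 2 ≤ (scale n : ℝ) ^ 2 := by gcongr
    linarith

end hit

end TreeNet

/-! ### The unperturbed walk -/

theorem IsLazyChain.dTV_le_quarter {V : Type} [Fintype V] [DecidableEq V] {P : Matrix V V ℝ}
    {π : V → ℝ} (hc : IsLazyChain P π) (o : V) {h : V → ℝ} (h0 : ∀ x, 0 ≤ h x)
    (hs : ∀ x, x ≠ o → P.mulVec h x ≤ h x - 1) {K : ℕ} (hK : 0 < K) (hh : ∀ x, h x ≤ 8 * K) :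
    dTV P π (200 * K) ≤ 1 / 4 := by
  have hKr : (0 : ℝ) < K := by exact_mod_cast hK
  have h1 := hc.mul_tvDist_sq_le o h0 hs (100 * K)
  have h2 : ∑ x, π x * h x ≤ 8 * K := by
    calc ∑ x, π x * h x ≤ ∑ x, π x * (8 * K) :=
          sum_le_sum fun x _ => mul_le_mul_of_nonneg_left (hh x) (hc.prob.1 x).le
      _ = 8 * K := by rw [← sum_mul, hc.prob.2, one_mul]
  have h3 : tvDist ((P ^ (100 * K)) o) π ≤ 17 / 100 := by
    have h4 := h1.trans h2
    push_cast at h4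
    have h5 : 100 * (2 * tvDist ((P ^ (100 * K)) o) π) ^ 2 ≤ 8 := by
      by_contra hcon
      push Not at hcon
      nlinarith [mul_lt_mul_of_pos_right hcon hKr]
    nlinarith
  refine hc.dTV_le fun x => ?_
  have h4 := hc.tvDist_add_le (fun x => x = o) (θ := 17 / 100) (by norm_num)
    (fun z hz => by rw [hz]; exact h3) (100 * K) x
  have h5 := hc.mul_surv_le (fun x => x = o) h0 hs (100 * K) x
  rw [show 100 * K + 100 * K = 200 * K by ring] at h4
  have h6 : surv P (fun x => x = o) (100 * K) x ≤ 8 / 100 := by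
    have h7 := h5.trans (hh x)
    push_cast at h7
    by_contra hcon
    push Not at hcon
    nlinarith
  linarith

namespace TreeNet
variable {n : ℕ}

theorem wt_one : (wt 1 : Edge n → ℝ) = fun _ => 1 := by
  funext e
  rcases e with ⟨t, y, b⟩ | j
  · cases b <;> rfl
  · rfl

instance : Nonempty (net n).Vx := ⟨Sum.inl (Sum.inl (origin n).1)⟩

theorem isLazyChain {E : ℝ} (hE : 0 < E) : IsLazyChain (wMat ((net n).sw (wt E)))
    (wSta ((net n).sw (wt E))) :=
  isLazyChain_wMat ((net n).sw_nonneg fun e => (wt_pos hE e).le) ((net n).sw_symm _)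
    ((net n).sw_self _) ((net n).rowsum_pos (wt_pos hE) exists_edge)

/-- The hitting time bound for the unperturbed walk. -/
def levelOne (n : ℕ) (_ x : ℕ) : ℝ := 8 * (scale n : ℝ) ^ 2 / (x + 2)

theorem levelOne_nonneg (i x : ℕ) : 0 ≤ levelOne n i x := by unfold levelOne; positivity

theorem levelOne_le (i x : ℕ) : levelOne n i x ≤ 4 * (scale n : ℝ) ^ 2 := by
  unfold levelOne
  rw [div_le_iff₀ (by positivity)]
  nlinarith [(Nat.cast_nonneg x : (0 : ℝ) ≤ x), sq_nonneg (scale n : ℝ)]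

theorem levelOp_levelOne (i x : ℕ) : levelOp 1 (levelOne n) i x + 2 * (scale n : ℝ) ^ 2 *
      ((2 + 1) / (((x : ℝ) + 1) * (x + 2)) + (2 * 1 + 1) / ((x : ℝ) * (x + 1))) ≤ 0 := by
  have hL := pow_pos (scale_cast_pos n) 2
  rcases x with _ | x
  · simp only [levelOp, levelOne]
    norm_num
    nlinarith
  · simp only [levelOp, levelOne, Nat.add_sub_cancel]
    push_cast
    have hx : (0 : ℝ) ≤ x := x.cast_nonneg
    have h : ∀ a : ℝ, 0 ≤ a → ((a + 1 + 1) * (a + 1 + 2) * (2 * (8 * (scale n : ℝ) ^ 2 / (a + 1 + 1 + 2)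
        - 8 * (scale n : ℝ) ^ 2 / (a + 1 + 2)) + 1 * (8 * (scale n : ℝ) ^ 2 / (a + 1 + 1 + 2)
        - 8 * (scale n : ℝ) ^ 2 / (a + 1 + 2))) + (a + 1) * (a + 1 + 1) *
        (2 * 1 * (8 * (scale n : ℝ) ^ 2 / (a + 2) - 8 * (scale n : ℝ) ^ 2 / (a + 1 + 2))
        + (8 * (scale n : ℝ) ^ 2 / (a + 2) - 8 * (scale n : ℝ) ^ 2 / (a + 1 + 2)))
        + 2 * (scale n : ℝ) ^ 2 * ((2 + 1) / ((a + 1 + 1) * (a + 1 + 2))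
          + (2 * 1 + 1) / ((a + 1) * (a + 1 + 1)))) =
        - (36 * (scale n : ℝ) ^ 2 * (a * (a + 2)) / ((a + 1) * (a + 2) * (a + 3) * (a + 4))) := by
      intro a ha
      rw [show a + 1 + 1 + 2 = a + 4 by ring, show a + 1 + 1 = a + 2 by ring,
        show a + 1 + 2 = a + 3 by ring]
      field_simp
      ring
    rw [h x hx]
    have : 0 ≤ 36 * (scale n : ℝ) ^ 2 * ((x : ℝ) * (x + 2)) /
      (((x : ℝ) + 1) * (x + 2) * (x + 3) * (x + 4)) := by positivity
    linarith

theorem size_cast_ge (hn : 3 ≤ n) : 16 * ((n : ℝ) + 1) ^ 2 ≤ size n := by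
  have h1 : 8 * (n + 1) ≤ 2 ^ n ^ 2 := by
    have h2 : 2 ^ (n * 3) ≤ 2 ^ n ^ 2 := Nat.pow_le_pow_right (by norm_num) (by nlinarith)
    have h3 : n + 1 ≤ 2 ^ n := Nat.lt_two_pow_self
    have h4 : 2 ^ 3 ≤ 2 ^ n := Nat.pow_le_pow_right (by norm_num) hn
    calc 8 * (n + 1) ≤ 2 ^ n * 2 ^ n := Nat.mul_le_mul h4 h3
      _ = 2 ^ (n * 2) := by ring
      _ ≤ 2 ^ (n * 3) := Nat.pow_le_pow_right (by norm_num) (by lia)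
      _ ≤ _ := h2
  have h5 : 16 * (n + 1) ^ 2 ≤ size n := by
    unfold size half
    nlinarith
  exact_mod_cast h5

theorem hit_one (hn : 3 ≤ n) (v : (net n).Vx) (hv : v ≠ Sum.inl (Sum.inl (origin n).1)) :
    (wMat ((net n).sw (wt 1))).mulVec ((net n).lift (hitBase (levelOne n)) fun _ => 1) v ≤
      (net n).lift (hitBase (levelOne n)) (fun _ => 1) v - 1 := by
  refine hit_supersolution (u := 4) (fun i x _ _ => levelOne_nonneg i x)
    (fun i x _ _ => levelOne_le i x) le_rfl (fun i x _ _ _ => levelOp_levelOne i x) ?_ v hv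
  have := size_cast_ge hn
  have hn' : (3 : ℝ) ≤ n := by exact_mod_cast hn
  nlinarith

theorem dTV_one_le (hn : 3 ≤ n) : dTV (wMat ((net n).sw (wt 1))) (wSta ((net n).sw (wt 1)))
    (200 * scale n ^ 2) ≤ 1 / 4 := by
  refine (isLazyChain one_pos).dTV_le_quarter (Sum.inl (Sum.inl (origin n).1))
    (h := (net n).lift (hitBase (levelOne n)) fun _ => 1) ?_ (hit_one hn)
    (pow_pos (scale_pos n) 2) ?_
  · exact (net n).lift_nonneg (fun _ => zero_le_one)
      (hitBase_nonneg fun i x _ _ => levelOne_nonneg i x)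
  · intro v
    refine (hit_le (u := 4) (fun i x _ _ => levelOne_nonneg i x)
      (fun i x _ _ => levelOne_le i x) v).trans_eq ?_
    push_cast; ring

theorem graph_connected (hn : 3 ≤ n) : (net n).graph.Connected := by
  refine connected_of_descent _ (Sum.inl (Sum.inl (origin n).1))
    ((net n).lift (hitBase (levelOne n)) fun _ => 1) fun v hv => ?_
  have h1 := hit_one hn v hv
  have hpos := (net n).rowsum_pos (wt_pos (n := n) one_pos) exists_edge
  rw [wMat_mulVec_sub ((net n).sw_self _) hpos] at h1
  by_contra hcon
  push Not at hcon
  have h2 : 0 ≤ (∑ u, (net n).sw (wt 1) v u * ((net n).lift (hitBase (levelOne n)) (fun _ => 1) u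
      - (net n).lift (hitBase (levelOne n)) (fun _ => 1) v)) /
      (2 * ∑ u, (net n).sw (wt 1) v u) := by
    refine div_nonneg (sum_nonneg fun u _ => ?_) (by linarith [hpos v])
    by_cases hu : (net n).graph.Adj v u
    · exact mul_nonneg ((net n).sw_nonneg (fun e => (wt_pos one_pos e).le) _ _)
        (sub_nonneg.2 (hcon u hu))
    · have h3 : (net n).sw (wt 1) v u = 0 := by
        rw [wt_one]
        by_contra h4
        exact hu h4
      rw [h3, zero_mul]
  linarith

/-- Sign of the eigenfunction on an edge. -/
def eigSign : Edge n → ℝ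
  | Sum.inr (Sum.inr (p, b)) => if p = origin n then cond b 1 (-1) else 0
  | _ => 0

/-- An antisymmetric eigenfunction living on the two dangling paths at the origin. -/
def eigFun (θ : ℝ) : (net n).Vx → ℝ
  | Sum.inl (Sum.inl _) => 0
  | Sum.inl (Sum.inr z) => eigSign (Sum.inr (Sum.inr z))
  | Sum.inr ⟨e, i⟩ => eigSign e * Real.sin (θ * (i + 1))

theorem eigFun_pt {θ : ℝ} (hθ : θ * scale n = Real.pi / 2) (e : Edge n) {j : ℕ}
    (hj : j ≤ (net n).len e) : eigFun θ ((net n).pt e j) = eigSign e * Real.sin (θ * j) := by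
  rcases Nat.eq_zero_or_pos j with rfl | h0
  · rw [BaseNet.pt_zero]
    rcases e with ⟨t, y, b⟩ | j | z
    · cases b <;> simp [net, src, eigFun]
    · simp [net, src, eigFun]
    · simp [net, src, eigFun]
  · rcases hj.eq_or_lt with rfl | h1
    · rw [BaseNet.pt_len]
      rcases e with ⟨t, y, b⟩ | j | z
      · cases b <;> simp [net, dst, eigFun, eigSign]
      · simp [net, dst, eigFun, eigSign]
      · have : (net n).len (Sum.inr (Sum.inr z)) = scale n := rfl
        rw [this, hθ]
        simp [net, dst, eigFun]
    · obtain ⟨i, rfl⟩ : ∃ i, j = i + 1 := ⟨j - 1, by lia⟩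
      have hi : i < (net n).len e - 1 := by lia
      have : (net n).pt e (i + 1) = Sum.inr ⟨e, ⟨i, hi⟩⟩ :=
        ((net n).inr_eq_pt_iff (i := ⟨i, hi⟩)).2 ⟨rfl, rfl⟩ |>.symm
      rw [this]
      simp [eigFun]

theorem sum_net_edges (F : Edge n → ℝ) : ∑ e, F e = (∑ e, F (Sum.inl e)) +
    ((∑ j, F (Sum.inr (Sum.inl j))) + ∑ p, (F (Sum.inr (Sum.inr (p, true)))
      + F (Sum.inr (Sum.inr (p, false))))) := by
  rw [Fintype.sum_sum_type, Fintype.sum_sum_type,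
    Fintype.sum_prod_type (fun z : Bd n × Bool => F (Sum.inr (Sum.inr z)))]
  simp only [Fintype.sum_bool]

theorem bdeg_leaf (z : Bd n × Bool) : (net n).bdeg (wt 1) (Sum.inr z) = 1 := by
  rw [BaseNet.bdeg, sum_eq_single (Sum.inr (Sum.inr z))]
  · simp [net, src, dst, wt]
  · rintro (⟨t, y, b⟩ | j | z') - h
    · cases b <;> simp [net, src, dst]
    · simp [net, src, dst]
    · rw [if_neg, if_neg]
      · simp
      · simp only [net, dst, Sum.inr.injEq]
        rintro rfl; exact h rfl
      · simp [net, src]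
  · simp

theorem eigFun_eigen {θ : ℝ} (hθ : θ * scale n = Real.pi / 2) :
    (wMat ((net n).sw (wt 1))).mulVec (eigFun θ) = ((1 + Real.cos θ) / 2) • eigFun θ := by
  funext v
  simp only [Pi.smul_apply, smul_eq_mul]
  rcases v with z | ⟨e, i⟩
  · rw [(net n).mulVec_inl (wt_pos one_pos) exists_edge]
    have h1 : ∀ e : Edge n, eigFun θ ((net n).pt e 1) = eigSign e * Real.sin θ := by
      intro e
      have := eigFun_pt hθ e (j := 1) ((net n).len_pos e)
      simpa using this
    rcases z with p | z
    · have hz : eigFun θ (Sum.inl (Sum.inl p) : (net n).Vx) = 0 := rfl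
      have hsum : ∑ e : Edge n, wt 1 e * ((if Sum.inl p = (net n).src e then
          eigFun θ ((net n).pt e 1) - eigFun θ (Sum.inl ((net n).src e)) else 0)
          + (if Sum.inl p = (net n).dst e then eigFun θ ((net n).pt e ((net n).len e - 1))
            - eigFun θ (Sum.inl ((net n).dst e)) else 0)) = 0 := by
        have h2 : ∀ e : Edge n, wt 1 e * ((if Sum.inl p = (net n).src e then
          eigFun θ ((net n).pt e 1) - eigFun θ (Sum.inl ((net n).src e)) else 0)
          + (if Sum.inl p = (net n).dst e then eigFun θ ((net n).pt e ((net n).len e - 1))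
            - eigFun θ (Sum.inl ((net n).dst e)) else 0)) =
            if Sum.inl p = (net n).src e then eigSign e * Real.sin θ else 0 := by
          intro e
          rw [wt_one, one_mul]
          have h3 : (if Sum.inl p = (net n).dst e then eigFun θ ((net n).pt e ((net n).len e - 1))
            - eigFun θ (Sum.inl ((net n).dst e)) else 0) = 0 := by
            split_ifs with h
            · rw [eigFun_pt hθ e (Nat.sub_le _ _), ← h, hz]
              rcases e with ⟨t, y, b⟩ | j | z
              · simp [eigSign]
              · simp [eigSign]
              · simp [net, dst] at h
            · rfl
          rw [h3, add_zero]
          split_ifs with h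
          · rw [h1, ← h, hz, sub_zero]
          · rfl
        rw [sum_congr rfl fun e _ => h2 e, sum_net_edges]
        have h4 : ∀ q : Bd n, ((if (Sum.inl p : Base n) = (net n).src (Sum.inr (Sum.inr (q, true)))
            then eigSign (Sum.inr (Sum.inr (q, true)) : Edge n) * Real.sin θ else 0)
            + if (Sum.inl p : Base n) = (net n).src (Sum.inr (Sum.inr (q, false)))
            then eigSign (Sum.inr (Sum.inr (q, false)) : Edge n) * Real.sin θ else 0) = 0 := by
          intro q
          simp only [net, src, eigSign, Sum.inl.injEq]
          split_ifs <;> simp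
        simp only [h4]
        simp [eigSign]
      rw [hsum, hz]; simp
    · have hz : eigFun θ (Sum.inl (Sum.inr z) : (net n).Vx) = eigSign (Sum.inr (Sum.inr z)) := rfl
      rw [bdeg_leaf, sum_eq_single (Sum.inr (Sum.inr z)), wt_one]
      · rw [if_neg, if_pos]
        · rw [eigFun_pt hθ _ (Nat.sub_le _ _)]
          have h2 : (net n).dst (Sum.inr (Sum.inr z)) = Sum.inr z := rfl
          have h3 : (net n).len (Sum.inr (Sum.inr z)) = scale n := rfl
          rw [h2, h3, hz, Nat.cast_sub (scale_pos n), mul_sub, hθ, Nat.cast_one, mul_one,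
            Real.sin_pi_div_two_sub]
          ring
        · rfl
        · simp [net, src]
      · rintro (⟨t, y, b⟩ | j | z') - h
        · cases b <;> simp [net, src, dst]
        · simp [net, src, dst]
        · rw [if_neg, if_neg]
          · simp
          · simp only [net, dst, Sum.inr.injEq]
            rintro rfl; exact h rfl
          · simp [net, src]
      · simp
  · have hi := i.2
    rw [(net n).mulVec_inr (wt_pos one_pos) exists_edge, eigFun_pt hθ e (by lia),
      eigFun_pt hθ e (by lia)]
    simp only [eigFun]
    have h1 : Real.sin (θ * ((i.1 + 2 : ℕ) : ℝ)) + Real.sin (θ * i.1) =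
        2 * Real.cos θ * Real.sin (θ * (i.1 + 1)) := by
      push_cast
      rw [show θ * ((i.1 : ℝ) + 2) = θ * (i.1 + 1) + θ by ring,
        show θ * (i.1 : ℝ) = θ * (i.1 + 1) - θ by ring, Real.sin_add, Real.sin_sub]
      ring
    linear_combination eigSign e / 4 * h1

theorem trel_one_bounds (hn : 3 ≤ n) :
    (scale n : ℝ) ^ 2 ≤ trel (wMat ((net n).sw (wt 1))) ∧
    trel (wMat ((net n).sw (wt 1))) ≤ 2 * tmixW ((net n).sw (wt 1)) (1 / 4) := by
  have hL := scale_cast_pos n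
  have h8 : (8 : ℝ) ≤ scale n := by exact_mod_cast scale_ge_eight n
  set θ := Real.pi / 2 / scale n with hθdef
  have hθ : θ * scale n = Real.pi / 2 := by rw [hθdef]; field_simp
  have hpi := Real.pi_pos
  have hpi4 := Real.pi_le_four
  have hθ0 : 0 < θ := by positivity
  have hθ1 : θ ≤ Real.pi := by nlinarith
  have hcos : Real.cos θ < 1 := by
    have := Real.cos_lt_cos_of_nonneg_of_le_pi le_rfl hθ1 hθ0
    rwa [Real.cos_zero] at this
  have hcos2 := Real.one_sub_sq_div_two_le_cos (x := θ)
  have h := (isLazyChain (n := n) one_pos).trel_bounds (dTV_one_le hn)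
    (μ := (1 + Real.cos θ) / 2) (by linarith) (f := eigFun θ) ?_ (eigFun_eigen hθ)
  · refine ⟨le_trans ?_ h.1, h.2⟩
    rw [le_div_iff₀ (by linarith)]
    have h1 : (scale n : ℝ) ^ 2 * θ ^ 2 ≤ 4 := by
      rw [← mul_pow, mul_comm, hθ]; nlinarith
    nlinarith [mul_le_mul_of_nonneg_left hcos2 (sq_nonneg (scale n : ℝ))]
  · intro h0
    have := congrFun h0 (Sum.inl (Sum.inr (origin n, true)))
    simp [eigFun, eigSign] at this

theorem tmixW_one_le (hn : 3 ≤ n) :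
    (tmixW ((net n).sw (wt 1)) (1 / 4) : ℝ) ≤ 200 * (scale n : ℝ) ^ 2 := by
  have : tmixW ((net n).sw (wt 1)) (1 / 4) ≤ 200 * scale n ^ 2 := Nat.sInf_le (dTV_one_le hn)
  exact_mod_cast this

theorem bdeg_one_le (z : Base n) : (net n).bdeg (fun _ => 1) z ≤ 10 := by
  rw [← wt_one]
  rcases z with p | z
  · rw [BaseNet.bdeg, sum_net_edges]
    have h1 := sum_tree_edges (n := n) 1 (fun _ _ _ => 1) (fun _ _ _ => 1) p.1 p.2
    have h2 : ∑ j : Fin (bdCard n - 1), wt 1 (Sum.inr (Sum.inl j) : Edge n) *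
        ((if Sum.inl p = (net n).src (Sum.inr (Sum.inl j)) then (1 : ℝ) else 0)
        + if Sum.inl p = (net n).dst (Sum.inr (Sum.inl j)) then 1 else 0) ≤ 2 := by
      by_cases hp : IsBd p
      · have h1 : ∀ j : Fin (bdCard n - 1), (net n).src (Sum.inr (Sum.inl j)) =
            Sum.inl ((idx n).symm ⟨j.1, by have := j.2; lia⟩).1 := fun j => rfl
        have h2 : ∀ j : Fin (bdCard n - 1), (net n).dst (Sum.inr (Sum.inl j)) =
            Sum.inl ((idx n).symm ⟨j.1 + 1, by have := j.2; lia⟩).1 := fun j => rfl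
        have h3 := site_eq_symm_iff (n := n) ⟨p, hp⟩
        simp only at h3
        simp only [h1, h2, h3, wt_one, one_mul, sum_add_distrib]
        rw [sum_heights (bdPos ⟨p, hp⟩) fun _ => 1, sum_heights_succ
          (by have := bdPos_lt (⟨p, hp⟩ : Bd n); lia) fun _ => 1]
        split_ifs <;> norm_num
      · rw [sum_eq_zero]
        · norm_num
        · intro j _
          rw [if_neg, if_neg]
          · simp
          · simp only [net, dst, Sum.inl.injEq]
            exact fun h => hp (h ▸ Subtype.prop _)
          · simp only [net, src, Sum.inl.injEq]
            exact fun h => hp (h ▸ Subtype.prop _)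
    have h3 : ∑ q : Bd n, (wt 1 (Sum.inr (Sum.inr (q, true)) : Edge n) *
        ((if Sum.inl p = (net n).src (Sum.inr (Sum.inr (q, true))) then (1 : ℝ) else 0)
        + if Sum.inl p = (net n).dst (Sum.inr (Sum.inr (q, true))) then 1 else 0) +
        wt 1 (Sum.inr (Sum.inr (q, false)) : Edge n) *
        ((if Sum.inl p = (net n).src (Sum.inr (Sum.inr (q, false))) then (1 : ℝ) else 0)
        + if Sum.inl p = (net n).dst (Sum.inr (Sum.inr (q, false))) then 1 else 0)) ≤ 2 := by
      have h4 : ∀ b, ∀ q : Bd n, (net n).src (Sum.inr (Sum.inr (q, b))) = Sum.inl q.1 :=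
        fun _ _ => rfl
      have h5 : ∀ b, ∀ q : Bd n, (net n).dst (Sum.inr (Sum.inr (q, b))) = Sum.inr (q, b) :=
        fun _ _ => rfl
      simp only [h4, h5, wt_one, Sum.inl.injEq, reduceCtorEq, if_false, add_zero, one_mul]
      by_cases hp : IsBd p
      · rw [sum_eq_single ⟨p, hp⟩]
        · simp; norm_num
        · intro q _ hq
          rw [if_neg fun h => hq (Subtype.ext h.symm), add_zero]
        · simp
      · rw [sum_eq_zero]
        · norm_num
        · intro q _
          have h : p ≠ q.1 := fun h => hp (by rw [h]; exact q.2)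
          rw [if_neg h, add_zero]
    have h6 : ∑ e : Fin (2 * half n) × Fin n × Bool, wt 1 (Sum.inl e : Edge n) *
        ((if (Sum.inl p : Base n) = (net n).src (Sum.inl e) then (1 : ℝ) else 0)
        + (if (Sum.inl p : Base n) = (net n).dst (Sum.inl e) then 1 else 0)) ≤ 6 := by
      refine h1.le.trans ?_
      split_ifs <;> norm_num
    linarith
  · rw [bdeg_leaf]; norm_num

theorem deg_le_ten (v : (net n).Vx) : deg (net n).graph v ≤ 10 := by
  rcases v with z | ⟨e, i⟩
  · have h1 := (net n).deg_inl z
    have h2 := bdeg_one_le z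
    rw [← h1] at h2
    exact_mod_cast h2
  · rw [BaseNet.deg_inr]; norm_num

end TreeNet

/-! ### The perturbed walk: functions of level and height -/

theorem exists_geometric_bound {r : ℝ} (hr0 : 0 ≤ r) (hr1 : r < 1) :
    ∃ S : ℝ, 1 ≤ S ∧ ∀ m, ∑ k ∈ range m, r ^ k * ((k : ℝ) + 1) ^ 2 ≤ S := by
  have h : Summable fun k : ℕ => r ^ k * ((k : ℝ) + 1) ^ 2 := by
    have hr : ‖r‖ < 1 := by rwa [Real.norm_of_nonneg hr0]
    have h0 := summable_geometric_of_lt_one hr0 hr1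
    have h1 := summable_pow_mul_geometric_of_norm_lt_one 1 hr
    have h2 := summable_pow_mul_geometric_of_norm_lt_one 2 hr
    refine ((h2.add (h1.mul_left 2)).add h0).congr fun k => ?_
    ring
  have h1 : ∀ m, ∑ k ∈ range m, r ^ k * ((k : ℝ) + 1) ^ 2 ≤
      ∑' k : ℕ, r ^ k * ((k : ℝ) + 1) ^ 2 := fun m =>
    h.sum_le_tsum _ fun k _ => by positivity
  refine ⟨_, ?_, h1⟩
  simpa using h1 1

theorem exists_gradient {r κ B b0 : ℝ} {b : ℕ → ℝ} (hr0 : 0 < r) (hr1 : r < 1) (hκ : 0 < κ)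
    (hb0 : 0 < b0) (hbz : b0 ≤ b 0) (hb : ∀ y, 0 ≤ b y) (hbB : ∀ y, b y ≤ B) :
    ∃ K : ℝ, 0 < K ∧ ∀ n : ℕ, 1 ≤ n → ∃ (c : ℝ) (p : ℕ → ℝ), 1 / K ≤ c ∧ c ≤ K ∧
      (∀ x, |p x| ≤ K * (((x : ℝ) + 1) * (x + 2))) ∧
      p 0 = c * κ * 2 - b 0 ∧
      ∀ x : ℕ, x + 1 < n → r * p (x + 1) = p x + r * (c * κ * (((x : ℝ) + 2) * (x + 3)) - b (x + 1)) := by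
  obtain ⟨S, hS1, hS⟩ := exists_geometric_bound hr0.le hr1
  have hB : 0 < B := lt_of_lt_of_le hb0 (hbz.trans (hbB 0))
  set K := 2 * κ * S / b0 + B / κ + 2 * B * S with hK
  have hS0 : 0 < S := by linarith
  have hK0 : 0 < K := by positivity
  refine ⟨K, hK0, fun n hn => ?_⟩
  set X := ∑ y ∈ range n, r ^ y * (((y : ℝ) + 1) * (y + 2)) with hX
  set W := ∑ y ∈ range n, r ^ y * b y with hW
  have hX2 : X ≤ 2 * S := by
    calc X ≤ ∑ y ∈ range n, 2 * (r ^ y * ((y : ℝ) + 1) ^ 2) := by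
          refine sum_le_sum fun y _ => ?_
          have : (0 : ℝ) ≤ r ^ y := by positivity
          have hy : (0 : ℝ) ≤ y := y.cast_nonneg
          nlinarith [mul_nonneg this hy, mul_nonneg (mul_nonneg this hy) hy]
      _ ≤ 2 * S := by rw [← mul_sum]; linarith [hS n]
  have hX1 : 0 < X := by
    refine sum_pos (fun y _ => by positivity) ⟨0, mem_range.2 hn⟩
  have hW0 : b0 ≤ W := by
    have := single_le_sum (f := fun y => r ^ y * b y) (s := range n)
      (fun y _ => mul_nonneg (by positivity) (hb y)) (mem_range.2 hn)
    simp only [pow_zero, one_mul] at this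
    exact hbz.trans this
  have hW1 : W ≤ B * X := by
    rw [hX, mul_sum]
    refine sum_le_sum fun y _ => ?_
    have h1 : (0 : ℝ) ≤ r ^ y := by positivity
    have h2 : (1 : ℝ) ≤ ((y : ℝ) + 1) * (y + 2) := by nlinarith [(y.cast_nonneg : (0 : ℝ) ≤ y)]
    have h3 := hbB y
    calc r ^ y * b y ≤ r ^ y * B := by gcongr
      _ ≤ B * (r ^ y * (((y : ℝ) + 1) * (y + 2))) := by
        nlinarith [mul_nonneg h1 hB.le, mul_le_mul_of_nonneg_left h2 (mul_nonneg h1 hB.le)]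
  set c := W / (κ * X) with hc
  have hc0 : 0 < c := by have : 0 < W := by linarith
                         positivity
  have hcB : c ≤ B / κ := by
    rw [hc, div_le_div_iff₀ (by positivity) hκ]; nlinarith
  set d : ℕ → ℝ := fun y => c * κ * (((y : ℝ) + 1) * (y + 2)) - b y with hd
  have hsum : ∑ y ∈ range n, r ^ y * d y = 0 := by
    have : ∑ y ∈ range n, r ^ y * d y = c * κ * X - W := by
      rw [hX, hW, mul_sum, ← sum_sub_distrib]
      exact sum_congr rfl fun y _ => by simp only [hd]; ring
    rw [this, hc]; field_simp; ring
  have hdB : ∀ y, |d y| ≤ 2 * B * (((y : ℝ) + 1) * (y + 2)) := by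
    intro y
    have h1 : c * κ ≤ B := by rwa [le_div_iff₀ hκ] at hcB
    have h2 : (1 : ℝ) ≤ ((y : ℝ) + 1) * (y + 2) := by nlinarith [(y.cast_nonneg : (0 : ℝ) ≤ y)]
    have h3 : 0 ≤ c * κ := by positivity
    rw [abs_le]
    constructor <;> simp only [hd] <;> nlinarith [hb y, hbB y]
  refine ⟨c, fun x => -∑ k ∈ range (n - 1 - x), r ^ (k + 1) * d (x + 1 + k), ?_, ?_, ?_, ?_, ?_⟩
  · have h1 : 1 / K ≤ b0 / (κ * (2 * S)) := by
      rw [div_le_div_iff₀ hK0 (by positivity), hK]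
      have : b0 * (2 * κ * S / b0) = 2 * κ * S := by field_simp
      have h2 : 0 ≤ b0 * (B / κ + 2 * B * S) := by positivity
      nlinarith
    refine h1.trans ?_
    rw [hc]
    exact div_le_div₀ (hb0.le.trans hW0) hW0 (by positivity) (by gcongr)
  · have : 0 ≤ 2 * κ * S / b0 + 2 * B * S := by positivity
    linarith
  · intro x
    rw [abs_neg]
    calc |∑ k ∈ range (n - 1 - x), r ^ (k + 1) * d (x + 1 + k)|
        ≤ ∑ k ∈ range (n - 1 - x), r ^ (k + 1) * (2 * B * (((x : ℝ) + 1) * (x + 2) *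
          (((k + 1 : ℕ) : ℝ) + 1) ^ 2)) := by
          refine (abs_sum_le_sum_abs _ _).trans (sum_le_sum fun k _ => ?_)
          rw [abs_mul, abs_of_nonneg (by positivity)]
          refine mul_le_mul_of_nonneg_left ((hdB _).trans ?_) (by positivity)
          refine mul_le_mul_of_nonneg_left ?_ (by positivity)
          push_cast
          have hx : (0 : ℝ) ≤ x := x.cast_nonneg
          have hk : (0 : ℝ) ≤ k := k.cast_nonneg
          calc ((x : ℝ) + 1 + k + 1) * (x + 1 + k + 2) ≤
              ((x + 1) * (k + 2)) * ((x + 2) * (k + 2)) := by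
                gcongr <;> nlinarith [mul_nonneg hx hk]
            _ = _ := by ring
      _ = 2 * B * (((x : ℝ) + 1) * (x + 2)) *
          ∑ k ∈ range (n - 1 - x), r ^ (k + 1) * (((k + 1 : ℕ) : ℝ) + 1) ^ 2 := by
          rw [mul_sum]; exact sum_congr rfl fun k _ => by ring
      _ ≤ 2 * B * (((x : ℝ) + 1) * (x + 2)) * S := by
          refine mul_le_mul_of_nonneg_left ?_ (by positivity)
          have := hS (n - 1 - x + 1)
          rw [sum_range_succ'] at this
          simp only [pow_zero, Nat.cast_zero] at this
          linarith
      _ ≤ K * (((x : ℝ) + 1) * (x + 2)) := by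
          have h1 : 0 ≤ 2 * κ * S / b0 + B / κ := by positivity
          have h2 : (0 : ℝ) ≤ ((x : ℝ) + 1) * (x + 2) := by positivity
          nlinarith [mul_nonneg h1 h2]
  · obtain ⟨m, rfl⟩ : ∃ m, n = m + 1 := ⟨n - 1, by lia⟩
    rw [sum_range_succ'] at hsum
    have h1 : d 0 = c * κ * 2 - b 0 := by simp only [hd]; norm_num
    rw [← h1]
    simp only [pow_zero, one_mul] at hsum ⊢
    rw [show m + 1 - 1 - 0 = m by lia]
    have h2 : ∑ k ∈ range m, r ^ (k + 1) * d (0 + 1 + k) = ∑ k ∈ range m, r ^ (k + 1) * d (k + 1) :=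
      sum_congr rfl fun k _ => by rw [show 0 + 1 + k = k + 1 by lia]
    rw [h2]; linarith
  · intro x hx
    obtain ⟨m, hm⟩ : ∃ m, n - 1 - x = m + 1 := ⟨n - 2 - x, by lia⟩
    have h1 : d (x + 1) = c * κ * (((x : ℝ) + 2) * (x + 3)) - b (x + 1) := by
      simp only [hd]; push_cast; ring
    rw [← h1]
    simp only []
    rw [hm, show n - 1 - (x + 1) = m by lia, sum_range_succ']
    simp only [zero_add, pow_one, add_zero]
    have h2 : ∑ k ∈ range m, r ^ (k + 1 + 1) * d (x + 1 + (k + 1)) =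
        r * ∑ k ∈ range m, r ^ (k + 1) * d (x + 1 + 1 + k) := by
      rw [mul_sum]
      refine sum_congr rfl fun k _ => ?_
      rw [show x + 1 + (k + 1) = x + 1 + 1 + k by lia]; ring
    rw [h2]; ring

namespace TreeNet

/-- Expected squared-time scale for the perturbed walk as a function of level and height. -/
theorem exists_poisson {E : ℝ} (hE : 1 < E) : ∃ K : ℝ, 0 < K ∧ ∀ n : ℕ, 1 ≤ n →
    ∃ (c : ℝ) (ψ : ℕ → ℝ), 1 / K ≤ c ∧ c ≤ K ∧ (∀ x, x ≤ n → 0 ≤ ψ x) ∧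
      (∀ x, x ≤ n → ψ x ≤ K * n) ∧ (∀ x, |ψ (x + 1) - ψ x| ≤ K) ∧
      ∀ (m : ℝ) (i x : ℕ), 1 ≤ i → x < n → levelOp E (fun i x => c * (m - i) + ψ x) i x +
        2 * ((2 + E) / (((x : ℝ) + 1) * (x + 2)) + (2 * E + 1) / ((x : ℝ) * (x + 1))) = 0 := by
  have hE0 : 0 < E := by linarith
  set b : ℕ → ℝ := fun x => 2 * ((2 + E) / (((x : ℝ) + 1) * (x + 2)) +
    (2 * E + 1) / ((x : ℝ) * (x + 1))) with hb
  have hbb : ∀ y, b y ≤ 6 * E + 6 := by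
    intro y
    have h1 : (2 + E) / (((y : ℝ) + 1) * (y + 2)) ≤ 2 + E :=
      div_le_self (by linarith) (by nlinarith [(y.cast_nonneg : (0 : ℝ) ≤ y)])
    have h2 : (2 * E + 1) / ((y : ℝ) * (y + 1)) ≤ 2 * E + 1 := by
      rcases y with _ | y
      · simp; linarith
      · refine div_le_self (by linarith) ?_
        push_cast
        nlinarith [(y.cast_nonneg : (0 : ℝ) ≤ y)]
    simp only [hb]; linarith
  obtain ⟨K, hK0, hK⟩ := exists_gradient (r := (2 + E) / (2 * E + 1)) (κ := 6 * E / (2 * E + 1))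
    (b := b) (b0 := 2 + E) (B := 6 * E + 6) (by positivity)
    (by rw [div_lt_one (by positivity)]; linarith) (by positivity) (by positivity)
    (by simp only [hb]; norm_num; linarith) (fun y => by positivity) hbb
  refine ⟨4 * K, by positivity, fun n hn => ?_⟩
  obtain ⟨c, p, hc1, hc2, hp, hp0, hrec⟩ := hK n hn
  have hc0 : 0 < c := lt_of_lt_of_le (by positivity) hc1
  set g : ℕ → ℝ := fun x => p x / ((2 + E) * (((x : ℝ) + 1) * (x + 2))) with hg
  set γ := (2 * E - 1) / (2 * E + 1) with hγ
  have hγ0 : 0 ≤ γ := div_nonneg (by linarith) (by linarith)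
  have hγ1 : γ ≤ 1 := by rw [hγ, div_le_one (by linarith)]; linarith
  have hgb : ∀ x, |g x - c * γ| ≤ 2 * K := by
    intro x
    have h1 : |g x| ≤ K := by
      simp only [hg]
      rw [abs_div, abs_of_nonneg (by positivity : (0 : ℝ) ≤ (2 + E) * (((x : ℝ) + 1) * (x + 2))),
        div_le_iff₀ (by positivity)]
      have : (0 : ℝ) ≤ K * (((x : ℝ) + 1) * (x + 2)) := by positivity
      nlinarith [hp x]
    have h2 : 0 ≤ c * γ := by positivity
    have h3 : c * γ ≤ K := by nlinarith
    rw [abs_le] at h1 ⊢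
    constructor <;> linarith
  set ψ : ℕ → ℝ := fun x => ∑ y ∈ range x, (g y - c * γ) + 2 * K * n with hψ
  have hψb : ∀ x, x ≤ n → |∑ y ∈ range x, (g y - c * γ)| ≤ 2 * K * n := by
    intro x hx
    calc _ ≤ ∑ y ∈ range x, |g y - c * γ| := abs_sum_le_sum_abs _ _
      _ ≤ ∑ y ∈ range x, 2 * K := sum_le_sum fun y _ => hgb y
      _ = x * (2 * K) := by simp
      _ ≤ 2 * K * n := by
        have : (x : ℝ) ≤ n := by exact_mod_cast hx
        nlinarith
  have hψs : ∀ x, ψ (x + 1) - ψ x = g x - c * γ := by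
    intro x; simp only [hψ, sum_range_succ]; ring
  refine ⟨c, ψ, ?_, by linarith, ?_, ?_, ?_, ?_⟩
  · refine le_trans ?_ hc1
    gcongr; linarith
  · intro x hx
    have := (abs_le.1 (hψb x hx)).1
    simp only [hψ]; linarith
  · intro x hx
    have := (abs_le.1 (hψb x hx)).2
    simp only [hψ]; linarith
  · intro x
    rw [hψs]; linarith [hgb x]
  · intro m i x hi hx
    obtain ⟨j, rfl⟩ : ∃ j, i = j + 1 := ⟨i - 1, by lia⟩
    have hgx : ∀ x : ℕ, p x = g x * ((2 + E) * (((x : ℝ) + 1) * (x + 2))) := by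
      intro x; simp only [hg]; field_simp
    have hid : (E - 2) - (2 + E) * γ + 6 * E / (2 * E + 1) = 0 := by
      rw [hγ]; field_simp; ring
    have hid2 : (2 * E + 1) * γ = 2 * E - 1 := by rw [hγ]; field_simp
    clear_value g ψ b γ
    rcases x with _ | x
    · have h1 := hψs 0
      rw [hgx] at hp0
      have hb00 : b 0 = 2 + E := by simp only [hb]; norm_num; ring
      rw [hb00] at hp0
      simp only [levelOp, Nat.add_sub_cancel]
      push_cast at hp0 h1 ⊢
      simp only [zero_add, zero_mul, div_zero, add_zero] at h1 ⊢
      have h2 : 2 * ((2 + E) / (1 * 2)) = 2 + E := by ring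
      rw [h2]
      linear_combination hp0 + 2 * (2 + E) * h1 + 2 * c * hid
    · have h1 := hψs (x + 1)
      have h2 := hψs x
      have h3 := hrec x hx
      rw [hgx, hgx, div_mul_eq_mul_div, div_mul_eq_mul_div, div_eq_iff (by positivity)] at h3
      have h4 : (g (x + 1) * ((2 + E) * (((x : ℝ) + 2) * (x + 3)))) =
          (2 * E + 1) * (g x * (((x : ℝ) + 1) * (x + 2))) +
          (c * (6 * E / (2 * E + 1)) * (((x : ℝ) + 2) * (x + 3)) - b (x + 1)) := by
        have h5 : (2 + E) ≠ 0 := by positivity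
        apply mul_left_cancel₀ h5
        push_cast at h3
        rw [add_mul _ _ (2 * E + 1), div_mul_cancel₀ _ (by positivity)] at h3
        linear_combination h3
      simp only [hb] at h4
      simp only [levelOp, Nat.add_sub_cancel]
      push_cast at h4 ⊢
      have e1 : (x : ℝ) + 1 + 1 = x + 2 := by ring
      have e2 : (x : ℝ) + 1 + 2 = x + 3 := by ring
      rw [e1, e2] at h4 ⊢
      linear_combination h4 + (2 + E) * (x + 2) * (x + 3) * h1 -
        (2 * E + 1) * (x + 1) * (x + 2) * h2 + c * (x + 2) * (x + 3) * hid
        + c * (x + 1) * (x + 2) * hid2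
end TreeNet

namespace TreeNet

theorem levelOp_add (E : ℝ) (F G : ℕ → ℕ → ℝ) (i x : ℕ) :
    levelOp E (fun i x => F i x + G i x) i x = levelOp E F i x + levelOp E G i x := by
  simp only [levelOp]; ring

theorem levelOp_mul (E a : ℝ) (G : ℕ → ℕ → ℝ) (i x : ℕ) :
    levelOp E (fun i x => a * G i x) i x = a * levelOp E G i x := by
  simp only [levelOp]; ring

/-- A linear function of level and height with strongly negative drift. -/
def tilt (E : ℝ) (n i x : ℕ) : ℝ := (n : ℝ) ^ 2 + 1 + n - i - (E - 1) / (E + 1) * x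

section tilt
variable {E : ℝ} (hE : 1 ≤ E) {n i x : ℕ}
include hE

theorem tilt_coeff : 0 ≤ (E - 1) / (E + 1) ∧ (E - 1) / (E + 1) ≤ 1 :=
  ⟨div_nonneg (by linarith) (by linarith), by rw [div_le_one (by linarith)]; linarith⟩

theorem tilt_nonneg (hi : i ≤ n ^ 2 + 1) (hx : x ≤ n) : 0 ≤ tilt E n i x := by
  have hi' : (i : ℝ) ≤ (n : ℝ) ^ 2 + 1 := by exact_mod_cast hi
  have hx' : (x : ℝ) ≤ n := by exact_mod_cast hx
  obtain ⟨h0, h1⟩ := tilt_coeff hE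
  have hx0 : (0 : ℝ) ≤ x := x.cast_nonneg
  unfold tilt
  nlinarith

theorem tilt_le : tilt E n i x ≤ (n : ℝ) ^ 2 + 1 + n := by
  obtain ⟨h0, -⟩ := tilt_coeff hE
  have hx0 : (0 : ℝ) ≤ x := x.cast_nonneg
  have hi0 : (0 : ℝ) ≤ i := i.cast_nonneg
  unfold tilt
  nlinarith [mul_nonneg h0 hx0]

theorem levelOp_tilt (hi : 1 ≤ i) :
    levelOp E (tilt E n) i x ≤ - (2 * ((x : ℝ) + 1) ^ 2) := by
  obtain ⟨j, rfl⟩ : ∃ j, i = j + 1 := ⟨i - 1, by lia⟩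
  have hE1 : E + 1 ≠ 0 := by linarith
  have hk : 1 ≤ 2 * E / (E + 1) := by rw [le_div_iff₀ (by linarith)]; linarith
  have key : levelOp E (tilt E n) (j + 1) x = -(2 * E / (E + 1)) * (2 * ((x : ℝ) + 1) ^ 2) := by
    rcases x with _ | x
    · simp only [levelOp, tilt, Nat.add_sub_cancel]
      push_cast
      field_simp
      ring
    · simp only [levelOp, tilt, Nat.add_sub_cancel]
      push_cast
      field_simp
      ring
  rw [key]
  have : 0 ≤ ((x : ℝ) + 1) ^ 2 := by positivity
  nlinarith

theorem levelOp_geom (m : ℝ) (hi : 1 ≤ i) :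
    levelOp E (fun i x => m * ((1 / 2) ^ i * ((2 + E) / (2 * E + 1)) ^ x)) i x = 0 := by
  obtain ⟨j, rfl⟩ : ∃ j, i = j + 1 := ⟨i - 1, by lia⟩
  rw [levelOp_mul]
  have h1 : (2 + E) ≠ 0 := by linarith
  have h2 : (2 * E + 1) ≠ 0 := by linarith
  set r := (2 + E) / (2 * E + 1) with hr
  have hr' : r * (2 * E + 1) = 2 + E := by rw [hr]; field_simp
  rcases x with _ | x
  · simp only [levelOp, Nat.add_sub_cancel]
    push_cast
    linear_combination (m * (1 / 2) ^ j * (0 + 1) * (0 + 2) * (1 / 2)) * hr'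
  · simp only [levelOp, Nat.add_sub_cancel]
    push_cast
    linear_combination (m * (1 / 2) ^ j * r ^ x * (1 / 2) * (r * (x + 2) * (x + 3) - (x + 1) * (x + 2))) * hr'

end tilt

theorem levelOp_cube {E : ℝ} (hE : 1 < E) (i x : ℕ) :
    levelOp E (fun _ x => ((x : ℝ) + 1) ^ 3) i x ≤
      (10 * (2 + E) ^ 2 / (E - 1) + 20 * (2 + E)) * (2 * ((x : ℝ) + 1) ^ 2) := by
  have hx0 : (0 : ℝ) ≤ x := x.cast_nonneg
  have key : levelOp E (fun _ x => ((x : ℝ) + 1) ^ 3) i x = (x + 1) *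
      ((2 + E) * (x + 2) * (3 * x ^ 2 + 9 * x + 7) - (2 * E + 1) * x * (3 * x ^ 2 + 3 * x + 1)) := by
    rcases x with _ | x
    · simp only [levelOp]; push_cast; ring
    · simp only [levelOp, Nat.add_sub_cancel]; push_cast; ring
  rw [key]
  have hE1 : 0 < E - 1 := by linarith
  have h1 : 15 * (2 + E) * (x : ℝ) ≤ 3 * (E - 1) * x ^ 2 + 20 * (2 + E) ^ 2 / (E - 1) := by
    have : 3 * (E - 1) * (x : ℝ) ^ 2 + 20 * (2 + E) ^ 2 / (E - 1) - 15 * (2 + E) * x =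
      (3 * (E - 1) ^ 2 * x ^ 2 + 20 * (2 + E) ^ 2 - 15 * (2 + E) * ((E - 1) * x)) / (E - 1) := by
      field_simp
    have h2 : 0 ≤ 3 * (E - 1) ^ 2 * (x : ℝ) ^ 2 + 20 * (2 + E) ^ 2 - 15 * (2 + E) * ((E - 1) * x) := by
      nlinarith [sq_nonneg ((E - 1) * x * 5 - 12 * (2 + E)), sq_nonneg ((E - 1) * (x : ℝ))]
    have h3 := div_nonneg h2 hE1.le
    linarith
  have h2 := mul_le_mul_of_nonneg_right h1 hx0
  have h4 : (10 * (2 + E) ^ 2 / (E - 1) + 20 * (2 + E)) * (2 * ((x : ℝ) + 1) ^ 2) = (x + 1) *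
      ((20 * (2 + E) ^ 2 / (E - 1) + 40 * (2 + E)) * (x + 1)) := by ring
  rw [h4]
  refine mul_le_mul_of_nonneg_left ?_ (by linarith)
  have h5 : 0 ≤ 20 * (2 + E) ^ 2 / (E - 1) := by positivity
  have h6 : 0 ≤ (2 + E) * (x : ℝ) := by positivity
  have h7 : 0 ≤ (E - 1) * (x : ℝ) := by positivity
  nlinarith [mul_nonneg h7 hx0]

/-- A function, small at the starting point, dominating the indicator of the exceptional part of
the boundary. -/
def escape (E : ℝ) (n i x : ℕ) : ℝ :=
  2 ^ n * ((1 / 2) ^ i * ((2 + E) / (2 * E + 1)) ^ x) + 1 / ((n : ℝ) + 1) ^ 3 *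
    ((10 * (2 + E) ^ 2 / (E - 1) + 20 * (2 + E)) * tilt E n i x + ((x : ℝ) + 1) ^ 3)

section escape
variable {E : ℝ} (hE : 1 < E) {n i x : ℕ}
include hE

theorem escape_parts (hi : i ≤ n ^ 2 + 1) (hx : x ≤ n) :
    0 ≤ (2 : ℝ) ^ n * ((1 / 2) ^ i * ((2 + E) / (2 * E + 1)) ^ x) ∧
    0 ≤ (10 * (2 + E) ^ 2 / (E - 1) + 20 * (2 + E)) * tilt E n i x := by
  have h1 : 0 < E - 1 := by linarith
  have := tilt_nonneg hE.le hi hx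
  constructor <;> positivity

theorem escape_nonneg (hi : i ≤ n ^ 2 + 1) (hx : x ≤ n) : 0 ≤ escape E n i x := by
  obtain ⟨h1, h2⟩ := escape_parts hE hi hx
  unfold escape; positivity

theorem one_le_escape (hi : i ≤ n ^ 2 + 1) (hx : x ≤ n) (h : i = 0 ∨ x = n) :
    1 ≤ escape E n i x := by
  obtain ⟨h1, h2⟩ := escape_parts hE hi hx
  rcases h with rfl | rfl
  · have h3 : (1 : ℝ) ≤ 2 ^ n * ((2 + E) / (2 * E + 1)) ^ x := by
      have hr : 1 / 2 ≤ (2 + E) / (2 * E + 1) := by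
        rw [div_le_div_iff₀ (by norm_num) (by linarith)]; linarith
      have hr1 : (2 + E) / (2 * E + 1) ≤ 1 := by rw [div_le_one (by linarith)]; linarith
      calc (1 : ℝ) = 2 ^ n * (1 / 2) ^ n := by rw [← mul_pow]; norm_num
        _ ≤ 2 ^ n * ((2 + E) / (2 * E + 1)) ^ n := by gcongr
        _ ≤ _ := mul_le_mul_of_nonneg_left (pow_le_pow_of_le_one (by linarith) hr1 hx)
          (by positivity)
    have h4 : 0 ≤ 1 / ((n : ℝ) + 1) ^ 3 * ((10 * (2 + E) ^ 2 / (E - 1) + 20 * (2 + E)) *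
      tilt E n 0 x + ((x : ℝ) + 1) ^ 3) := by positivity
    unfold escape
    rw [pow_zero, one_mul]; linarith
  · have h3 : 1 / ((x : ℝ) + 1) ^ 3 * ((x : ℝ) + 1) ^ 3 = 1 := by field_simp
    unfold escape
    have h4 : 0 ≤ 1 / ((x : ℝ) + 1) ^ 3 * ((10 * (2 + E) ^ 2 / (E - 1) + 20 * (2 + E)) *
      tilt E x i x) := by positivity
    rw [mul_add, h3]; linarith

theorem levelOp_escape (hi : 1 ≤ i) : levelOp E (escape E n) i x ≤ 0 := by
  have h1 := levelOp_geom hE.le (x := x) (2 ^ n) hi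
  have h2 := levelOp_tilt hE.le (n := n) (x := x) hi
  have h3 := levelOp_cube hE i x
  have h0 : 0 < E - 1 := by linarith
  set C := 10 * (2 + E) ^ 2 / (E - 1) + 20 * (2 + E) with hC
  have hC0 : 0 ≤ C := by positivity
  have h4 : levelOp E (escape E n) i x = 0 + 1 / ((n : ℝ) + 1) ^ 3 *
      (C * levelOp E (tilt E n) i x + levelOp E (fun _ x => ((x : ℝ) + 1) ^ 3) i x) := by
    rw [← h1, ← levelOp_mul, ← levelOp_add, ← levelOp_mul, ← levelOp_add]
    rfl
  rw [h4, zero_add]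
  refine mul_nonpos_of_nonneg_of_nonpos (by positivity) ?_
  have := mul_le_mul_of_nonneg_left h2 hC0
  linarith

theorem escape_start (hn : 1 ≤ n) :
    escape E n (2 * n) 0 ≤ (10 * (2 + E) ^ 2 / (E - 1) + 20 * (2 + E) + 2) / (n + 1) := by
  have h0 : 0 < E - 1 := by linarith
  set C := 10 * (2 + E) ^ 2 / (E - 1) + 20 * (2 + E) with hC
  have hC0 : 0 ≤ C := by positivity
  have hn1 : (1 : ℝ) ≤ n := by exact_mod_cast hn
  have h1 : (2 : ℝ) ^ n * ((1 / 2) ^ (2 * n) * ((2 + E) / (2 * E + 1)) ^ 0) ≤ 1 / (n + 1) := by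
    have h2 : (2 : ℝ) ^ n * ((1 / 2) ^ (2 * n) * ((2 + E) / (2 * E + 1)) ^ 0) = 1 / 2 ^ n := by
      rw [pow_zero, mul_one, pow_mul', div_pow, one_pow]
      field_simp
    rw [h2]
    have : (n : ℝ) + 1 ≤ 2 ^ n := by exact_mod_cast n.lt_two_pow_self
    gcongr
  have h3 : 1 / ((n : ℝ) + 1) ^ 3 * (C * tilt E n (2 * n) 0 + (((0 : ℕ) : ℝ) + 1) ^ 3) ≤
      (C + 1) / (n + 1) := by
    have h4 : tilt E n (2 * n) 0 ≤ ((n : ℝ) + 1) ^ 2 := by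
      unfold tilt; push_cast; nlinarith
    have h5 := mul_le_mul_of_nonneg_left h4 hC0
    rw [div_mul_eq_mul_div, one_mul, div_le_div_iff₀ (by positivity) (by positivity)]
    push_cast
    have h6 : C * tilt E n (2 * n) 0 + (0 + 1) ^ 3 ≤ (C + 1) * ((n : ℝ) + 1) ^ 2 := by nlinarith
    calc _ ≤ (C + 1) * ((n : ℝ) + 1) ^ 2 * (n + 1) := by gcongr
      _ = _ := by ring
  unfold escape
  have h7 : (C + 2) / ((n : ℝ) + 1) = 1 / (n + 1) + (C + 1) / (n + 1) := by ring
  rw [h7]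
  exact add_le_add h1 h3

end escape
end TreeNet

/-! ### The perturbed walk: test functions on the network -/

namespace TreeNet
variable {n : ℕ}

/-- The vertices of the blob, including its dangling paths. -/
def OnBd : (net n).Vx → Prop
  | Sum.inl (Sum.inl p) => IsBd p
  | Sum.inl (Sum.inr _) => True
  | Sum.inr ⟨Sum.inl _, _⟩ => False
  | Sum.inr ⟨Sum.inr _, _⟩ => True

instance : DecidablePred (OnBd (n := n)) := fun _ => Classical.dec _

/-- A function of level and height as a function on the base vertices. -/
def ext (F : ℕ → ℕ → ℝ) : Base n → ℝ :=
  Sum.elim (fun p => F (Nat.size p.1) p.2) fun z => F (Nat.size z.1.1.1) z.1.1.2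

theorem ext_mem {F : ℕ → ℕ → ℝ} {a b : ℝ}
    (h : ∀ i x, i ≤ n ^ 2 + 1 → x ≤ n → a ≤ F i x ∧ F i x ≤ b) (z : Base n) :
    a ≤ ext F z ∧ ext F z ≤ b := by
  rcases z with p | ⟨p, s⟩
  · exact h _ _ (site_size_le p) (by have := p.2.2; lia)
  · exact h _ _ (site_size_le p.1) (by have := p.1.2.2; lia)

theorem len_le_scale (e : Edge n) : ((net n).len e : ℝ) ≤ scale n := by
  rcases e with ⟨t, y, b⟩ | j | z
  · rw [len_tree_cast]
    exact div_le_self (scale_cast_pos n).le (by nlinarith [(Nat.cast_nonneg y.1 : (0 : ℝ) ≤ y.1)])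
  · have := scale_ge_eight n
    have h1 : (net n).len (Sum.inr (Sum.inl j)) = 1 := rfl
    rw [h1]
    exact_mod_cast (by lia : 1 ≤ scale n)
  · exact le_rfl

theorem not_onBd_cases {v : (net n).Vx} (hv : ¬ OnBd v) :
    (∃ p, v = Sum.inl (Sum.inl p) ∧ ¬ IsBd p) ∨ ∃ e i, v = Sum.inr ⟨Sum.inl e, i⟩ := by
  rcases v with (p | z) | ⟨e | e, i⟩
  · exact Or.inl ⟨p, rfl, hv⟩
  · exact absurd trivial hv
  · exact Or.inr ⟨e, i, rfl⟩
  · exact absurd trivial hv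

theorem blap_ext {E : ℝ} (F : ℕ → ℕ → ℝ) {q : Edge n → ℝ} {Q : ℕ → ℝ}
    (hq : ∀ (t : Fin (2 * half n)) (y : Fin n) (b : Bool), q (Sum.inl (t, y, b)) = Q y)
    {p : Site n} (hp : ¬ IsBd p) :
    (net n).blap (wt E) (ext F) q (Sum.inl p) = levelOp E F (Nat.size p.1) p.2 / scale n +
      2 * scale n * ((2 + E) * Q p.2 / (((p.2.1 : ℝ) + 1) * (p.2.1 + 2)) +
        (2 * E + 1) * Q (p.2.1 - 1) / ((p.2.1 : ℝ) * (p.2.1 + 1))) :=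
  blap_interior E (fun _ => rfl) hq hp

section
variable {E : ℝ} (hE : 1 < E)
include hE

theorem mulVec_lift_ext_eq {F : ℕ → ℕ → ℝ} (hF : ∀ i x : ℕ, 1 ≤ i → x < n → levelOp E F i x +
      2 * ((2 + E) / (((x : ℝ) + 1) * (x + 2)) + (2 * E + 1) / ((x : ℝ) * (x + 1))) = 0)
    {v : (net n).Vx} (hv : ¬ OnBd v) :
    (wMat ((net n).sw (wt E))).mulVec ((net n).lift (ext fun i x => (scale n : ℝ) ^ 2 * F i x)
      fun _ => 1) v = (net n).lift (ext fun i x => (scale n : ℝ) ^ 2 * F i x) (fun _ => 1) v - 1 := by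
  have hE0 : 0 < E := by linarith
  rcases not_onBd_cases hv with ⟨p, rfl, hp⟩ | ⟨e, i, rfl⟩
  · refine (net n).mulVec_lift_eq_sub_one (wt_pos hE0) exists_edge _ _ _ (fun _ _ => rfl) ?_
    obtain ⟨h1, h2, h3⟩ := interior_bounds hp
    rw [blap_ext _ (Q := fun _ => 1) (fun _ _ _ => rfl) hp, levelOp_mul]
    have hL := scale_cast_pos n
    have := hF _ _ h1 h3
    simp only [mul_one]
    field_simp at this ⊢
    linear_combination (scale n : ℝ) * this
  · rw [(net n).mulVec_lift_inr (wt_pos hE0) exists_edge]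

theorem mulVec_lift_ext_le {F : ℕ → ℕ → ℝ} (hF : ∀ i x : ℕ, 1 ≤ i → levelOp E F i x ≤ 0)
    {v : (net n).Vx} (hv : ¬ OnBd v) :
    (wMat ((net n).sw (wt E))).mulVec ((net n).lift (ext F) fun _ => 0) v ≤
      (net n).lift (ext F) (fun _ => 0) v := by
  have hE0 : 0 < E := by linarith
  refine (net n).mulVec_lift_le (wt_pos hE0) exists_edge _ (fun _ => le_rfl) _ ?_
  rintro z rfl
  rcases not_onBd_cases hv with ⟨p, h, hp⟩ | ⟨e, i, h⟩
  · cases h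
    obtain ⟨h1, h2, h3⟩ := interior_bounds hp
    rw [blap_ext _ (Q := fun _ => 0) (fun _ _ _ => rfl) hp]
    simp only [mul_zero, zero_div, add_zero]
    exact div_nonpos_of_nonpos_of_nonneg (hF _ _ h1) (scale_cast_pos n).le
  · cases h

/-- The weights of the variance bound. -/
def varWeight (M : ℝ) (f : Base n → ℝ) : Edge n → ℝ :=
  Sum.elim (fun e => (M * (scale n * (((e.2.1.1 : ℝ) + 1) * (e.2.1.1 + 2)))) ^ 2)
    fun e => (|f ((net n).dst (Sum.inr e)) - f ((net n).src (Sum.inr e))| /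
      (net n).len (Sum.inr e) + 2 * (net n).len (Sum.inr e)) ^ 2

omit hE in
theorem varWeight_nonneg (M : ℝ) (f : Base n → ℝ) (e : Edge n) : 0 ≤ varWeight M f e := by
  rcases e with e | e <;> exact sq_nonneg _

omit hE in
theorem abs_ext_sub_le {F : ℕ → ℕ → ℝ} {A : ℝ}
    (hF : ∀ i x, |F (i + 1) (x + 1) - F i x| ≤ A ∧ |F (i + 1) x - F i (x + 1)| ≤ A ∧
      |F 0 (x + 1) - F 0 x| ≤ A) (e : Fin (2 * half n) × Fin n × Bool) :
    |ext F ((net n).dst (Sum.inl e)) - ext F ((net n).src (Sum.inl e))| ≤ A := by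
  obtain ⟨t, y, b⟩ := e
  have h1 : Nat.size (parent t).1 = Nat.size t.1 - 1 := size_div_two _
  cases b
  · rw [dst_false, src_false]
    simp only [ext, Sum.elim_inl, h1, Fin.val_succ, Fin.val_castSucc]
    rcases h : Nat.size t.1 with _ | i
    · rw [abs_sub_comm]; exact (hF 0 y).2.2
    · exact (hF i y).2.1
  · rw [dst_true, src_true]
    simp only [ext, Sum.elim_inl, h1, Fin.val_succ, Fin.val_castSucc]
    rcases h : Nat.size t.1 with _ | i
    · exact (hF 0 y).2.2
    · exact (hF i y).1

theorem mulVec_lift_variance_le {A : ℝ} (hA : 0 ≤ A) {F : ℕ → ℕ → ℝ}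
    (hF : ∀ i x, |F (i + 1) (x + 1) - F i x| ≤ A ∧ |F (i + 1) x - F i (x + 1)| ≤ A ∧
      |F 0 (x + 1) - F 0 x| ≤ A) {v : (net n).Vx} (hv : ¬ OnBd v) :
    let f := ext fun i x => (scale n : ℝ) ^ 2 * F i x
    let g := ext fun i x => (scale n : ℝ) ^ 4 * ((A + 1) ^ 2 * (6 * E + 6)) * tilt E n i x
    (wMat ((net n).sw (wt E))).mulVec ((net n).lift g (varWeight (A + 1) f)) v ≤
      (net n).lift g (varWeight (A + 1) f) v - ∑ y, wMat ((net n).sw (wt E)) v y *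
        ((net n).lift f (fun _ => 1) y - (net n).lift f (fun _ => 1) v) ^ 2 := by
  intro f g
  have hE0 : 0 < E := by linarith
  have hL := scale_cast_pos n
  refine (net n).mulVec_lift_le_sub_variance (wt_pos hE0) exists_edge _ _ (fun _ => zero_le_one)
    (fun _ => le_rfl) ?_ _ ?_
  · rintro (e | e)
    · refine pow_le_pow_left₀ (by positivity) ?_ 2
      have h1 := abs_ext_sub_le (A := (scale n : ℝ) ^ 2 * A)
        (F := fun i x => (scale n : ℝ) ^ 2 * F i x) (fun i x => by
          obtain ⟨h1, h2, h3⟩ := hF i x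
          refine ⟨?_, ?_, ?_⟩ <;>
          · rw [← mul_sub, abs_mul, abs_of_nonneg (by positivity)]
            gcongr) e
      obtain ⟨t, y, b⟩ := e
      rw [len_tree_cast]
      have hy : (0 : ℝ) ≤ y.1 := Nat.cast_nonneg _
      set σ := ((y.1 : ℝ) + 1) * (y.1 + 2) with hσ
      have hσ2 : 2 ≤ σ := by nlinarith
      calc _ ≤ (scale n : ℝ) ^ 2 * A / (scale n / σ) + 2 * (scale n / σ) := by gcongr
        _ ≤ A * (scale n * σ) + scale n * σ := by
          have h2 : (scale n : ℝ) ^ 2 * A / (scale n / σ) = A * (scale n * σ) := by field_simp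
          have h3 : 2 * (scale n / σ) ≤ scale n * σ := by
            rw [← mul_div_assoc, div_le_iff₀ (by linarith)]
            have : 2 ≤ σ * σ := by nlinarith
            nlinarith
          linarith
        _ = (A + 1) * (scale n * σ) := by ring
    · exact le_rfl
  · rintro z rfl
    rcases not_onBd_cases hv with ⟨p, h, hp⟩ | ⟨e, i, h⟩
    · cases h
      obtain ⟨h1, h2, h3⟩ := interior_bounds hp
      rw [blap_ext _ (Q := fun y => ((A + 1) * (scale n * (((y : ℝ) + 1) * (y + 2)))) ^ 2)
        (fun _ _ _ => rfl) hp, levelOp_mul]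
      have h4 := levelOp_tilt hE.le (n := n) (x := p.2.1) h1
      set x := p.2.1
      set i := Nat.size p.1.1
      have hx : (0 : ℝ) ≤ x := x.cast_nonneg
      have h5 : (2 + E) * ((A + 1) * (scale n * (((x : ℝ) + 1) * (x + 2)))) ^ 2 /
          (((x : ℝ) + 1) * (x + 2)) = (scale n : ℝ) ^ 2 * (A + 1) ^ 2 *
            ((2 + E) * (((x : ℝ) + 1) * (x + 2))) := by
        field_simp
      have h6 : (2 * E + 1) * ((A + 1) * (scale n * ((((x - 1 : ℕ) : ℝ) + 1) *
          (((x - 1 : ℕ) : ℝ) + 2)))) ^ 2 / ((x : ℝ) * (x + 1)) = (scale n : ℝ) ^ 2 * (A + 1) ^ 2 *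
            ((2 * E + 1) * ((x : ℝ) * (x + 1))) := by
        rcases x with _ | x
        · simp
        · rw [Nat.add_sub_cancel]
          push_cast
          field_simp
          ring
      rw [h5, h6]
      have h7 : (2 + E) * (((x : ℝ) + 1) * (x + 2)) + (2 * E + 1) * ((x : ℝ) * (x + 1)) ≤
          (6 * E + 6) * ((x : ℝ) + 1) ^ 2 := by
        have h8 : ((x : ℝ) + 1) * (x + 2) ≤ 2 * ((x : ℝ) + 1) ^ 2 := by nlinarith
        have h9 : (x : ℝ) * (x + 1) ≤ ((x : ℝ) + 1) ^ 2 := by nlinarith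
        have h10 := mul_le_mul_of_nonneg_left h8 (by linarith : 0 ≤ 2 + E)
        have h11 := mul_le_mul_of_nonneg_left h9 (by linarith : 0 ≤ 2 * E + 1)
        nlinarith [sq_nonneg ((x : ℝ) + 1)]
      have h8 : (scale n : ℝ) ^ 4 * ((A + 1) ^ 2 * (6 * E + 6)) * levelOp E (tilt E n) i x / scale n =
          (scale n : ℝ) ^ 3 * (A + 1) ^ 2 * ((6 * E + 6) * levelOp E (tilt E n) i x) := by
        field_simp
      rw [h8]
      have h9 : 0 ≤ (scale n : ℝ) ^ 3 * (A + 1) ^ 2 := by positivity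
      have h10 : (6 * E + 6) * levelOp E (tilt E n) i x ≤ (6 * E + 6) * (-(2 * ((x : ℝ) + 1) ^ 2)) := by
        gcongr
      have h11 : (6 * E + 6) * levelOp E (tilt E n) i x + 2 * ((2 + E) * (((x : ℝ) + 1) * (x + 2))
        + (2 * E + 1) * ((x : ℝ) * (x + 1))) ≤ 0 := by linarith
      have h12 := mul_nonpos_of_nonneg_of_nonpos h9 h11
      linarith
    · cases h

end

end TreeNet

namespace TreeNet
variable {n : ℕ}

/-- The starting vertex for the lower bound. -/
def start (n : ℕ) : (net n).Vx :=
  Sum.inl (Sum.inl (⟨2 ^ (2 * n - 1), by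
    rw [half, ← pow_succ']
    exact Nat.pow_lt_pow_right (by norm_num) (by
      rcases n with _ | n
      · norm_num
      · nlinarith [Nat.sub_add_cancel (show 1 ≤ 2 * (n + 1) by lia), sq_nonneg (n : ℤ)])⟩, 0))

theorem lift_start (hn : 1 ≤ n) (F : ℕ → ℕ → ℝ) (q : Edge n → ℝ) :
    (net n).lift (ext F) q (start n) = F (2 * n) 0 := by
  rw [start, BaseNet.lift_inl, ext, Sum.elim_inl]
  have : Nat.size (2 ^ (2 * n - 1)) = 2 * n := by rw [Nat.size_pow]; lia
  simp only [this]; rfl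

theorem escape_or_size {E : ℝ} (hE : 1 < E) {p : Site n} (hp : IsBd p) :
    1 ≤ escape E n (Nat.size p.1) p.2 ∨ Nat.size p.1 = n ^ 2 + 1 := by
  have h1 := site_size_le p
  have h2 : p.2.1 ≤ n := by have := p.2.2; lia
  rcases hp with h | h | h
  · left
    exact one_le_escape hE h1 h2 (Or.inl (by rw [h]; exact Nat.size_zero))
  · right
    have : n ^ 2 < Nat.size p.1 := Nat.lt_size.2 h
    lia
  · left
    exact one_le_escape hE h1 h2 (Or.inr h)

theorem lift_ext_onBd {P : ℝ → ℝ → Prop} {F G : ℕ → ℕ → ℝ}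
    (h : ∀ p : Site n, IsBd p → ∀ d, 0 ≤ d → d ≤ (scale n : ℝ) ^ 2 →
      P (F (Nat.size p.1) p.2) (G (Nat.size p.1) p.2 + d)) {v : (net n).Vx} (hv : OnBd v) :
    P ((net n).lift (ext F) (fun _ => 0) v) ((net n).lift (ext G) (fun _ => 1) v) := by
  have hL := scale_cast_pos n
  rcases v with (p | z) | ⟨e | j | z, i⟩
  · have := h p hv 0 le_rfl (by positivity)
    rwa [add_zero] at this
  · have := h z.1.1 z.1.2 0 le_rfl (by positivity)
    rwa [add_zero] at this
  · exact absurd hv id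
  · exact absurd i.2 (by simp [net, len])
  · have hs : ∀ F : ℕ → ℕ → ℝ, ext F ((net n).src (Sum.inr (Sum.inr z))) =
        F (Nat.size z.1.1.1) z.1.1.2 := fun F => rfl
    have hd : ∀ F : ℕ → ℕ → ℝ, ext F ((net n).dst (Sum.inr (Sum.inr z))) =
        F (Nat.size z.1.1.1) z.1.1.2 := fun F => rfl
    have hl : (net n).len (Sum.inr (Sum.inr z)) = scale n := rfl
    have e1 : (net n).lift (ext F) (fun _ => 0) (Sum.inr ⟨Sum.inr (Sum.inr z), i⟩) =
        F (Nat.size z.1.1.1) z.1.1.2 := by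
      rw [BaseNet.lift_inr, BaseNet.prof, hs, hd]; ring
    have h2 := (net n).lift_le (f := ext G) (q := fun _ => 1) (e := Sum.inr (Sum.inr z))
      zero_le_one (hs G).le (hd G).le i
    have h3 := (net n).le_lift (f := ext G) (q := fun _ => 1) (e := Sum.inr (Sum.inr z))
      zero_le_one (hs G).ge (hd G).ge i
    rw [hl, one_mul] at h2
    have := h z.1.1 z.1.2 ((net n).lift (ext G) (fun _ => 1) (Sum.inr ⟨Sum.inr (Sum.inr z), i⟩) -
      G (Nat.size z.1.1.1) z.1.1.2) (by linarith) (by linarith)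
    rwa [add_sub_cancel, ← e1] at this

set_option maxHeartbeats 1000000 in
theorem exists_test_functions {E : ℝ} (hE : 1 < E) : ∃ K : ℝ, 1 ≤ K ∧ ∀ n : ℕ, 1 ≤ n →
    ∃ (c : ℝ) (v H J : (net n).Vx → ℝ), 1 / K ≤ c ∧ c ≤ K ∧
      (∀ x, ¬ OnBd x → (wMat ((net n).sw (wt E))).mulVec v x = v x - 1) ∧
      (∀ x, 0 ≤ v x) ∧ (∀ x, 0 ≤ H x) ∧ (∀ x, 0 ≤ J x) ∧
      (∀ x, ¬ OnBd x → (wMat ((net n).sw (wt E))).mulVec H x ≤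
        H x - ∑ y, wMat ((net n).sw (wt E)) x y * (v y - v x) ^ 2) ∧
      (∀ x, ¬ OnBd x → (wMat ((net n).sw (wt E))).mulVec J x ≤ J x) ∧
      (∀ x, OnBd x → 1 ≤ J x ∨ v x ≤ K * n * (scale n : ℝ) ^ 2) ∧
      (∀ x, v x ≤ (c * (n : ℝ) ^ 2 + K * n) * (scale n : ℝ) ^ 2) ∧
      (∀ x, ¬ OnBd x → H x ≤ K * (n : ℝ) ^ 2 * (scale n : ℝ) ^ 4) ∧
      (c * (n : ℝ) ^ 2 - K * n) * (scale n : ℝ) ^ 2 ≤ v (start n) ∧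
      H (start n) ≤ K * (n : ℝ) ^ 2 * (scale n : ℝ) ^ 4 ∧ J (start n) ≤ K / n := by
  obtain ⟨K, hK0, hK⟩ := exists_poisson hE
  have hE1 : 0 < E - 1 := by linarith
  set A := 2 * K with hA
  set C := 10 * (2 + E) ^ 2 / (E - 1) + 20 * (2 + E) with hC
  have hC0 : 0 ≤ C := by positivity
  set CH := (A + 1) ^ 2 * (6 * E + 6) with hCH
  have hCH0 : 0 ≤ CH := by positivity
  have hA2 : 0 ≤ (A + 1) ^ 2 := by positivity
  set K1 := 2 * K + 1 + 3 * CH + (A + 1) ^ 2 + C + 2 with hK1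
  refine ⟨K1, by linarith, fun n hn => ?_⟩
  obtain ⟨c, ψ, hc1, hc2, hψ0, hψ1, hψs, hP⟩ := hK n hn
  have hc0 : 0 < c := lt_of_lt_of_le (by positivity) hc1
  have hL := scale_cast_pos n
  have hL2 : (0 : ℝ) < (scale n : ℝ) ^ 2 := by positivity
  have hL4 : (0 : ℝ) < (scale n : ℝ) ^ 4 := by positivity
  have hn1 : (1 : ℝ) ≤ n := by exact_mod_cast hn
  have hn2 : (n : ℝ) ≤ (n : ℝ) ^ 2 := by nlinarith
  set F : ℕ → ℕ → ℝ := fun i x => c * ((n : ℝ) ^ 2 + 1 - i) + ψ x with hF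
  have hF0 : ∀ i x, i ≤ n ^ 2 + 1 → x ≤ n → 0 ≤ (scale n : ℝ) ^ 2 * F i x ∧
      (scale n : ℝ) ^ 2 * F i x ≤ (scale n : ℝ) ^ 2 * (c * ((n : ℝ) ^ 2 + 1) + K * n) := by
    intro i x hi hx
    have hi' : (i : ℝ) ≤ (n : ℝ) ^ 2 + 1 := by exact_mod_cast hi
    have hi0 : (0 : ℝ) ≤ i := i.cast_nonneg
    have h1 := hψ0 x hx
    have h2 := hψ1 x hx
    have h3 : 0 ≤ c * ((n : ℝ) ^ 2 + 1 - i) := mul_nonneg hc0.le (by linarith)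
    have h4 : 0 ≤ c * i := by positivity
    constructor
    · exact mul_nonneg hL2.le (by simp only [hF]; linarith)
    · refine mul_le_mul_of_nonneg_left ?_ hL2.le
      simp only [hF]; linarith
  have hT0 : ∀ i x, i ≤ n ^ 2 + 1 → x ≤ n → 0 ≤ (scale n : ℝ) ^ 4 * CH * tilt E n i x ∧
      (scale n : ℝ) ^ 4 * CH * tilt E n i x ≤ (scale n : ℝ) ^ 4 * CH * (3 * (n : ℝ) ^ 2) := by
    intro i x hi hx
    have h1 := tilt_nonneg hE.le hi hx
    have h2 := tilt_le hE.le (n := n) (i := i) (x := x)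
    refine ⟨by positivity, mul_le_mul_of_nonneg_left ?_ (by positivity)⟩
    nlinarith
  have hlip : ∀ i x, |F (i + 1) (x + 1) - F i x| ≤ A ∧ |F (i + 1) x - F i (x + 1)| ≤ A ∧
      |F 0 (x + 1) - F 0 x| ≤ A := by
    intro i x
    have h := abs_le.1 (hψs x)
    simp only [hF]
    push_cast
    refine ⟨abs_le.2 ⟨?_, ?_⟩, abs_le.2 ⟨?_, ?_⟩, abs_le.2 ⟨?_, ?_⟩⟩ <;> nlinarith [h.1, h.2]
  set f := ext (n := n) fun i x => (scale n : ℝ) ^ 2 * F i x with hf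
  set g := ext (n := n) fun i x => (scale n : ℝ) ^ 4 * CH * tilt E n i x with hg
  have hfb : ∀ z, 0 ≤ f z ∧ f z ≤ (scale n : ℝ) ^ 2 * (c * ((n : ℝ) ^ 2 + 1) + K * n) := ext_mem hF0
  have hgb : ∀ z, 0 ≤ g z ∧ g z ≤ (scale n : ℝ) ^ 4 * CH * (3 * (n : ℝ) ^ 2) := ext_mem hT0
  have hHb : 3 * CH + (A + 1) ^ 2 ≤ K1 := by linarith
  refine ⟨c, (net n).lift f fun _ => 1, (net n).lift g (varWeight (A + 1) f),
    (net n).lift (ext (escape E n)) fun _ => 0, ?_, by linarith, ?_, ?_, ?_, ?_, ?_, ?_, ?_, ?_, ?_,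
    ?_, ?_, ?_⟩
  · refine le_trans ?_ hc1
    gcongr; linarith
  · intro x hx
    exact mulVec_lift_ext_eq hE (fun i x hi hx => hP _ i x hi hx) hx
  · exact (net n).lift_nonneg (fun _ => zero_le_one) fun z => (hfb z).1
  · exact (net n).lift_nonneg (varWeight_nonneg _ _) fun z => (hgb z).1
  · refine (net n).lift_nonneg (fun _ => le_rfl) fun z => ?_
    rcases z with p | ⟨p, s⟩
    · exact escape_nonneg hE (site_size_le p) (by have := p.2.2; lia)
    · exact escape_nonneg hE (site_size_le p.1) (by have := p.1.2.2; lia)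
  · intro x hx
    exact mulVec_lift_variance_le hE (by positivity) hlip hx
  · intro x hx
    exact mulVec_lift_ext_le hE (fun i x hi => levelOp_escape hE hi) hx
  · intro x hx
    refine lift_ext_onBd (P := fun a b => 1 ≤ a ∨ b ≤ K1 * n * (scale n : ℝ) ^ 2) ?_ hx
    intro p hp d hd0 hd1
    rcases escape_or_size hE hp with h | h
    · exact Or.inl h
    · right
      have h2 : p.2.1 ≤ n := by have := p.2.2; lia
      have h3 := hψ1 _ h2
      have h4 : F (Nat.size p.1) p.2 = ψ p.2 := by simp only [hF, h]; push_cast; ring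
      rw [h4]
      have h5 : (scale n : ℝ) ^ 2 * ψ p.2 ≤ (scale n : ℝ) ^ 2 * (K * n) := by gcongr
      have h6 : (K * n + 1) * (scale n : ℝ) ^ 2 ≤ K1 * n * (scale n : ℝ) ^ 2 := by
        gcongr
        nlinarith
      linarith
  · intro x
    have h1 : (scale n : ℝ) ^ 2 * (c * ((n : ℝ) ^ 2 + 1) + K * n) + 1 * (scale n : ℝ) ^ 2 ≤
        (c * (n : ℝ) ^ 2 + K1 * n) * (scale n : ℝ) ^ 2 := by
      have : c + K * n + 1 ≤ K1 * n := by nlinarith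
      nlinarith
    rcases x with z | ⟨e, i⟩
    · have := (hfb z).2
      rw [BaseNet.lift_inl]; linarith
    · have := (net n).lift_le (q := fun _ => 1) zero_le_one (hfb ((net n).src e)).2
        (hfb ((net n).dst e)).2 i
      have h2 : ((net n).len e : ℝ) ^ 2 ≤ (scale n : ℝ) ^ 2 := by
        have := len_le_scale e
        gcongr
      linarith
  · intro x hx
    rcases not_onBd_cases hx with ⟨p, rfl, hp⟩ | ⟨e, i, rfl⟩
    · have := (hgb (Sum.inl p)).2
      rw [BaseNet.lift_inl]
      calc _ ≤ _ := this
        _ = 3 * CH * (n : ℝ) ^ 2 * (scale n : ℝ) ^ 4 := by ring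
        _ ≤ _ := by gcongr; linarith
    · have := (net n).lift_le (varWeight_nonneg (A + 1) f (Sum.inl e)) (hgb ((net n).src (Sum.inl e))).2
        (hgb ((net n).dst (Sum.inl e))).2 i
      have h2 : varWeight (A + 1) f (Sum.inl e) * ((net n).len (Sum.inl e) : ℝ) ^ 2 =
          (A + 1) ^ 2 * (scale n : ℝ) ^ 4 := by
        obtain ⟨t, y, b⟩ := e
        rw [len_tree_cast]
        simp only [varWeight, Sum.elim_inl]
        field_simp
      rw [h2] at this
      calc _ ≤ _ := this
        _ ≤ (3 * CH + (A + 1) ^ 2) * (n : ℝ) ^ 2 * (scale n : ℝ) ^ 4 := by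
          have : (1 : ℝ) ≤ (n : ℝ) ^ 2 := by linarith
          have h3 := mul_le_mul_of_nonneg_left this (mul_nonneg hA2 hL4.le)
          linarith
        _ ≤ _ := by gcongr
  · rw [hf, lift_start hn]
    have h1 := hψ0 0 (Nat.zero_le _)
    have h2 : c * (n : ℝ) ^ 2 - K1 * n ≤ F (2 * n) 0 := by
      simp only [hF]; push_cast; nlinarith
    nlinarith
  · rw [hg, lift_start hn]
    have h1 := tilt_le hE.le (n := n) (i := 2 * n) (x := 0)
    calc (scale n : ℝ) ^ 4 * CH * tilt E n (2 * n) 0 ≤ (scale n : ℝ) ^ 4 * CH * (3 * (n : ℝ) ^ 2) := by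
          refine mul_le_mul_of_nonneg_left ?_ (by positivity)
          nlinarith
      _ = 3 * CH * (n : ℝ) ^ 2 * (scale n : ℝ) ^ 4 := by ring
      _ ≤ _ := by gcongr; linarith
  · rw [lift_start hn]
    refine (escape_start hE hn).trans ?_
    exact div_le_div₀ (by positivity) (by linarith) (by linarith) (by linarith)

end TreeNet

/-! ### The perturbed walk: hitting the origin of the blob -/

namespace TreeNet
variable {n : ℕ}

theorem pow_le_size (hn : 5 ≤ n) : (n + 1) ^ 5 ≤ size n := by
  have h1 : n + 1 ≤ 2 ^ n := Nat.lt_two_pow_self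
  calc (n + 1) ^ 5 ≤ (2 ^ n) ^ 5 := Nat.pow_le_pow_left h1 5
    _ = 2 ^ (n * 5) := by rw [pow_mul]
    _ ≤ 2 ^ n ^ 2 := Nat.pow_le_pow_right (by norm_num) (by nlinarith)
    _ ≤ size n := by
      unfold size half
      have : 0 < 2 ^ n ^ 2 := by positivity
      nlinarith

theorem eventually_mul_le_size (K : ℝ) : ∀ᶠ n : ℕ in atTop, K * ((n : ℝ) + 1) ^ 4 ≤ size n := by
  filter_upwards [eventually_ge_atTop 5, eventually_ge_atTop ⌈K⌉₊] with n h5 hK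
  have h1 : ((n : ℝ) + 1) ^ 5 ≤ size n := by exact_mod_cast pow_le_size h5
  have h2 : K ≤ n := (Nat.le_ceil K).trans (by exact_mod_cast hK)
  calc K * ((n : ℝ) + 1) ^ 4 ≤ (n + 1) * ((n : ℝ) + 1) ^ 4 := by gcongr; linarith
    _ = ((n : ℝ) + 1) ^ 5 := by ring
    _ ≤ _ := h1

theorem lift_hitBase_le {U : ℕ → ℕ → ℝ} {v : (net n).Vx} (hv : OnBd v) :
    (net n).lift (hitBase U) (fun _ => 1) v ≤ 4 * (scale n : ℝ) ^ 2 := by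
  have hL : (0 : ℝ) ≤ (scale n : ℝ) ^ 2 := by positivity
  rcases v with (p | z) | ⟨e | j | z, i⟩
  · rw [BaseNet.lift_inl, hitBase, dif_pos (show IsBd p from hv)]
    linarith [bdVal_le (n := n) (bdPos ⟨p, hv⟩)]
  · rw [BaseNet.lift_inl, hitBase]
    linarith [bdVal_le (n := n) (bdPos z.1)]
  · exact absurd hv id
  · exact absurd i.2 (by simp [net, len])
  · have hs : hitBase U ((net n).src (Sum.inr (Sum.inr z))) = bdVal n (bdPos z.1) :=
      hitBase_bd U z.1
    have hd : hitBase U ((net n).dst (Sum.inr (Sum.inr z))) =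
        bdVal n (bdPos z.1) + 2 * (scale n : ℝ) ^ 2 := rfl
    have h1 := bdVal_le (n := n) (bdPos z.1)
    have h2 := (net n).lift_le (f := hitBase U) (q := fun _ => 1) (e := Sum.inr (Sum.inr z))
      (B := 3 * (scale n : ℝ) ^ 2) zero_le_one (by rw [hs]; linarith) (by rw [hd]; linarith) i
    have hl : (net n).len (Sum.inr (Sum.inr z)) = scale n := rfl
    rw [hl] at h2
    linarith

theorem levelOp_hit {E : ℝ} (hE : 1 ≤ E) {i x : ℕ} (hi : 1 ≤ i) (L : ℝ) :
    levelOp E (fun i x => 3 * (E + 1) * L ^ 2 * tilt E n i x) i x + 2 * L ^ 2 *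
      ((2 + E) / (((x : ℝ) + 1) * (x + 2)) + (2 * E + 1) / ((x : ℝ) * (x + 1))) ≤ 0 := by
  have h1 := levelOp_tilt hE hi (n := n) (x := x)
  have hL : 0 ≤ L ^ 2 := sq_nonneg L
  rw [levelOp_mul]
  have hx : (0 : ℝ) ≤ x := x.cast_nonneg
  have h2 : (2 + E) / (((x : ℝ) + 1) * (x + 2)) ≤ 2 + E :=
    div_le_self (by linarith) (by nlinarith)
  have h3 : (2 * E + 1) / ((x : ℝ) * (x + 1)) ≤ 2 * E + 1 := by
    rcases x with _ | x
    · simp; linarith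
    · push_cast
      have hx : (0 : ℝ) ≤ x := x.cast_nonneg
      exact div_le_self (by linarith) (by nlinarith)
  have h4 : 3 * (E + 1) * L ^ 2 * levelOp E (tilt E n) i x ≤ 3 * (E + 1) * L ^ 2 * (-2) :=
    mul_le_mul_of_nonneg_left (by nlinarith) (by positivity)
  have h5 := mul_le_mul_of_nonneg_left (add_le_add h2 h3) (show 0 ≤ 2 * L ^ 2 by positivity)
  linarith

theorem wt_le {E : ℝ} (hE : 1 ≤ E) (e : Edge n) : wt E e ≤ E := by
  rcases e with ⟨t, y, b⟩ | j
  · cases b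
    · exact le_rfl
    · exact hE
  · exact hE

theorem bdeg_le {E : ℝ} (hE : 1 ≤ E) (z : Base n) : (net n).bdeg (wt E) z ≤ 10 * E := by
  calc (net n).bdeg (wt E) z ≤ E * (net n).bdeg (fun _ => 1) z := by
        rw [BaseNet.bdeg, BaseNet.bdeg, mul_sum]
        refine sum_le_sum fun e _ => ?_
        rw [one_mul]
        refine mul_le_mul_of_nonneg_right (wt_le hE e) ?_
        split_ifs <;> norm_num
    _ ≤ E * 10 := mul_le_mul_of_nonneg_left (bdeg_one_le z) (by linarith)
    _ = _ := by ring

theorem sum_telescope_le (n : ℕ) : ∑ y : Fin n, 1 / (((y.1 : ℝ) + 1) * (y.1 + 2)) ≤ 1 := by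
  rw [Fin.sum_univ_eq_sum_range (fun y => 1 / (((y : ℝ) + 1) * (y + 2)))]
  have : ∀ m : ℕ, ∑ y ∈ range m, 1 / (((y : ℝ) + 1) * (y + 2)) = 1 - 1 / ((m : ℝ) + 1) := by
    intro m
    induction m with
    | zero => simp
    | succ m ih =>
      rw [sum_range_succ, ih]
      push_cast
      have : (0 : ℝ) ≤ m := m.cast_nonneg
      field_simp
      ring
  rw [this]
  have : (0 : ℝ) ≤ 1 / ((n : ℝ) + 1) := by positivity
  linarith

theorem le_bdCard (n : ℕ) : half n * (n + 1) ≤ bdCard n := by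
  let f : Fin (half n) × Fin (n + 1) → Bd n := fun p =>
    ⟨(⟨half n + p.1, by have := p.1.2; lia⟩, p.2), Or.inr (Or.inl (Nat.le_add_right _ _))⟩
  have hf : Function.Injective f := by
    intro p q h
    have h1 := congrArg (fun z : Bd n => z.1.1.1) h
    have h2 := congrArg (fun z : Bd n => z.1.2) h
    simp only [f, Nat.add_left_cancel_iff] at h1 h2
    exact Prod.ext (Fin.ext h1) h2
  have := Fintype.card_le_of_injective f hf
  simpa [Fintype.card_prod, bdCard] using this

theorem sum_rowsum_off_le {E : ℝ} (hE : 1 ≤ E) :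
    ∑ v : (net n).Vx, (if OnBd v then 0 else ∑ x, (net n).sw (wt E) v x) ≤
      8 * E * half n * scale n + 10 * E * size n := by
  rw [Fintype.sum_sum_type, Fintype.sum_sigma, Fintype.sum_sum_type, Fintype.sum_sum_type]
  have h1 : ∑ p : Site n, (if OnBd (Sum.inl (Sum.inl p) : (net n).Vx) then 0
      else ∑ x, (net n).sw (wt E) (Sum.inl (Sum.inl p)) x) ≤ 10 * E * size n := by
    calc _ ≤ ∑ p : Site n, 10 * E := by
          refine sum_le_sum fun p _ => ?_
          split_ifs
          · linarith
          · rw [BaseNet.rowsum_inl]; exact bdeg_le hE _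
      _ = _ := by
        simp [size]; ring
  have h2 : ∑ z : Bd n × Bool, (if OnBd (Sum.inl (Sum.inr z) : (net n).Vx) then 0
      else ∑ x, (net n).sw (wt E) (Sum.inl (Sum.inr z)) x) = 0 :=
    sum_eq_zero fun z _ => if_pos trivial
  have h3 : ∑ e, ∑ i, (if OnBd (Sum.inr ⟨Sum.inr e, i⟩ : (net n).Vx) then 0
      else ∑ x, (net n).sw (wt E) (Sum.inr ⟨Sum.inr e, i⟩) x) = 0 :=
    sum_eq_zero fun e _ => sum_eq_zero fun i _ => if_pos trivial
  have h4 : ∑ e, ∑ i, (if OnBd (Sum.inr ⟨Sum.inl e, i⟩ : (net n).Vx) then 0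
      else ∑ x, (net n).sw (wt E) (Sum.inr ⟨Sum.inl e, i⟩) x) ≤ 8 * E * half n * scale n := by
    calc _ ≤ ∑ e : Fin (2 * half n) × Fin n × Bool,
          2 * E * scale n * (1 / (((e.2.1.1 : ℝ) + 1) * (e.2.1.1 + 2))) := by
          refine sum_le_sum fun e _ => ?_
          obtain ⟨t, y, b⟩ := e
          have h5 : ∀ i, (if OnBd (Sum.inr ⟨Sum.inl (t, y, b), i⟩ : (net n).Vx) then 0
              else ∑ x, (net n).sw (wt E) (Sum.inr ⟨Sum.inl (t, y, b), i⟩) x) ≤ 2 * E := by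
            intro i
            rw [if_neg (show ¬ OnBd (Sum.inr ⟨Sum.inl (t, y, b), i⟩ : (net n).Vx) from id), BaseNet.rowsum_inr]
            linarith [wt_le hE (Sum.inl (t, y, b))]
          refine (sum_le_sum fun i _ => h5 i).trans ?_
          rw [sum_const, card_univ, Fintype.card_fin, nsmul_eq_mul]
          have h6 : (((net n).len (Sum.inl (t, y, b)) - 1 : ℕ) : ℝ) ≤
              (net n).len (Sum.inl (t, y, b)) := by exact_mod_cast Nat.sub_le _ _
          rw [len_tree_cast] at h6
          calc _ ≤ (scale n : ℝ) / (((y.1 : ℝ) + 1) * (y.1 + 2)) * (2 * E) := by gcongr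
            _ = _ := by ring
      _ = 2 * half n * (2 * (2 * E * scale n) * ∑ y : Fin n, 1 / (((y.1 : ℝ) + 1) * (y.1 + 2))) := by
          rw [Fintype.sum_prod_type]
          simp only [Fintype.sum_prod_type, sum_const, card_univ, Fintype.card_bool,
            Fintype.card_fin, nsmul_eq_mul, mul_sum]
          push_cast
          refine sum_congr rfl fun y _ => ?_
          ring
      _ ≤ 2 * half n * (2 * (2 * E * scale n) * 1) := by
          have := sum_telescope_le n
          gcongr
      _ = _ := by ring
  linarith

theorem sum_rowsum_ge {E : ℝ} (hE : 1 ≤ E) : 2 * half n * ((n : ℝ) + 1) * scale n ≤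
    ∑ v : (net n).Vx, ∑ x, (net n).sw (wt E) v x := by
  have hpos := (net n).rowsum_pos (wt_pos (n := n) (show 0 < E by linarith)) exists_edge
  have h8 : ∑ e, ∑ i, ∑ x, (net n).sw (wt E) (Sum.inr ⟨e, i⟩) x =
      (∑ e, ∑ i, ∑ x, (net n).sw (wt E) (Sum.inr ⟨Sum.inl e, i⟩) x) +
      ((∑ j, ∑ i, ∑ x, (net n).sw (wt E) (Sum.inr ⟨Sum.inr (Sum.inl j), i⟩) x) +
      ∑ z, ∑ i, ∑ x, (net n).sw (wt E) (Sum.inr ⟨Sum.inr (Sum.inr z), i⟩) x) := by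
    rw [Fintype.sum_sum_type, Fintype.sum_sum_type]
  rw [Fintype.sum_sum_type, Fintype.sum_sigma, h8]
  have h1 : ∑ z : Bd n × Bool, ∑ i, ∑ x, (net n).sw (wt E)
      (Sum.inr ⟨Sum.inr (Sum.inr z), i⟩) x = 4 * bdCard n * ((scale n : ℝ) - 1) := by
    have : ∀ z : Bd n × Bool, ∑ i, ∑ x, (net n).sw (wt E)
      (Sum.inr ⟨Sum.inr (Sum.inr z), i⟩) x = 2 * ((scale n : ℝ) - 1) := by
      intro z
      simp only [BaseNet.rowsum_inr]
      rw [sum_const, card_univ, Fintype.card_fin, nsmul_eq_mul]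
      have h2 : (net n).len (Sum.inr (Sum.inr z)) = scale n := rfl
      rw [h2, Nat.cast_sub (scale_pos n)]
      simp [wt]; ring
    rw [sum_congr rfl fun z _ => this z]
    simp [bdCard]; ring
  have h2 : (half n : ℝ) * (n + 1) ≤ bdCard n := by exact_mod_cast le_bdCard n
  have h3 : (8 : ℝ) ≤ scale n := by exact_mod_cast scale_ge_eight n
  have h4 : 2 * half n * ((n : ℝ) + 1) * scale n ≤ 4 * bdCard n * ((scale n : ℝ) - 1) := by
    nlinarith
  have h5 : 0 ≤ ∑ z, ∑ x, (net n).sw (wt E) (Sum.inl z) x := sum_nonneg fun z _ => (hpos _).le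
  have h6 : 0 ≤ ∑ e, ∑ i, ∑ x, (net n).sw (wt E) (Sum.inr ⟨Sum.inl e, i⟩) x :=
    sum_nonneg fun e _ => sum_nonneg fun i _ => (hpos _).le
  have h7 : 0 ≤ ∑ j, ∑ i, ∑ x, (net n).sw (wt E) (Sum.inr ⟨Sum.inr (Sum.inl j), i⟩) x :=
    sum_nonneg fun e _ => sum_nonneg fun i _ => (hpos _).le
  linarith

/-- The stationary measure concentrates on the blob. -/
theorem sta_off_le {E : ℝ} (hE : 1 ≤ E) :
    ∑ v : (net n).Vx, (if OnBd v then 0 else wSta ((net n).sw (wt E)) v) ≤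
      14 * E / ((n : ℝ) + 1) := by
  have h1 := sum_rowsum_off_le hE (n := n)
  have h2 := sum_rowsum_ge hE (n := n)
  have hL := scale_cast_pos n
  have hh : (0 : ℝ) < half n := by exact_mod_cast half_pos n
  have hLn : (n : ℝ) + 1 ≤ scale n := by
    have h3 : n + 1 ≤ size n := by
      have := half_pos n
      unfold size; nlinarith
    have h4 : size n ≤ size n ^ 3 := Nat.le_self_pow (by norm_num) _
    exact_mod_cast h3.trans (h4.trans (scale_ge n))
  have h3 : ∑ v : (net n).Vx, (if OnBd v then 0 else wSta ((net n).sw (wt E)) v) =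
      (∑ v : (net n).Vx, (if OnBd v then 0 else ∑ x, (net n).sw (wt E) v x)) /
        ∑ v : (net n).Vx, ∑ x, (net n).sw (wt E) v x := by
    rw [sum_div]
    refine sum_congr rfl fun v _ => ?_
    split_ifs
    · rw [zero_div]
    · rfl
  rw [h3, div_le_div_iff₀ (lt_of_lt_of_le (by positivity) h2) (by positivity)]
  have h4 : (size n : ℝ) = 2 * half n * (n + 1) := by unfold size; push_cast; ring
  calc _ ≤ (8 * E * half n * scale n + 10 * E * size n) * ((n : ℝ) + 1) := by gcongr
    _ ≤ 14 * E * (2 * half n * ((n : ℝ) + 1) * scale n) := by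
      rw [h4]
      have h5 := mul_le_mul_of_nonneg_left hLn
        (show 0 ≤ 20 * E * half n * ((n : ℝ) + 1) by positivity)
      nlinarith
    _ ≤ _ := by gcongr

theorem exists_hitting {E : ℝ} (hE : 1 ≤ E) : ∃ K : ℝ, 0 ≤ K ∧ ∀ᶠ n : ℕ in atTop,
    ∃ h : (net n).Vx → ℝ, (∀ v, 0 ≤ h v) ∧
      (∀ v, v ≠ Sum.inl (Sum.inl (origin n).1) →
        (wMat ((net n).sw (wt E))).mulVec h v ≤ h v - 1) ∧
      (∀ v, OnBd v → h v ≤ 4 * (scale n : ℝ) ^ 2) ∧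
      ∑ v, wSta ((net n).sw (wt E)) v * h v ≤ K * n * (scale n : ℝ) ^ 2 := by
  set C := 3 * (E + 1) with hC
  refine ⟨4 + 14 * E * (3 * C + 4), by positivity, ?_⟩
  filter_upwards [eventually_mul_le_size (3 * (1 + E) * (2 * C + 3) + 9), eventually_ge_atTop 1]
    with n hs hn
  have hn1 : (1 : ℝ) ≤ n := by exact_mod_cast hn
  set u := C * ((n : ℝ) ^ 2 + 1 + n) with hu
  have hu0 : 0 ≤ u := by positivity
  have hL2 : (0 : ℝ) < (scale n : ℝ) ^ 2 := pow_pos (scale_cast_pos n) 2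
  have hU0 : ∀ i x, i ≤ n ^ 2 + 1 → x ≤ n →
      0 ≤ (fun i x => 3 * (E + 1) * (scale n : ℝ) ^ 2 * tilt E n i x) i x := fun i x hi hx =>
    mul_nonneg (by positivity) (tilt_nonneg hE hi hx)
  have hU1 : ∀ i x, i ≤ n ^ 2 + 1 → x ≤ n →
      (fun i x => 3 * (E + 1) * (scale n : ℝ) ^ 2 * tilt E n i x) i x ≤
        u * (scale n : ℝ) ^ 2 := fun i x hi hx => by
    have := mul_le_mul_of_nonneg_left (tilt_le hE (n := n) (i := i) (x := x))
      (show 0 ≤ 3 * (E + 1) * (scale n : ℝ) ^ 2 by positivity)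
    refine this.trans_eq ?_
    rw [hu, hC]; ring
  have h0 : ∀ v, 0 ≤ (net n).lift (hitBase fun i x =>
      3 * (E + 1) * (scale n : ℝ) ^ 2 * tilt E n i x) (fun _ => 1) v :=
    (net n).lift_nonneg (fun _ => zero_le_one) (hitBase_nonneg hU0)
  refine ⟨_, h0, ?_, fun v hv => lift_hitBase_le hv, ?_⟩
  · refine hit_supersolution hU0 hU1 hE (fun i x hi _ _ => levelOp_hit hE hi _) ?_
    have h1 : ((n : ℝ) + 1) ^ 2 * (u + 1) + 2 ≤ (2 * C + 3) * ((n : ℝ) + 1) ^ 4 := by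
      have h2 : u + 1 ≤ (C + 1) * ((n : ℝ) + 1) ^ 2 := by rw [hu]; nlinarith
      have h3 : 1 ≤ ((n : ℝ) + 1) ^ 4 := one_le_pow₀ (by linarith)
      have h4 := mul_le_mul_of_nonneg_left h2 (sq_nonneg ((n : ℝ) + 1))
      have hC0 : 0 ≤ C := by positivity
      nlinarith
    have h3 : 1 ≤ ((n : ℝ) + 1) ^ 4 := one_le_pow₀ (by linarith)
    have h4 := mul_le_mul_of_nonneg_left h1 (show 0 ≤ 3 * (1 + E) by linarith)
    have h5 : (0 : ℝ) ≤ size n := Nat.cast_nonneg _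
    linarith
  · have hc := isLazyChain (n := n) (show 0 < E by linarith)
    have h1 := sta_off_le hE (n := n)
    have h2 : u + 4 ≤ (3 * C + 4) * (n : ℝ) ^ 2 := by
      have hC0 : 0 ≤ C := by positivity
      rw [hu]; nlinarith [mul_nonneg hC0 (show (0 : ℝ) ≤ n ^ 2 - n by nlinarith)]
    calc _ ≤ ∑ v, (wSta ((net n).sw (wt E)) v * (4 * (scale n : ℝ) ^ 2) +
          (if OnBd v then 0 else wSta ((net n).sw (wt E)) v) * ((u + 4) * (scale n : ℝ) ^ 2)) := by
          refine sum_le_sum fun v _ => ?_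
          have hp := (hc.prob.1 v).le
          split_ifs with hv
          · rw [zero_mul, add_zero]
            exact mul_le_mul_of_nonneg_left (lift_hitBase_le hv) hp
          · have := mul_le_mul_of_nonneg_left (hit_le hU0 hU1 v) hp
            have h3 : 0 ≤ wSta ((net n).sw (wt E)) v * (4 * (scale n : ℝ) ^ 2) := by positivity
            linarith
      _ = 4 * (scale n : ℝ) ^ 2 + (∑ v : (net n).Vx, (if OnBd v then 0
            else wSta ((net n).sw (wt E)) v)) * ((u + 4) * (scale n : ℝ) ^ 2) := by
          rw [sum_add_distrib, ← sum_mul, ← sum_mul, hc.prob.2, one_mul]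
      _ ≤ 4 * (scale n : ℝ) ^ 2 + 14 * E / ((n : ℝ) + 1) *
            (((3 * C + 4) * (n : ℝ) ^ 2) * (scale n : ℝ) ^ 2) := by gcongr
      _ ≤ 4 * (scale n : ℝ) ^ 2 + 14 * E / n *
            (((3 * C + 4) * (n : ℝ) ^ 2) * (scale n : ℝ) ^ 2) := by
          gcongr; linarith
      _ = 4 * (scale n : ℝ) ^ 2 + 14 * E * (3 * C + 4) * n * (scale n : ℝ) ^ 2 := by
          field_simp
      _ ≤ _ := by nlinarith

end TreeNet

/-! ### Cutoff for the perturbed walk -/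

namespace IsLazyChain
variable {V : Type} [Fintype V] [DecidableEq V] {P : Matrix V V ℝ} {π : V → ℝ}
  (hc : IsLazyChain P π) (A : V → Prop) [DecidablePred A]
include hc

/-- Upper bound for the mixing time: travel to `A`, then from `A` to `o`, then mix from `o`. -/
theorem exists_dTV_le (o : V) {h v H : V → ℝ} {c K η δ m S : ℝ}
    (h0 : ∀ x, 0 ≤ h x) (hs : ∀ x, x ≠ o → P.mulVec h x ≤ h x - 1)
    (hA : ∀ x, A x → h x ≤ 4 * S) (hπ : ∑ x, π x * h x ≤ K * m * S)
    (hv : ∀ x, ¬ A x → P.mulVec v x = v x - 1) (v0 : ∀ x, 0 ≤ v x) (H0 : ∀ x, 0 ≤ H x)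
    (hH : ∀ x, ¬ A x → P.mulVec H x ≤ H x - ∑ y, P x y * (v y - v x) ^ 2)
    (hvM : ∀ x, v x ≤ (c * m ^ 2 + K * m) * S)
    (hHM : ∀ x, ¬ A x → H x ≤ K * m ^ 2 * S ^ 2)
    (hc0 : 0 ≤ c) (hη : 0 < η) (hδ : 0 < δ) (hm : 0 < m) (hS : 0 < S)
    (h1 : K ≤ η * m) (h2 : 9 * K ≤ η * δ ^ 2 * m) (h3 : 12 ≤ η * δ * m ^ 2)
    (h4 : 3 * K ≤ δ * η ^ 2 * m ^ 2) (h5 : 3 ≤ η * m ^ 2 * S) :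
    ∃ T : ℕ, (T : ℝ) ≤ (c + 5 * η) * m ^ 2 * S ∧ dTV P π T ≤ δ := by
  set t := ⌈η * m ^ 2 * S⌉₊ with ht
  set r := ⌈(c + 2 * η) * m ^ 2 * S⌉₊ with hr
  have ht1 : η * m ^ 2 * S ≤ t := Nat.le_ceil _
  have ht2 : (t : ℝ) < η * m ^ 2 * S + 1 := Nat.ceil_lt_add_one (by positivity)
  have hr1 : (c + 2 * η) * m ^ 2 * S ≤ r := Nat.le_ceil _
  have hr2 : (r : ℝ) < (c + 2 * η) * m ^ 2 * S + 1 := Nat.ceil_lt_add_one (by positivity)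
  have hpos : 0 < η * m ^ 2 * S := by positivity
  have e1 : tvDist ((P ^ t) o) π ≤ δ / 3 := by
    have h6 := (hc.mul_tvDist_sq_le o h0 hs t).trans hπ
    by_contra hcon
    push Not at hcon
    have h7 : (2 * (δ / 3)) ^ 2 < (2 * tvDist ((P ^ t) o) π) ^ 2 :=
      pow_lt_pow_left₀ (by linarith) (by positivity) two_ne_zero
    have h8 : η * m ^ 2 * S * (2 * (δ / 3)) ^ 2 < K * m * S :=
      calc _ < η * m ^ 2 * S * (2 * tvDist ((P ^ t) o) π) ^ 2 := by gcongr
        _ ≤ t * (2 * tvDist ((P ^ t) o) π) ^ 2 := by gcongr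
        _ ≤ _ := h6
    have h9 := mul_le_mul_of_nonneg_right h2 (show 0 ≤ m * S by positivity)
    have h10 : 0 < η * δ ^ 2 * m * (m * S) := by positivity
    nlinarith
  have e2 : ∀ x, A x → tvDist ((P ^ (t + t)) x) π ≤ 2 * δ / 3 := by
    intro x hx
    have h6 := hc.tvDist_add_le (fun z => z = o) (θ := δ / 3) (by positivity) (fun z hz => by rw [hz]; exact e1)
      t x
    have h7 := (hc.mul_surv_le (fun z => z = o) h0 hs t x).trans (hA x hx)
    have h8 := hc.surv_nonneg (fun z => z = o) t x
    have h9 : surv P (fun z => z = o) t x ≤ δ / 3 := by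
      by_contra hcon
      push Not at hcon
      have h10 : η * m ^ 2 * S * (δ / 3) < 4 * S :=
        calc _ < η * m ^ 2 * S * surv P (fun z => z = o) t x := by gcongr
          _ ≤ t * surv P (fun z => z = o) t x := by gcongr
          _ ≤ _ := h7
      have h11 := mul_le_mul_of_nonneg_right h3 hS.le
      nlinarith
    linarith
  refine ⟨t + t + r, by push_cast; linarith, hc.dTV_le fun x => ?_⟩
  have h6 := hc.tvDist_add_le A (by positivity) e2 r x
  have h7 : surv P A r x ≤ δ / 3 := by
    by_cases hx : A x
    · rw [surv_of_mem hx]; positivity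
    · have h8 : η * m ^ 2 * S ≤ r - v x := by
        have h9 := mul_le_mul_of_nonneg_right h1 (show 0 ≤ m * S by positivity)
        linarith [hvM x]
      have h9 := (hc.surv_mul_sq_le A hv v0 H0 hH (t := r) (x := x) (by linarith)).trans (hHM x hx)
      by_contra hcon
      push Not at hcon
      have h10 : δ / 3 * (η * m ^ 2 * S) ^ 2 < K * m ^ 2 * S ^ 2 :=
        calc _ < surv P A r x * (η * m ^ 2 * S) ^ 2 := by gcongr
          _ ≤ surv P A r x * (r - v x) ^ 2 := by
            have := hc.surv_nonneg A r x
            gcongr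
          _ ≤ _ := h9
      have h11 := mul_le_mul_of_nonneg_right h4 (show 0 ≤ m ^ 2 * S ^ 2 by positivity)
      nlinarith
  linarith

/-- Lower bound for the mixing time by concentration of the hitting time of `A`. -/
theorem le_mixTime_of_concentration {v H J : V → ℝ} {c K K' η δ m S : ℝ} {x : V} {T : ℕ}
    (hT : dTV P π T ≤ δ)
    (hv : ∀ x, ¬ A x → P.mulVec v x = v x - 1) (H0 : ∀ x, 0 ≤ H x)
    (J0 : ∀ x, 0 ≤ J x)
    (hH : ∀ x, ¬ A x → P.mulVec H x ≤ H x - ∑ y, P x y * (v y - v x) ^ 2)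
    (hJ : ∀ x, ¬ A x → P.mulVec J x ≤ J x)
    (hA : ∀ x, A x → 1 ≤ J x ∨ v x ≤ K * m * S)
    (hvx : (c * m ^ 2 - K * m) * S ≤ v x) (hHx : H x ≤ K * m ^ 2 * S ^ 2) (hJx : J x ≤ K / m)
    (hπ : ∑ y, (if A y then 0 else π y) ≤ K' / m)
    (hη : 0 < η) (hm : 0 < m) (hS : 0 < S)
    (h1 : K ≤ η * m) (h2 : 3 * K < (1 - δ) * (η ^ 2 * m ^ 2)) (h3 : 3 * K < (1 - δ) * m)
    (h4 : 3 * K' < (1 - δ) * m) (h5 : 1 ≤ η * m ^ 2 * S) :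
    (c - 4 * η) * m ^ 2 * S ≤ mixTime P π δ := by
  have hpos : 0 < η * m ^ 2 * S := by positivity
  rcases le_or_gt ((c - 3 * η) * m ^ 2 * S) 0 with h6 | h6
  · exact le_trans (by linarith) (Nat.cast_nonneg _)
  set t := ⌊(c - 3 * η) * m ^ 2 * S⌋₊ with ht
  have ht1 : (t : ℝ) ≤ (c - 3 * η) * m ^ 2 * S := Nat.floor_le h6.le
  have ht2 : (c - 3 * η) * m ^ 2 * S < t + 1 := Nat.lt_floor_add_one _
  have hmS := mul_le_mul_of_nonneg_right h1 (show 0 ≤ m * S by positivity)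
  have h7 := hc.one_sub_surv_le A (m := v x - t) hpos hv H0 J0 hH hJ (fun y hy => by
    rcases hA y hy with h | h
    · exact Or.inl h
    · right; linarith) t x (by ring)
  have h8 := hc.surv_sub_le_tvDist A t x
  have h9 : H x / (η * m ^ 2 * S) ^ 2 < (1 - δ) / 3 := by
    rw [div_lt_iff₀ (by positivity)]
    have := mul_lt_mul_of_pos_right h2 (show 0 < m ^ 2 * S ^ 2 by positivity)
    linarith
  have h10 : K / m < (1 - δ) / 3 := by rw [div_lt_iff₀ hm]; linarith
  have h11 : K' / m < (1 - δ) / 3 := by rw [div_lt_iff₀ hm]; linarith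
  have h12 := hc.le_mixTime (t := t) (x := x) (by linarith) hT
  have h13 : (t : ℝ) ≤ mixTime P π δ := by exact_mod_cast h12
  linarith

end IsLazyChain

theorem eventually_le_mul_cast (K : ℝ) {a : ℝ} (ha : 0 < a) : ∀ᶠ n : ℕ in atTop, K < a * n := by
  filter_upwards [eventually_gt_atTop ⌈K / a⌉₊] with n hn
  have := (Nat.le_ceil (K / a)).trans_lt (Nat.cast_lt.2 hn)
  rwa [div_lt_iff₀' ha] at this

namespace TreeNet

/-- The mixing time of the perturbed walk is asymptotically `c n ^ 2 scale n ^ 2`. -/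
theorem mixing_asymptotics {E : ℝ} (hE : 1 < E) : ∃ (K : ℝ) (c : ℕ → ℝ), 0 < K ∧
    (∀ n, 1 / K ≤ c n ∧ c n ≤ K) ∧ ∀ δ : ℝ, 0 < δ → δ < 1 → ∀ η : ℝ, 0 < η →
      ∀ᶠ n : ℕ in atTop,
        (c n - η) * ((n : ℝ) ^ 2 * (scale n : ℝ) ^ 2) ≤ tmixW ((net n).sw (wt E)) δ ∧
        tmixW ((net n).sw (wt E)) δ ≤ (c n + η) * ((n : ℝ) ^ 2 * (scale n : ℝ) ^ 2) := by
  obtain ⟨K₀, hK₀, hT⟩ := exists_test_functions hE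
  obtain ⟨K₁, hK₁, hH⟩ := exists_hitting hE.le
  choose c' hT using hT
  set c : ℕ → ℝ := fun n => if hn : 1 ≤ n then c' n hn else K₀ with hcdef
  have hcn : ∀ n (hn : 1 ≤ n), c n = c' n hn := fun n hn => dif_pos hn
  refine ⟨K₀, c, by linarith, fun n => ?_, fun δ hδ0 hδ1 η' hη' => ?_⟩
  · by_cases hn : 1 ≤ n
    · obtain ⟨v, H, J, h1, h2, -⟩ := hT n hn
      exact ⟨(hcn n hn).symm ▸ h1, (hcn n hn).symm ▸ h2⟩
    · rw [hcdef]
      simp only [dif_neg hn, le_refl, and_true]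
      rw [div_le_iff₀ (by linarith)]; nlinarith
  set η := η' / 5 with hηdef
  have hη : 0 < η := by positivity
  have hδ : 0 < 1 - δ := by linarith
  filter_upwards [hH, eventually_ge_atTop 1,
    eventually_le_mul_cast (K₀ + K₁) hη,
    eventually_le_mul_cast (9 * (K₀ + K₁)) (show 0 < η * δ ^ 2 by positivity),
    eventually_le_mul_cast 12 (show 0 < η * δ by positivity),
    eventually_le_mul_cast (3 * (K₀ + K₁)) (show 0 < δ * η ^ 2 by positivity),
    eventually_le_mul_cast 3 hη,
    eventually_le_mul_cast (3 * (K₀ + K₁)) (show 0 < (1 - δ) * η ^ 2 by positivity),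
    eventually_le_mul_cast (3 * (K₀ + K₁)) hδ,
    eventually_le_mul_cast (3 * (14 * E)) hδ] with n ⟨h, h0, hs, hA, hπ⟩ hn a1 a2 a3 a4 a5 a6 a7 a8
  obtain ⟨v, H, J, bc, -, b1, b2, b3, b4, b5, b6, b7, b8, b9, b10, b11, b12⟩ := hT n hn
  rw [← hcn n hn] at bc b8 b10
  have hn1 : (1 : ℝ) ≤ n := by exact_mod_cast hn
  have hnn : (n : ℝ) ≤ (n : ℝ) ^ 2 := by nlinarith
  have hS1 : (1 : ℝ) ≤ (scale n : ℝ) ^ 2 := by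
    have : (8 : ℝ) ≤ scale n := by exact_mod_cast scale_ge_eight n
    nlinarith
  have hS4 : (scale n : ℝ) ^ 4 = ((scale n : ℝ) ^ 2) ^ 2 := by ring
  have hc0 : 0 ≤ c n := le_trans (by positivity) bc
  rw [hS4] at b9 b11
  have hlc := isLazyChain (n := n) (show 0 < E by linarith)
  have up : ∀ {a : ℝ}, 0 < a → a * n ≤ a * (n : ℝ) ^ 2 := fun ha =>
    mul_le_mul_of_nonneg_left hnn ha.le
  have b5' : 3 < η * (n : ℝ) ^ 2 * (scale n : ℝ) ^ 2 := by
    have := up hη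
    nlinarith
  have hKm : ∀ {a : ℝ}, 0 ≤ a → K₀ * a ≤ (K₀ + K₁) * a := fun ha =>
    mul_le_mul_of_nonneg_right (by linarith) ha
  obtain ⟨T, hT1, hT2⟩ := hlc.exists_dTV_le OnBd (Sum.inl (Sum.inl (origin n).1))
    (K := K₀ + K₁) (c := c n) (η := η) (δ := δ) (m := n) (S := (scale n : ℝ) ^ 2) h0 hs hA
    (hπ.trans (by rw [mul_assoc, mul_assoc]; exact mul_le_mul_of_nonneg_right (by linarith) (by positivity)))
    b1 b2 b3 b5 (fun x => (b8 x).trans (by gcongr; linarith))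
    (fun x hx => (b9 x hx).trans (by gcongr; linarith)) hc0 hη hδ0 (by linarith) (by linarith)
    a1.le a2.le (a3.le.trans (up (by positivity))) (a4.le.trans (up (by positivity))) b5'.le
  constructor
  · have := hlc.le_mixTime_of_concentration OnBd (K := K₀ + K₁) (K' := 14 * E) (c := c n)
      (η := η) (m := n) (S := (scale n : ℝ) ^ 2) (x := start n) hT2 b1 b3 b4 b5 b6
      (fun x hx => (b7 x hx).imp_right fun h => h.trans (by gcongr; linarith))
      (le_trans (by gcongr; linarith) b10) (b11.trans (by gcongr; linarith))
      (b12.trans (by gcongr; linarith))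
      ((sta_off_le hE.le).trans (by gcongr; linarith)) hη (by linarith) (by linarith) a1.le
      (a6.trans_le (by rw [← mul_assoc]; exact up (by positivity))) a7 a8 (by linarith)
    refine le_trans ?_ this
    rw [mul_assoc]
    gcongr
    linarith
  · have h1 : (tmixW ((net n).sw (wt E)) δ : ℝ) ≤ T := by
      exact_mod_cast Nat.sInf_le hT2
    refine h1.trans (hT1.trans ?_)
    rw [mul_assoc]
    gcongr
    linarith

/-- Cutoff for the perturbed walk. -/
theorem tendsto_tmixW_div {E : ℝ} (hE : 1 < E) {δ : ℝ} (hδ0 : 0 < δ) (hδ1 : δ < 1) :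
    Tendsto (fun n => (tmixW ((net n).sw (wt E)) δ : ℝ) / (tmixW ((net n).sw (wt E)) (1 - δ) : ℝ))
      atTop (nhds 1) := by
  obtain ⟨K, c, hK, hc, h⟩ := mixing_asymptotics hE
  rw [Metric.tendsto_nhds]
  intro e he
  set η := min (1 / (2 * K)) (e / (8 * K)) with hη
  have hη0 : 0 < η := by positivity
  filter_upwards [h δ hδ0 hδ1 η hη0, h (1 - δ) (by linarith) (by linarith) η hη0,
    eventually_ge_atTop 1] with n ⟨h1, h2⟩ ⟨h3, h4⟩ hn
  have hn1 : (1 : ℝ) ≤ n := by exact_mod_cast hn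
  have hτ : 0 < (n : ℝ) ^ 2 * (scale n : ℝ) ^ 2 := by
    have := scale_cast_pos n
    positivity
  set τ := (n : ℝ) ^ 2 * (scale n : ℝ) ^ 2
  have hη1 : η ≤ 1 / (2 * K) := min_le_left _ _
  have hη2 : η ≤ e / (8 * K) := min_le_right _ _
  have h5 : 1 / (2 * K) * τ ≤ tmixW ((net n).sw (wt E)) (1 - δ) := by
    refine le_trans (mul_le_mul_of_nonneg_right ?_ hτ.le) h3
    have : 1 / K = 1 / (2 * K) + 1 / (2 * K) := by field_simp; norm_num
    linarith [(hc n).1]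
  have h6 : 0 < (tmixW ((net n).sw (wt E)) (1 - δ) : ℝ) := lt_of_lt_of_le (by positivity) h5
  rw [Real.dist_eq, div_sub_one h6.ne', abs_div, abs_of_pos h6, div_lt_iff₀ h6]
  have h7 : |(tmixW ((net n).sw (wt E)) δ : ℝ) - tmixW ((net n).sw (wt E)) (1 - δ)| ≤ 2 * η * τ :=
    abs_le.2 ⟨by linarith, by linarith⟩
  calc _ ≤ 2 * η * τ := h7
    _ ≤ 2 * (e / (8 * K)) * τ := by gcongr
    _ = e * (1 / (2 * K) * τ) / 2 := by field_simp; ring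
    _ < e * (1 / (2 * K) * τ) := half_lt_self (by positivity)
    _ ≤ _ := by gcongr

end TreeNet

/-! ### Counting vertices and transport to `Fin N` -/

namespace TreeNet
variable {n : ℕ}

theorem size_eq (n : ℕ) : size n = 2 ^ (n ^ 2 + 1) * (n + 1) := by
  unfold size half; ring

theorem card_le (hn : 1 ≤ n) : Fintype.card (net n).Vx ≤ 2 ^ (17 * n ^ 2) := by
  have h1 : ∀ e, Fintype.card (Fin ((net n).len e - 1)) ≤ scale n := by
    intro e
    rw [Fintype.card_fin]
    have : (net n).len e ≤ scale n := by exact_mod_cast len_le_scale e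
    lia
  have hb := bdCard_le n
  have hs : 2 * half n * n + 2 * half n = size n := by unfold size; ring
  have h2 : Fintype.card (net n).Vx ≤ 3 * size n + 5 * size n * scale n := by
    rw [Fintype.card_sum, Fintype.card_sigma]
    refine add_le_add ?_ ((sum_le_sum fun e _ => h1 e).trans ?_)
    · simp only [Fintype.card_sum, Fintype.card_prod, Fintype.card_fin, Fintype.card_bool]
      rw [show Fintype.card (Bd n) = bdCard n from rfl]
      have : 2 * half n * (n + 1) = size n := rfl
      lia
    · rw [sum_const, card_univ, smul_eq_mul]
      refine Nat.mul_le_mul_right _ ?_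
      simp only [Fintype.card_sum, Fintype.card_prod, Fintype.card_fin, Fintype.card_bool]
      rw [show Fintype.card (Bd n) = bdCard n from rfl]
      have : 2 * half n * (n * 2) = 2 * (2 * half n * n) := by ring
      lia
  have h3 : n + 1 ≤ 2 ^ n := Nat.lt_two_pow_self
  have h4 : (n + 1).factorial ≤ 2 ^ (n * (n + 1)) := by
    rw [pow_mul]
    exact (Nat.factorial_le_pow _).trans (Nat.pow_le_pow_left h3 _)
  have h5 : size n ≤ 2 ^ (n ^ 2 + 1 + n) := by
    rw [size_eq, pow_add _ (n ^ 2 + 1)]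
    exact Nat.mul_le_mul_left _ h3
  have h6 := scale_ge_eight n
  calc _ ≤ _ := h2
    _ ≤ 8 * (size n * scale n) := by
      have := Nat.mul_le_mul_left (size n) h6
      nlinarith
    _ ≤ 2 ^ 3 * (2 ^ (n ^ 2 + 1 + n) * (2 ^ (n * (n + 1)) * (2 ^ (n ^ 2 + 1 + n)) ^ 3)) := by
      unfold scale
      gcongr
      norm_num
    _ = 2 ^ (3 + (n ^ 2 + 1 + n + (n * (n + 1) + (n ^ 2 + 1 + n) * 3))) := by
      rw [← pow_mul, ← pow_add, ← pow_add, ← pow_add]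
    _ ≤ _ := Nat.pow_le_pow_right (by norm_num) (by nlinarith)

theorem log_card_le (hn : 1 ≤ n) : Real.log (Fintype.card (net n).Vx) ≤ 17 * (n : ℝ) ^ 2 := by
  have h1 : (Fintype.card (net n).Vx : ℝ) ≤ 2 ^ (17 * n ^ 2) := by exact_mod_cast card_le hn
  have h0 : (0 : ℝ) < Fintype.card (net n).Vx := by exact_mod_cast Fintype.card_pos
  calc _ ≤ Real.log (2 ^ (17 * n ^ 2)) := Real.log_le_log h0 h1
    _ = 17 * (n : ℝ) ^ 2 * Real.log 2 := by rw [Real.log_pow]; push_cast; ring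
    _ ≤ 17 * (n : ℝ) ^ 2 * 1 := by
      have : Real.log 2 ≤ 1 := by linarith [Real.log_two_lt_d9]
      gcongr
    _ = _ := mul_one _

theorem le_card (n : ℕ) : n ≤ Fintype.card (net n).Vx := by
  have h := Fintype.card_le_of_injective
    (fun x : Fin (n + 1) => (Sum.inl (Sum.inl (⟨0, by have := half_pos n; lia⟩, x)) : (net n).Vx))
    (fun x y h => (Prod.mk.inj (Sum.inl.inj (Sum.inl.inj h))).2)
  rw [Fintype.card_fin] at h
  lia

theorem wt_eq (E : ℝ) (e : Edge n) : wt E e = 1 ∨ wt E e = E := by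
  rcases e with ⟨t, y, b⟩ | j
  · cases b
    · exact Or.inr rfl
    · exact Or.inl rfl
  · exact Or.inl rfl

end TreeNet

section relabel
variable {V W : Type} [Fintype V] [DecidableEq V] [Fintype W] [DecidableEq W]

theorem adjW_comap (e : W ≃ V) (G : SimpleGraph V) :
    adjW (G.comap e) = fun a b => adjW G (e a) (e b) := rfl

theorem deg_comap (e : W ≃ V) (G : SimpleGraph V) (a : W) : deg (G.comap e) a = deg G (e a) :=
  Nat.card_congr (e.subtypeEquiv fun _ => Iff.rfl)

theorem connected_comap (e : W ≃ V) {G : SimpleGraph V} (h : G.Connected) :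
    (G.comap e).Connected :=
  (SimpleGraph.Iso.connected_iff (SimpleGraph.Iso.comap e G)).2 h

end relabel

namespace TreeNet

/-- Number of vertices of the `n`-th graph. -/
def numVertices (n : ℕ) : ℕ := Fintype.card (net (n + 3)).Vx

/-- Numbering of the vertices of the `n`-th graph. -/
def numbering (n : ℕ) : Fin (numVertices n) ≃ (net (n + 3)).Vx := (Fintype.equivFin _).symm

/-- The graphs of the main theorem. -/
def finGraph (n : ℕ) : SimpleGraph (Fin (numVertices n)) := (net (n + 3)).graph.comap (numbering n)

/-- The edge weights of the main theorem. -/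
def finWeight (E : ℝ) (n : ℕ) (a b : Fin (numVertices n)) : ℝ :=
  (net (n + 3)).sw (wt E) (numbering n a) (numbering n b)

theorem adjW_finGraph (n : ℕ) : adjW (finGraph n) = finWeight 1 n := by
  rw [finGraph, adjW_comap, BaseNet.adjW_graph]
  unfold finWeight
  rw [wt_one]

theorem tmixW_finWeight (E : ℝ) (n : ℕ) (δ : ℝ) :
    tmixW (finWeight E n) δ = tmixW ((net (n + 3)).sw (wt E)) δ :=
  tmixW_relabel (numbering n) _ δ

theorem tmixG_finGraph (n : ℕ) (δ : ℝ) :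
    tmixG (finGraph n) δ = tmixW ((net (n + 3)).sw (wt 1)) δ := by
  rw [tmixG_eq, adjW_finGraph, tmixW_finWeight]

theorem trelG_finGraph (n : ℕ) :
    trelG (finGraph n) = trel (wMat ((net (n + 3)).sw (wt 1))) := by
  rw [trelG_eq, adjW_finGraph]
  exact trel_relabel (numbering n) _

theorem goodWeights_finWeight {E : ℝ} (hE : 0 < E) (n : ℕ) :
    GoodWeights (finGraph n) (finWeight E n) := by
  obtain ⟨h1, h2, h3⟩ := (net (n + 3)).goodWeights_sw (wt_pos hE)
  exact ⟨fun u v => h1 _ _, fun u v h => h2 _ _ h, fun u v h => h3 _ _ h⟩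

theorem log_mul_tmix_le {E : ℝ} (hE : 1 < E) : ∃ c : ℝ, 0 < c ∧ ∀ᶠ n : ℕ in atTop,
    c * Real.log (Fintype.card (net n).Vx) * (tmixW ((net n).sw (wt 1)) (1 / 4) : ℝ) ≤
      (tmixW ((net n).sw (wt E)) (1 / 4) : ℝ) := by
  obtain ⟨K, c, hK, hc, h⟩ := mixing_asymptotics hE
  refine ⟨1 / (2 * K) / 3400, by positivity, ?_⟩
  filter_upwards [h (1 / 4) (by norm_num) (by norm_num) (1 / (2 * K)) (by positivity),
    eventually_ge_atTop 3] with n ⟨h1, _⟩ hn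
  refine le_trans ?_ h1
  have h2 : 1 / (2 * K) ≤ c n - 1 / (2 * K) := by
    have : 1 / K = 1 / (2 * K) + 1 / (2 * K) := by field_simp; norm_num
    linarith [(hc n).1]
  calc _ ≤ 1 / (2 * K) / 3400 * (17 * (n : ℝ) ^ 2) * (200 * (scale n : ℝ) ^ 2) := by
        gcongr
        · exact log_card_le (by lia)
        · exact tmixW_one_le hn
    _ = 1 / (2 * K) * ((n : ℝ) ^ 2 * (scale n : ℝ) ^ 2) := by ring
    _ ≤ _ := by gcongr

end TreeNet

/-- **Theorem 3(a).** A sequence of bounded degree graphs with `t_rel = Θ(t_mix)` such that,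
for every `ε > 0`, increasing some edge weights to `1 + ε` increases the mixing time by a
factor of `c_ε log |V_n|`, and the perturbed walks exhibit cutoff. -/
theorem bounded_perturbation_increases_mixing_by_log_factor :
    ∃ (D : ℕ) (N : ℕ → ℕ) (G : ∀ n, SimpleGraph (Fin (N n))),
      (∀ n, (G n).Connected) ∧
      (∀ n v, deg (G n) v ≤ D) ∧
      Tendsto N atTop atTop ∧
      -- t_rel(G_n) = Θ(t_mix(G_n)), so the LSRWs lack pre-cutoff
      (∃ c C : ℝ, 0 < c ∧ 0 < C ∧ ∀ n,
        c * (tmixG (G n) (1/4) : ℝ) ≤ trelG (G n) ∧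
        trelG (G n) ≤ C * (tmixG (G n) (1/4) : ℝ)) ∧
      -- for every ε > 0, a perturbation with weights in {1, 1+ε}
      (∀ ε : ℝ, 0 < ε →
        ∃ cε : ℝ, 0 < cε ∧
        ∃ w : ∀ n, Fin (N n) → Fin (N n) → ℝ,
          (∀ n, GoodWeights (G n) (w n)) ∧
          (∀ n u v, (G n).Adj u v → w n u v = 1 ∨ w n u v = 1 + ε) ∧
          (∀ᶠ n in atTop,
            cε * Real.log (N n) * (tmixG (G n) (1/4) : ℝ) ≤ (tmixW (w n) (1/4) : ℝ)) ∧
          -- the walks on the perturbed networks exhibit total variation cutoff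
          (∀ δ : ℝ, 0 < δ → δ ≤ 1/2 →
            Tendsto (fun n => (tmixW (w n) δ : ℝ) / (tmixW (w n) (1 - δ) : ℝ))
              atTop (nhds 1))) := by
  refine ⟨10, TreeNet.numVertices, TreeNet.finGraph,
    fun n => connected_comap _ (TreeNet.graph_connected (by lia)),
    fun n v => (deg_comap _ _ v).trans_le (TreeNet.deg_le_ten _),
    tendsto_atTop_mono (fun n => (Nat.le_add_right n 3).trans (TreeNet.le_card (n + 3))) tendsto_id,
    ⟨1 / 200, 2, by norm_num, by norm_num, fun n => ?_⟩, fun ε hε => ?_⟩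
  · rw [TreeNet.tmixG_finGraph, TreeNet.trelG_finGraph]
    have h1 := TreeNet.trel_one_bounds (n := n + 3) (by lia)
    have h2 := TreeNet.tmixW_one_le (n := n + 3) (by lia)
    exact ⟨by linarith [h1.1], h1.2⟩
  · obtain ⟨c, hc, h⟩ := TreeNet.log_mul_tmix_le (show 1 < 1 + ε by linarith)
    refine ⟨c, hc, TreeNet.finWeight (1 + ε), TreeNet.goodWeights_finWeight (by linarith),
      fun n u v huv => ?_, ?_, fun δ h0 h1 => ?_⟩
    · obtain ⟨e, he⟩ := (TreeNet.net (n + 3)).sw_cases (TreeNet.wt (1 + ε)) huv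
      rw [TreeNet.finWeight, he]
      exact TreeNet.wt_eq _ e
    · filter_upwards [(tendsto_add_atTop_nat 3).eventually h] with n hn
      rw [TreeNet.tmixG_finGraph, TreeNet.tmixW_finWeight]
      exact hn
    · simp only [TreeNet.tmixW_finWeight]
      exact (TreeNet.tendsto_tmixW_div (show 1 < 1 + ε by linarith) h0 (by linarith)).comp
        (tendsto_add_atTop_nat 3)

end
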